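/- arXiv:1010.4496 — 4 statements merged into one kernel-verified Lean document; each statement's English description precedes it below -/
import Mathlib

section
/- Let A ⊆ ℝ be a set having 0 as an accumulation point, and let (f_s)_{s ∈ A} be holomorphic injective maps on the unit disk 𝔻 with f_s(0) = 0 and f_s'(0) = e^{2πis}, commuting pairwise on a neighborhood of 0. Then for every t in the closure of A there exists a unique holomorphic injective map f_t : 𝔻 → ℂ with f_t(0) = 0 and f_t'(0) = e^{2πit} which commutes with every f_s (s ∈ A) on a neighborhood of 0; moreover, for every sequence (t_n) in A with t_n → t, the maps f_{t_n} converge to f_t uniformly on compact subsets of 𝔻. In particular, if K ⊆ 𝔻 is a compact set with f_s(K) = K for all s ∈ A, then f_t(K) = K for every t in the closure of A. -/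
open Complex Metric Set Filter

noncomputable section

/-- The property of being a univalent map of the unit disk fixing `0` with derivative
`e^{2πit}` at `0` and commuting near `0` with every member `f_s`, `s ∈ A`, of a given
family. -/
def IsCommutingExtension (A : Set ℝ) (f : ℝ → ℂ → ℂ) (t : ℝ) (g : ℂ → ℂ) : Prop :=
  DifferentiableOn ℂ g (Metric.ball 0 1) ∧
  Set.InjOn g (Metric.ball 0 1) ∧
  g 0 = 0 ∧
  deriv g 0 = Complex.exp (2 * Real.pi * Complex.I * t) ∧
  ∀ s ∈ A, ∀ᶠ z in nhds (0 : ℂ), g (f s z) = f s (g z)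

/-- A weak form of **Bloch's theorem**: if the image of the unit disk under a holomorphic map
contains no disk of radius `R`, then the derivative of the map is controlled by `R`. -/
theorem norm_deriv_mul_le_of_not_ball_subset_image {L : ℂ → ℂ} {R : ℝ} (hR : 0 < R)
    (hL : DifferentiableOn ℂ L (ball 0 1)) (hball : ∀ c, ¬ ball c R ⊆ L '' ball 0 1)
    {z : ℂ} (hz : z ∈ ball (0 : ℂ) 1) : ‖deriv L z‖ * (1 - ‖z‖) ≤ 96 * R := by
  rw [mem_ball_zero_iff] at hz
  set ρ : ℝ := (1 + ‖z‖) / 2 with hρ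
  have hzρ : ‖z‖ < ρ := by rw [hρ]; linarith
  have hρ1 : ρ < 1 := by rw [hρ]; linarith
  have hdL : DifferentiableOn ℂ (deriv L) (ball 0 1) := hL.deriv isOpen_ball
  have hcont : ContinuousOn (fun w => ‖deriv L w‖ * (ρ - ‖w‖)) (closedBall 0 ρ) :=
    ((hdL.continuousOn.mono (closedBall_subset_ball hρ1)).norm).mul (by fun_prop)
  obtain ⟨a, haρ, hmax⟩ := (isCompact_closedBall (0 : ℂ) ρ).exists_isMaxOn
    ⟨z, by simpa using hzρ.le⟩ hcont
  rw [mem_closedBall_zero_iff] at haρ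
  have hza : ‖deriv L z‖ * (ρ - ‖z‖) ≤ ‖deriv L a‖ * (ρ - ‖a‖) :=
    hmax (by simpa using hzρ.le : z ∈ closedBall (0 : ℂ) ρ)
  suffices h : ‖deriv L a‖ * (ρ - ‖a‖) ≤ 48 * R by
    have : ρ - ‖z‖ = (1 - ‖z‖) / 2 := by rw [hρ]; ring
    rw [this] at hza
    linarith
  by_contra! hlt
  set D := ‖deriv L a‖ with hD
  have hDpos : 0 < D := by
    rcases (norm_nonneg (deriv L a)).eq_or_lt with h | h
    · rw [hD, ← h] at hlt; linarith
    · exact h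
  set t : ℝ := (ρ - ‖a‖) / 2 with ht
  have ht0 : 0 < t := by
    by_contra! h
    have : D * (ρ - ‖a‖) ≤ 0 := mul_nonpos_of_nonneg_of_nonpos hDpos.le (by linarith)
    linarith
  have hsub : ball a t ⊆ ball 0 ρ := by
    refine ball_subset_ball' ?_
    rw [dist_zero_right]; linarith
  have hsub1 : ball a t ⊆ ball 0 1 := hsub.trans (ball_subset_ball hρ1.le)
  have hbound : ∀ w ∈ ball a t, ‖deriv L w‖ ≤ 2 * D := by
    intro w hw
    have h1 : ‖deriv L w‖ * (ρ - ‖w‖) ≤ D * (ρ - ‖a‖) :=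
      hmax (ball_subset_closedBall (hsub hw))
    have h2 : t ≤ ρ - ‖w‖ := by
      have : ‖w‖ ≤ ‖w - a‖ + ‖a‖ := by simpa using norm_add_le (w - a) a
      rw [mem_ball, dist_eq_norm] at hw
      linarith
    have h3 : ‖deriv L w‖ * t ≤ 2 * D * t := by
      calc ‖deriv L w‖ * t ≤ ‖deriv L w‖ * (ρ - ‖w‖) := by gcongr
        _ ≤ D * (ρ - ‖a‖) := h1
        _ = 2 * D * t := by rw [ht]; ring
    exact le_of_mul_le_mul_right h3 ht0
  have hschwarz : ∀ w ∈ closedBall a (t / 6), ‖deriv L w - deriv L a‖ ≤ D / 2 := by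
    intro w hw
    have hw' : w ∈ ball a t := closedBall_subset_ball (by linarith) hw
    have hmaps : MapsTo (deriv L) (ball a t) (closedBall (deriv L a) (3 * D)) := by
      intro v hv
      rw [mem_closedBall, dist_eq_norm]
      linarith [norm_sub_le (deriv L v) (deriv L a), hbound v hv]
    have := dist_le_div_mul_dist_of_mapsTo_ball (hdL.mono hsub1) hmaps hw'
    rw [dist_eq_norm] at this
    calc _ ≤ 3 * D / t * dist w a := this
      _ ≤ 3 * D / t * (t / 6) := by gcongr; exact hw
      _ = D / 2 := by field_simp; norm_num
  have hsub6 : closedBall a (t / 6) ⊆ ball 0 1 :=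
    (closedBall_subset_ball (by linarith)).trans hsub1
  have hdiffAt : ∀ w ∈ ball (0 : ℂ) 1, DifferentiableAt ℂ L w := fun w hw =>
    hL.differentiableAt (isOpen_ball.mem_nhds hw)
  have hlower : ∀ w ∈ sphere a (t / 6), D * t / 12 ≤ ‖L w - L a‖ := by
    intro w hw
    have hmv := (convex_closedBall a (t / 6)).norm_image_sub_le_of_norm_hasDerivWithin_le
      (f := fun v => L v - deriv L a * v) (f' := fun v => deriv L v - deriv L a) (C := D / 2)
      (x := a) (y := w)
      (fun v hv => by
        have h1 := (hdiffAt v (hsub6 hv)).hasDerivAt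
        simpa using (h1.fun_sub ((hasDerivAt_id v).const_mul (deriv L a))).hasDerivWithinAt)
      hschwarz (mem_closedBall_self (by positivity)) (sphere_subset_closedBall hw)
    rw [mem_sphere, dist_eq_norm] at hw
    have h2 : ‖deriv L a * (w - a)‖ = D * (t / 6) := by rw [norm_mul, hw]
    have h3 : deriv L a * (w - a) =
      (L w - L a) - ((L w - deriv L a * w) - (L a - deriv L a * a)) := by ring
    have h4 := norm_sub_le (L w - L a) ((L w - deriv L a * w) - (L a - deriv L a * a))
    rw [← h3, h2] at h4
    rw [hw] at hmv
    linarith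
  have hfreq : ∃ᶠ v in nhds a, L v ≠ L a := by
    have h := (hdiffAt a (hsub1 (mem_ball_self ht0))).hasDerivAt.eventually_ne
      (c := L a) (norm_pos_iff.1 hDpos)
    exact h.frequently.filter_mono nhdsWithin_le_nhds
  have himage := DiffContOnCl.ball_subset_image_closedBall
    (hL.diffContOnCl_ball hsub6) (by positivity) hlower hfreq
  refine hball (L a) ((ball_subset_ball ?_).trans (himage.trans (image_mono hsub6)))
  have : D * (ρ - ‖a‖) = 2 * (D * t) := by rw [ht]; ring
  linarith

/-- A univalent map of the unit disk, normalized at the origin, omits a value of norm at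
most `2`. -/
theorem exists_notMem_image_ball_of_injOn {f : ℂ → ℂ} (hf : DifferentiableOn ℂ f (ball 0 1))
    (hinj : InjOn f (ball 0 1)) (h0 : f 0 = 0) (hd : ‖deriv f 0‖ = 1) :
    ∃ w, ‖w‖ ≤ 2 ∧ w ∉ f '' ball 0 1 := by
  by_contra! hcon
  have h0mem : (0 : ℂ) ∈ ball (0 : ℂ) 1 := mem_ball_self one_pos
  have hopen : ∀ s ⊆ ball (0 : ℂ) 1, IsOpen s → IsOpen (f '' s) := by
    refine ((hf.analyticOnNhd isOpen_ball).is_constant_or_isOpen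
      (convex_ball (0 : ℂ) 1).isPreconnected).resolve_left ?_
    rintro ⟨w, hw⟩
    have h12 : (1 / 2 : ℂ) ∈ ball (0 : ℂ) 1 := by norm_num
    have := hinj h12 h0mem ((hw _ h12).trans (hw _ h0mem).symm)
    norm_num at this
  set F : ball (0 : ℂ) 1 → ℂ := (ball (0 : ℂ) 1).domRestrict f with hF
  have hemb : Topology.IsOpenEmbedding F := by
    refine .of_continuous_injective_isOpenMap
      (continuousOn_iff_continuous_domRestrict.1 hf.continuousOn)
      (injOn_iff_injective.1 hinj) ?_
    intro s hs
    have : F '' s = f '' (Subtype.val '' s) := by rw [image_image]; rfl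
    rw [this]
    exact hopen _ (by simp) (isOpen_ball.isOpenMap_subtype_val s hs)
  have hcompact : IsCompact (Subtype.val '' (F ⁻¹' closedBall 0 2)) := by
    refine IsCompact.image ?_ continuous_subtype_val
    refine hemb.isInducing.isCompact_preimage' (isCompact_closedBall _ _) ?_
    intro w hw
    obtain ⟨z, hz, rfl⟩ := hcon w (by simpa using hw)
    exact ⟨⟨z, hz⟩, rfl⟩
  set K : Set ℂ := Subtype.val '' (F ⁻¹' closedBall 0 2) with hK
  have hmemK : ∀ z, z ∈ K ↔ z ∈ ball (0 : ℂ) 1 ∧ ‖f z‖ ≤ 2 := by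
    intro z
    simp [hK, hF, and_comm]
  set U : Set ℂ := ball 0 1 ∩ f ⁻¹' ball 0 2 with hU
  have hUopen : IsOpen U := hf.continuousOn.isOpen_inter_preimage isOpen_ball isOpen_ball
  have hUK : U ⊆ K := fun z hz => (hmemK z).2 ⟨hz.1, by simpa using ball_subset_closedBall hz.2⟩
  have hclU : closure U ⊆ K := closure_minimal hUK hcompact.isClosed
  have hds : DifferentiableOn ℂ (dslope f 0) (ball 0 1) :=
    (differentiableOn_dslope (isOpen_ball.mem_nhds h0mem)).2 hf
  have hne : ∀ z ∈ ball (0 : ℂ) 1, dslope f 0 z ≠ 0 := by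
    intro z hz
    rcases eq_or_ne z 0 with rfl | hz0
    · rw [dslope_same, ← norm_pos_iff, hd]; exact one_pos
    · rw [dslope_of_ne _ hz0, slope_def_field, h0]
      refine div_ne_zero ?_ (by simpa using hz0)
      intro h
      exact hz0 (hinj hz h0mem (by simpa [h0] using h))
  have hmaxp := norm_le_of_forall_mem_frontier_norm_le (f := fun z => (dslope f 0 z)⁻¹)
    (U := U) (C := 1 / 2) (z := 0) (isBounded_ball.subset inter_subset_left)
    (DifferentiableOn.diffContOnCl
      ((hds.inv hne).mono (hclU.trans fun z hz => ((hmemK z).1 hz).1)))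
    (fun z hz => ?_) (subset_closure ⟨h0mem, by simp [h0]⟩)
  · rw [dslope_same, norm_inv, hd] at hmaxp
    norm_num at hmaxp
  · obtain ⟨hz1, hz2⟩ := (hmemK z).1 (hclU hz.1)
    have hzU : z ∉ U := by
      have := hz.2
      rwa [hUopen.interior_eq] at this
    have hge : 2 ≤ ‖f z‖ := by
      by_contra! h
      exact hzU ⟨hz1, by simpa using h⟩
    have hz0 : z ≠ 0 := by
      rintro rfl
      norm_num [h0] at hge
    rw [dslope_of_ne _ hz0, slope_def_field, h0, sub_zero, sub_zero, inv_div, norm_div,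
      div_le_iff₀ (by linarith)]
    rw [mem_ball_zero_iff] at hz1
    linarith

/-- Univalent maps of the unit disk, normalized at the origin, are locally uniformly bounded. -/
theorem norm_le_of_injOn_ball {f : ℂ → ℂ} (hf : DifferentiableOn ℂ f (ball 0 1))
    (hinj : InjOn f (ball 0 1)) (h0 : f 0 = 0) (hd : ‖deriv f 0‖ = 1) {r : ℝ} (hr : r < 1)
    {z : ℂ} (hz : ‖z‖ ≤ r) : ‖f z‖ ≤ 2 * (1 + Real.exp (384 / (1 - r))) := by
  obtain ⟨w, hw2, hw⟩ := exists_notMem_image_ball_of_injOn hf hinj h0 hd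
  have h0mem : (0 : ℂ) ∈ ball (0 : ℂ) 1 := mem_ball_self one_pos
  have hw0 : w ≠ 0 := by
    rintro rfl
    exact hw ⟨0, h0mem, h0⟩
  set g : ℂ → ℂ := fun z => 1 - f z / w with hg
  have hgd : DifferentiableOn ℂ g (ball 0 1) := (hf.div_const w).const_sub 1
  have hgne : ∀ z ∈ ball (0 : ℂ) 1, g z ≠ 0 := by
    intro z hz h
    refine hw ⟨z, hz, ?_⟩
    rw [hg, sub_eq_zero, eq_comm, div_eq_one_iff_eq hw0] at h
    exact h
  have hg0 : g 0 = 1 := by simp [hg, h0]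
  obtain ⟨L', hL'⟩ := ((hgd.deriv isOpen_ball).div hgd hgne).isExactOn_ball
  set L : ℂ → ℂ := fun z => L' z - L' 0 with hLdef
  have hL : ∀ z ∈ ball (0 : ℂ) 1, HasDerivAt L (deriv g z / g z) z :=
    fun z hz => (hL' z hz).sub_const _
  have hL0 : L 0 = 0 := sub_self _
  have hLd : DifferentiableOn ℂ L (ball 0 1) :=
    fun z hz => (hL z hz).differentiableAt.differentiableWithinAt
  have hexp : ∀ z ∈ ball (0 : ℂ) 1, exp (L z) = g z := by
    intro z hz
    have hder : ∀ v ∈ ball (0 : ℂ) 1, HasDerivAt (fun v => g v * exp (-L v)) 0 v := by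
      intro v hv
      have h1 := (hgd.differentiableAt (isOpen_ball.mem_nhds hv)).hasDerivAt
      have h2 := hgne v hv
      refine (h1.fun_mul (hL v hv).fun_neg.cexp).congr_deriv ?_
      field_simp
      ring
    have := isOpen_ball.is_const_of_deriv_eq_zero (convex_ball (0 : ℂ) 1).isPreconnected
      (fun v hv => (hder v hv).differentiableAt.differentiableWithinAt)
      (fun v hv => (hder v hv).deriv) hz h0mem
    simp only [hL0, hg0, neg_zero, Complex.exp_zero, mul_one, Complex.exp_neg] at this
    exact ((mul_inv_eq_one₀ (Complex.exp_ne_zero _)).1 this).symm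
  have hball : ∀ c, ¬ ball c 4 ⊆ L '' ball 0 1 := by
    intro c hc
    have hpi : ‖(Real.pi * I : ℂ)‖ < 4 := by
      simpa [abs_of_pos Real.pi_pos] using Real.pi_lt_four
    obtain ⟨x, hx, hxL⟩ := hc (show c + Real.pi * I ∈ ball c 4 by
      rw [mem_ball, dist_eq_norm, add_sub_cancel_left]; exact hpi)
    obtain ⟨y, hy, hyL⟩ := hc (show c - Real.pi * I ∈ ball c 4 by
      rw [mem_ball, dist_eq_norm, sub_sub_cancel_left, norm_neg]; exact hpi)
    have hxy : L x = L y + 2 * Real.pi * I := by rw [hxL, hyL]; ring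
    have hgxy : g x = g y := by
      rw [← hexp x hx, ← hexp y hy, hxy, Complex.exp_add, Complex.exp_two_pi_mul_I, mul_one]
    have hfxy : f x = f y := by
      simp only [hg, sub_right_inj] at hgxy
      field_simp at hgxy
      exact hgxy
    rw [hinj hx hy hfxy] at hxy
    simp [Real.pi_ne_zero] at hxy
  have hrz : ∀ v ∈ closedBall (0 : ℂ) r, v ∈ ball (0 : ℂ) 1 := closedBall_subset_ball hr
  have hr0 : 0 ≤ r := (norm_nonneg z).trans hz
  have hLz : ‖L z‖ ≤ 384 / (1 - r) := by
    have hmv := (convex_closedBall (0 : ℂ) r).norm_image_sub_le_of_norm_deriv_le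
      (f := L) (C := 384 / (1 - r)) (x := 0) (y := z)
      (fun v hv => (hL v (hrz v hv)).differentiableAt)
      (fun v hv => by
        have h1 := norm_deriv_mul_le_of_not_ball_subset_image (by norm_num) hLd hball (hrz v hv)
        rw [mem_closedBall_zero_iff] at hv
        rw [le_div_iff₀ (by linarith)]
        calc ‖deriv L v‖ * (1 - r) ≤ ‖deriv L v‖ * (1 - ‖v‖) := by gcongr
          _ ≤ 384 := by linarith)
      (mem_closedBall_self hr0) (by simpa using hz)
    rw [hL0, sub_zero, sub_zero] at hmv
    refine hmv.trans (mul_le_of_le_one_right ?_ (by linarith))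
    exact div_nonneg (by norm_num) (by linarith)
  have hzb := hrz z (by simpa using hz)
  have hgz : ‖g z‖ ≤ Real.exp (384 / (1 - r)) := by
    rw [← hexp z hzb, Complex.norm_exp]
    exact Real.exp_le_exp.2 ((re_le_norm _).trans hLz)
  have hfz : f z = w * (1 - g z) := by simp only [hg]; field_simp; ring
  rw [hfz, norm_mul]
  have h1 : ‖1 - g z‖ ≤ 1 + ‖g z‖ := by simpa using norm_sub_le 1 (g z)
  gcongr
  linarith

/-- **Montel's theorem** for ultrafilters: a locally bounded family of holomorphic functions
converges locally uniformly along every ultrafilter. -/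
theorem exists_tendstoLocallyUniformlyOn_ultrafilter {ι : Type*} {F : ι → ℂ → ℂ} {U : Set ℂ}
    (u : Ultrafilter ι) (hF : ∀ᶠ i in (u : Filter ι), DifferentiableOn ℂ (F i) U)
    (hb : ∀ x ∈ U, ∃ r > 0, ball x r ⊆ U ∧
      ∃ M, ∀ᶠ i in (u : Filter ι), ∀ z ∈ ball x r, ‖F i z‖ ≤ M) :
    ∃ g, TendstoLocallyUniformlyOn F g u U := by
  have hlim : ∀ x, ∃ y, x ∈ U → Tendsto (fun i => F i x) u (nhds y) := by
    intro x
    by_cases hx : x ∈ U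
    · obtain ⟨r, hr, -, M, hM⟩ := hb x hx
      have hmem : (u.map fun i => F i x : Filter ℂ) ≤ 𝓟 (closedBall 0 M) := by
        rw [le_principal_iff, Ultrafilter.coe_map, mem_map]
        filter_upwards [hM] with i hi
        simpa using hi x (mem_ball_self hr)
      obtain ⟨y, -, hy⟩ := (isCompact_closedBall (0 : ℂ) M).ultrafilter_le_nhds _ hmem
      exact ⟨y, fun _ => hy⟩
    · exact ⟨0, fun h => (hx h).elim⟩
  choose g hg using hlim
  refine ⟨g, Metric.tendstoLocallyUniformlyOn_iff.2 fun ε hε x hx => ?_⟩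
  obtain ⟨r, hr, hrU, M, hM⟩ := hb x hx
  have hM0 : 0 ≤ M := by
    obtain ⟨i, hi⟩ := hM.exists
    exact (norm_nonneg _).trans (hi x (mem_ball_self hr))
  have hlip : ∀ᶠ i in (u : Filter ι), ∀ z ∈ ball x r,
      dist (F i z) (F i x) ≤ 2 * M / r * dist z x := by
    filter_upwards [hM, hF] with i hi hdi z hz
    refine dist_le_div_mul_dist_of_mapsTo_ball (hdi.mono hrU) (fun v hv => ?_) hz
    rw [mem_closedBall, dist_eq_norm]
    linarith [norm_sub_le (F i v) (F i x), hi v hv, hi x (mem_ball_self hr)]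
  have hlip' : ∀ z ∈ ball x r, dist (g z) (g x) ≤ 2 * M / r * dist z x := fun z hz =>
    le_of_tendsto ((hg z (hrU hz)).dist (hg x hx)) (hlip.mono fun i hi => hi z hz)
  have hcont : ∀ᶠ z in nhds x, 2 * M / r * dist z x < ε / 3 := by
    have : Tendsto (fun z => 2 * M / r * dist z x) (nhds x) (nhds (2 * M / r * dist x x)) :=
      (continuous_const.mul (continuous_id.dist continuous_const)).tendsto x
    rw [dist_self, mul_zero] at this
    exact this.eventually_lt_const (by positivity)
  refine ⟨{z | 2 * M / r * dist z x < ε / 3} ∩ ball x r,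
    mem_nhdsWithin_of_mem_nhds (inter_mem hcont (ball_mem_nhds x hr)), ?_⟩
  filter_upwards [hlip, (Metric.tendsto_nhds.1 (hg x hx)) (ε / 3) (by positivity)]
    with i hi hix z hz
  have h1 := hlip' z hz.2
  have h2 := hi z hz.2
  have h3 : 2 * M / r * dist z x < ε / 3 := hz.1
  rw [dist_comm] at hix h2
  have h4 := dist_triangle4 (g z) (g x) (F i x) (F i z)
  linarith

/-- On an open subset of a locally compact space, locally uniform convergence along a filter can
be tested on the ultrafilters below it. -/
theorem tendstoLocallyUniformlyOn_of_ultrafilter {ι X Y : Type*} [TopologicalSpace X]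
    [LocallyCompactSpace X] [UniformSpace Y] {F : ι → X → Y} {g : X → Y} {U : Set X}
    {l : Filter ι} (hU : IsOpen U)
    (h : ∀ u : Ultrafilter ι, ↑u ≤ l → TendstoLocallyUniformlyOn F g u U) :
    TendstoLocallyUniformlyOn F g l U := by
  rw [tendstoLocallyUniformlyOn_iff_forall_isCompact hU]
  intro K hKU hK V hV
  refine mem_iff_ultrafilter.2 fun u hu => ?_
  exact (tendstoLocallyUniformlyOn_iff_forall_isCompact hU).1 (h u hu) K hKU hK V hV

/-- **Hurwitz's theorem**: a locally uniform limit of injective holomorphic functions on a disk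
is injective, provided it is not constant. -/
theorem injOn_ball_of_tendstoLocallyUniformlyOn {ι : Type*} {F : ι → ℂ → ℂ} {g : ℂ → ℂ}
    {l : Filter ι} [l.NeBot] {c : ℂ} {R : ℝ} (hlim : TendstoLocallyUniformlyOn F g l (ball c R))
    (hF : ∀ᶠ i in l, DifferentiableOn ℂ (F i) (ball c R))
    (hinj : ∀ᶠ i in l, InjOn (F i) (ball c R)) (hg : ∀ w, ¬ ∀ z ∈ ball c R, g z = w) :
    InjOn g (ball c R) := by
  intro a ha b hb hab
  by_contra hne
  have hgd := hlim.differentiableOn hF isOpen_ball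
  have hga := hgd.analyticOnNhd isOpen_ball
  have hev : ∀ᶠ z in nhdsWithin b {b}ᶜ, g z ≠ g b := by
    refine ((hga b hb).eventually_eq_or_eventually_ne analyticAt_const).resolve_left fun h => ?_
    exact hg (g b) (hga.eqOn_of_preconnected_of_eventuallyEq analyticOnNhd_const
      (convex_ball c R).isPreconnected hb h)
  rw [eventually_nhdsWithin_iff] at hev
  obtain ⟨r, hr, hr'⟩ := Metric.nhds_basis_closedBall.mem_iff.1
    (inter_mem (inter_mem hev (isOpen_ball.mem_nhds hb))
      (isOpen_compl_singleton.mem_nhds (show b ∈ ({a} : Set ℂ)ᶜ from Ne.symm hne)))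
  have hrB : closedBall b r ⊆ ball c R := fun z hz => (hr' hz).1.2
  have hcomp : IsCompact (sphere b r) := isCompact_sphere b r
  obtain ⟨z₀, hz₀, hmin⟩ := hcomp.exists_isMinOn (f := fun z => ‖g z - g b‖)
    (NormedSpace.sphere_nonempty.2 hr.le)
    ((hgd.continuousOn.mono (sphere_subset_closedBall.trans hrB)).sub continuousOn_const).norm
  set ε := ‖g z₀ - g b‖ with hε
  have hε0 : 0 < ε := norm_pos_iff.2 <| sub_ne_zero.2 <|
    (hr' (sphere_subset_closedBall hz₀)).1.1 (ne_of_mem_sphere hz₀ hr.ne')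
  have hunif := (tendstoLocallyUniformlyOn_iff_forall_isCompact isOpen_ball).1 hlim _ hrB
    (isCompact_closedBall b r)
  obtain ⟨i, hi, hia, hid, hii⟩ := ((Metric.tendstoUniformlyOn_iff.1 hunif (ε / 16)
    (by positivity)).and (((Metric.tendsto_nhds.1 (hlim.tendsto_at ha)) (ε / 16)
    (by positivity)).and (hF.and hinj))).exists
  have hib := hi b (mem_closedBall_self hr.le)
  rw [dist_eq_norm] at hib hia
  have himg := (hid.diffContOnCl_ball hrB).ball_subset_image_closedBall hr (ε := ε / 2)
    (fun z hz => by
      have h1 : ε ≤ ‖g z - g b‖ := hmin hz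
      have h2 := hi z (sphere_subset_closedBall hz)
      rw [dist_eq_norm] at h2
      have h3 : g z - g b = (g z - F i z) + ((F i z - F i b) - (g b - F i b)) := by ring
      have h4 := norm_add_le (g z - F i z) ((F i z - F i b) - (g b - F i b))
      have h5 := norm_sub_le (F i z - F i b) (g b - F i b)
      rw [← h3] at h4
      linarith)
    (by
      have : ∀ᶠ v in nhdsWithin b {b}ᶜ, F i v ≠ F i b := by
        filter_upwards [self_mem_nhdsWithin,
          mem_nhdsWithin_of_mem_nhds (isOpen_ball.mem_nhds hb)] with v hv hvB h
        exact hv (hii hvB hb h)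
      exact this.frequently.filter_mono nhdsWithin_le_nhds)
  obtain ⟨z, hz, hza⟩ := himg (show F i a ∈ ball (F i b) (ε / 2 / 2) by
    rw [mem_ball, dist_eq_norm]
    have h3 : F i a - F i b = (F i a - g a) + (g b - F i b) := by rw [hab]; ring
    rw [h3]
    linarith [norm_add_le (F i a - g a) (g b - F i b)])
  exact (hr' hz).2 (hii (hrB hz) ha hza)

theorem norm_exp_two_pi_I_mul (t : ℝ) : ‖exp (2 * Real.pi * I * t)‖ = 1 := by
  have : (2 * Real.pi * I * t : ℂ) = ((2 * Real.pi * t : ℝ) : ℂ) * I := by push_cast; ring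
  rw [this, norm_exp_ofReal_mul_I]

/-- `e^{2πis}` is not a root of unity of order at most `m` if `s ≠ 0` is small. -/
theorem exp_two_pi_I_mul_pow_ne_one {s : ℝ} (hs : s ≠ 0) {m : ℕ} (hm : m ≠ 0)
    (hsm : |s| * m < 1) : exp (2 * Real.pi * I * s) ^ m ≠ 1 := by
  rw [← Complex.exp_nat_mul, Ne, Complex.exp_eq_one_iff]
  rintro ⟨n, hn⟩
  have h1 : (m * s : ℂ) = n := by
    have : (2 * Real.pi * I : ℂ) ≠ 0 := two_pi_I_ne_zero
    apply mul_right_cancel₀ this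
    rw [← hn]; ring
  have h2 : (m * s : ℝ) = n := by exact_mod_cast h1
  have h3 : |(n : ℝ)| < 1 := by
    rw [← h2, abs_mul, Nat.abs_cast, mul_comm]; exact hsm
  have h4 : n = 0 := by
    rw [← Int.abs_lt_one_iff]; exact_mod_cast h3
  rw [h4, Int.cast_zero] at h2
  exact (mul_ne_zero (Nat.cast_ne_zero.2 hm) hs) h2

/-- If two holomorphic germs fixing `0` commute with `F` and their difference vanishes to the
exact order `n` at `0`, then the multiplier `λ` of `F` satisfies `λ ^ n = λ`. -/
theorem deriv_pow_eq_deriv_of_commute {F g g' q : ℂ → ℂ} {n : ℕ} (hF : AnalyticAt ℂ F 0)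
    (hF0 : F 0 = 0) (hg : ContinuousAt g 0) (hg0 : g 0 = 0) (hg' : ContinuousAt g' 0)
    (hg'0 : g' 0 = 0) (hq : ContinuousAt q 0) (hq0 : q 0 ≠ 0)
    (hgq : ∀ᶠ z in nhds 0, g z - g' z = z ^ n * q z)
    (hc : ∀ᶠ z in nhds 0, g (F z) = F (g z)) (hc' : ∀ᶠ z in nhds 0, g' (F z) = F (g' z)) :
    deriv F 0 ^ n = deriv F 0 := by
  have hFc : Tendsto F (nhds 0) (nhds 0) := by simpa [hF0] using hF.continuousAt.tendsto
  have hstrict : HasStrictDerivAt F (deriv F 0) 0 := hF.hasStrictDerivAt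
  have hslope : Tendsto (fun z => F z / z) (nhdsWithin 0 {0}ᶜ) (nhds (deriv F 0)) := by
    have := hasDerivAt_iff_tendsto_slope.1 hstrict.hasDerivAt
    refine this.congr fun z => ?_
    rw [slope_def_field, hF0, sub_zero, sub_zero]
  have hqF : Tendsto (fun z => q (F z)) (nhdsWithin 0 {0}ᶜ) (nhds (q 0)) :=
    (hq.tendsto.comp hFc).mono_left nhdsWithin_le_nhds
  have hleft : Tendsto (fun z => (g (F z) - g' (F z)) / z ^ n) (nhdsWithin 0 {0}ᶜ)
      (nhds (deriv F 0 ^ n * q 0)) := by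
    refine ((hslope.pow n).mul hqF).congr' ?_
    filter_upwards [nhdsWithin_le_nhds (hFc.eventually hgq), self_mem_nhdsWithin] with z hz hz0
    rw [hz, div_pow]
    ring
  have hpair : Tendsto (fun z => (g z, g' z)) (nhdsWithin 0 {0}ᶜ) (nhds (0, 0)) := by
    have := (hg.prodMk hg').tendsto
    rw [hg0, hg'0] at this
    exact this.mono_left nhdsWithin_le_nhds
  have hdiff : Tendsto (fun z => (g z - g' z) / z ^ n) (nhdsWithin 0 {0}ᶜ) (nhds (q 0)) := by
    refine (hq.tendsto.mono_left nhdsWithin_le_nhds).congr' ?_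
    filter_upwards [nhdsWithin_le_nhds hgq, self_mem_nhdsWithin] with z hz hz0
    rw [hz, mul_div_cancel_left₀ _ (pow_ne_zero n hz0)]
  have hbigO : (fun z => g z - g' z) =O[nhdsWithin 0 {0}ᶜ] fun z => z ^ n := by
    refine Asymptotics.isBigO_of_div_tendsto_nhds ?_ _ hdiff
    filter_upwards [self_mem_nhdsWithin] with z hz0 h
    exact absurd h (pow_ne_zero n hz0)
  have hlittle := (hstrict.isLittleO.comp_tendsto hpair).trans_isBigO hbigO
  have hright : Tendsto (fun z => (F (g z) - F (g' z)) / z ^ n) (nhdsWithin 0 {0}ᶜ)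
      (nhds (deriv F 0 * q 0)) := by
    have := hlittle.tendsto_div_nhds_zero.add (hdiff.const_mul (deriv F 0))
    rw [zero_add] at this
    refine this.congr fun z => ?_
    simp only [Function.comp_apply]
    simp
    ring
  have heq : deriv F 0 ^ n * q 0 = deriv F 0 * q 0 := by
    refine tendsto_nhds_unique hleft (hright.congr' ?_)
    filter_upwards [nhdsWithin_le_nhds hc, nhdsWithin_le_nhds hc'] with z h1 h2
    rw [h1, h2]
  exact mul_right_cancel₀ hq0 heq

/-- Uniqueness of the commuting univalent map with prescribed multiplier. -/
theorem IsCommutingExtension.eqOn {A : Set ℝ} (hA : (0 : ℝ) ∈ closure (A \ {0}))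
    {f : ℝ → ℂ → ℂ} (hfd : ∀ s ∈ A, DifferentiableOn ℂ (f s) (ball 0 1))
    (hf0 : ∀ s ∈ A, f s 0 = 0)
    (hfm : ∀ s ∈ A, deriv (f s) 0 = exp (2 * Real.pi * I * s)) {t : ℝ} {g g' : ℂ → ℂ}
    (hg : IsCommutingExtension A f t g) (hg' : IsCommutingExtension A f t g') :
    EqOn g g' (ball 0 1) := by
  obtain ⟨hgd, -, hg0, hgm, hgc⟩ := hg
  obtain ⟨hgd', -, hg0', hgm', hgc'⟩ := hg'
  have h0mem : (0 : ℂ) ∈ ball (0 : ℂ) 1 := mem_ball_self one_pos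
  have hga := hgd.analyticOnNhd isOpen_ball
  have hga' := hgd'.analyticOnNhd isOpen_ball
  by_contra hne
  have hz : ¬ ∀ᶠ z in nhds 0, g z - g' z = 0 := fun h =>
    hne (hga.eqOn_of_preconnected_of_eventuallyEq hga' (convex_ball (0 : ℂ) 1).isPreconnected
      h0mem (h.mono fun z hz => sub_eq_zero.1 hz))
  obtain ⟨n, q, hq, hq0, hgq⟩ :=
    ((hga 0 h0mem).fun_sub (hga' 0 h0mem)).exists_eventuallyEq_pow_smul_nonzero_iff.2 hz
  simp only [sub_zero, smul_eq_mul] at hgq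
  have hn0 : n ≠ 0 := by
    rintro rfl
    have := hgq.self_of_nhds
    simp [hg0, hg0', hq0.symm] at this
  have hn1 : n ≠ 1 := by
    rintro rfl
    have h1 : HasDerivAt (fun z => g z - g' z) 0 0 := by
      have := (hga 0 h0mem).differentiableAt.hasDerivAt.fun_sub
        (hga' 0 h0mem).differentiableAt.hasDerivAt
      rwa [hgm, hgm', sub_self] at this
    have h2 := (h1.congr_of_eventuallyEq (EventuallyEq.symm hgq)).unique
      (((hasDerivAt_id (0 : ℂ)).pow 1).mul hq.differentiableAt.hasDerivAt)
    simp [hq0.symm] at h2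
  obtain ⟨s, ⟨hsA, hs0⟩, hs⟩ := Metric.mem_closure_iff.1 hA (1 / n)
    (by have := Nat.pos_of_ne_zero hn0; positivity)
  rw [dist_zero_left, Real.norm_eq_abs] at hs
  have hpow := deriv_pow_eq_deriv_of_commute ((hfd s hsA).analyticOnNhd isOpen_ball 0 h0mem)
    (hf0 s hsA) (hga 0 h0mem).continuousAt hg0 (hga' 0 h0mem).continuousAt hg0'
    hq.continuousAt hq0 hgq (hgc s hsA) (hgc' s hsA)
  rw [hfm s hsA] at hpow
  obtain ⟨m, rfl⟩ : ∃ m, n = m + 1 := Nat.exists_eq_succ_of_ne_zero hn0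
  refine exp_two_pi_I_mul_pow_ne_one (m := m) hs0 (by omega) ?_
    (mul_right_cancel₀ (Complex.exp_ne_zero _) (hpow.trans (one_mul _).symm))
  rw [lt_div_iff₀ (by positivity)] at hs
  refine lt_of_le_of_lt ?_ hs
  gcongr
  simp

/-- A locally uniform limit of members of the family, along parameters tending to `t`, is a
commuting extension with multiplier `e^{2πit}`. -/
theorem isCommutingExtension_of_tendstoLocallyUniformlyOn {A : Set ℝ} {f : ℝ → ℂ → ℂ}
    (hf : ∀ s ∈ A,
      DifferentiableOn ℂ (f s) (ball 0 1) ∧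
      InjOn (f s) (ball 0 1) ∧
      f s 0 = 0 ∧
      deriv (f s) 0 = exp (2 * Real.pi * I * s))
    (hcomm : ∀ s ∈ A, ∀ s' ∈ A, ∀ᶠ z in nhds (0 : ℂ), f s (f s' z) = f s' (f s z))
    {t : ℝ} {l : Filter ℝ} [l.NeBot] (hl : l ≤ nhdsWithin t A) {g : ℂ → ℂ}
    (hlim : TendstoLocallyUniformlyOn f g l (ball 0 1)) : IsCommutingExtension A f t g := by
  have h0mem : (0 : ℂ) ∈ ball (0 : ℂ) 1 := mem_ball_self one_pos
  have hlA : ∀ᶠ s in l, s ∈ A := hl self_mem_nhdsWithin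
  have hlt : Tendsto (fun s : ℝ => s) l (nhds t) := hl.trans nhdsWithin_le_nhds
  have hFd : ∀ᶠ s in l, DifferentiableOn ℂ (f s) (ball 0 1) := hlA.mono fun s hs => (hf s hs).1
  have hgd : DifferentiableOn ℂ g (ball 0 1) := hlim.differentiableOn hFd isOpen_ball
  have hg0 : g 0 = 0 := by
    refine tendsto_nhds_unique (hlim.tendsto_at h0mem) (tendsto_const_nhds.congr' ?_)
    filter_upwards [hlA] with s hs
    exact (hf s hs).2.2.1.symm
  have hgm : deriv g 0 = exp (2 * Real.pi * I * t) := by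
    refine tendsto_nhds_unique ((hlim.deriv hFd isOpen_ball).tendsto_at h0mem) ?_
    have h1 : Tendsto (fun s : ℝ => exp (2 * Real.pi * I * s)) l
        (nhds (exp (2 * Real.pi * I * t))) :=
      ((by fun_prop : Continuous fun s : ℝ => exp (2 * Real.pi * I * s)).tendsto t).comp hlt
    refine h1.congr' ?_
    filter_upwards [hlA] with s hs
    exact (hf s hs).2.2.2.symm
  have hgc : ContinuousAt g 0 := (hgd.differentiableAt (isOpen_ball.mem_nhds h0mem)).continuousAt
  refine ⟨hgd, ?_, hg0, hgm, ?_⟩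
  · refine injOn_ball_of_tendstoLocallyUniformlyOn hlim hFd
      (hlA.mono fun s hs => (hf s hs).2.1) fun w hw => ?_
    have h1 : HasDerivAt g 0 0 := (hasDerivAt_const (0 : ℂ) w).congr_of_eventuallyEq
      (eventually_of_mem (isOpen_ball.mem_nhds h0mem) hw)
    exact Complex.exp_ne_zero _ (hgm.symm.trans h1.deriv)
  · intro s hs
    obtain ⟨hsd, -, hs0, -⟩ := hf s hs
    have hsc : ContinuousAt (f s) 0 :=
      (hsd.differentiableAt (isOpen_ball.mem_nhds h0mem)).continuousAt
    have hball : ball (0 : ℂ) (1 / 2) ∈ nhds (0 : ℂ) := ball_mem_nhds _ (by norm_num)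
    obtain ⟨δ, hδ, hδ'⟩ := Metric.nhds_basis_closedBall.mem_iff.1
      (inter_mem (inter_mem (hgc.preimage_mem_nhds (by rwa [hg0]))
        (hsc.preimage_mem_nhds (by rwa [hs0]))) hball)
    have hδ1 : closedBall (0 : ℂ) δ ⊆ ball 0 1 := fun z hz =>
      ball_subset_ball (by norm_num) (hδ' hz).2
    have hδs : MapsTo (f s) (ball 0 δ) (ball 0 1) := fun z hz =>
      ball_subset_ball (by norm_num) (hδ' (ball_subset_closedBall hz)).1.2
    have hδg : ∀ z ∈ closedBall (0 : ℂ) δ, ‖g z‖ < 1 / 2 := fun z hz => by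
      simpa using (hδ' hz).1.1
    have hδb : ball (0 : ℂ) δ ⊆ ball 0 1 := ball_subset_closedBall.trans hδ1
    have hunif := Metric.tendstoUniformlyOn_iff.1
      ((tendstoLocallyUniformlyOn_iff_forall_isCompact isOpen_ball).1 hlim _ hδ1
        (isCompact_closedBall 0 δ)) (1 / 2) (by norm_num)
    have hev : ∀ᶠ s' in l, ∀ z ∈ ball (0 : ℂ) δ, f s' (f s z) = f s (f s' z) := by
      filter_upwards [hunif, hlA] with s' hs' hs'A
      obtain ⟨hsd', -, hs0', -⟩ := hf s' hs'A
      have hmaps : MapsTo (f s') (ball 0 δ) (ball 0 1) := fun z hz => by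
        have h1 := hs' z (ball_subset_closedBall hz)
        have h2 := hδg z (ball_subset_closedBall hz)
        rw [dist_comm, dist_eq_norm] at h1
        have h3 := norm_add_le (f s' z - g z) (g z)
        rw [sub_add_cancel] at h3
        rw [mem_ball_zero_iff]
        linarith
      have hd1 : DifferentiableOn ℂ (fun z => f s' (f s z)) (ball 0 δ) :=
        hsd'.comp (hsd.mono hδb) hδs
      have hd2 : DifferentiableOn ℂ (fun z => f s (f s' z)) (ball 0 δ) :=
        hsd.comp (hsd'.mono hδb) hmaps
      exact (hd1.analyticOnNhd isOpen_ball).eqOn_of_preconnected_of_eventuallyEq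
        (hd2.analyticOnNhd isOpen_ball) (convex_ball (0 : ℂ) δ).isPreconnected
        (mem_ball_self hδ) (hcomm s' hs'A s hs)
    filter_upwards [ball_mem_nhds (0 : ℂ) hδ] with z hz
    have hgz : g z ∈ ball (0 : ℂ) 1 := by
      rw [mem_ball_zero_iff]
      linarith [hδg z (ball_subset_closedBall hz)]
    have h1 : Tendsto (fun s' => f s (f s' z)) l (nhds (f s (g z))) :=
      (hsd.differentiableAt (isOpen_ball.mem_nhds hgz)).continuousAt.tendsto.comp
        (hlim.tendsto_at (hδb hz))
    refine tendsto_nhds_unique (hlim.tendsto_at (hδs hz)) (h1.congr' ?_)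
    exact hev.mono fun s' hs' => (hs' z hz).symm

/-- A compact set invariant under maps converging locally uniformly is invariant under their
limit. -/
theorem image_eq_of_tendstoLocallyUniformlyOn {ι X : Type*} [MetricSpace X] {F : ι → X → X}
    {g : X → X} {U K : Set X} {l : Filter ι} [l.NeBot] (hlim : TendstoLocallyUniformlyOn F g l U)
    (hg : ContinuousOn g U) (hKU : K ⊆ U) (hK : IsCompact K) (hF : ∀ᶠ i in l, F i '' K = K) :
    g '' K = K := by
  refine Subset.antisymm ?_ ?_
  · rintro _ ⟨x, hx, rfl⟩
    refine hK.isClosed.mem_of_tendsto (hlim.tendsto_at (hKU hx)) ?_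
    filter_upwards [hF] with i hi
    exact hi.subset (mem_image_of_mem _ hx)
  · intro y hy
    rw [← (hK.image_of_continuousOn (hg.mono hKU)).isClosed.closure_eq]
    refine Metric.mem_closure_iff.2 fun ε hε => ?_
    have hunif := (tendstoLocallyUniformlyOn_iff_tendstoUniformlyOn_of_compact hK).1
      (hlim.mono hKU)
    obtain ⟨i, hi, hiK⟩ := ((Metric.tendstoUniformlyOn_iff.1 hunif ε hε).and hF).exists
    obtain ⟨x, hx, rfl⟩ := hiK.superset hy
    exact ⟨g x, mem_image_of_mem _ hx, by rw [dist_comm]; exact hi x hx⟩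

/-- A commuting family of univalent maps `(f_s)_{s ∈ A}` of the unit disk, with `A`
accumulating at `0`, extends uniquely to the closure of `A`: for each `t ∈ closure A`
there is a unique univalent map `g` with `g(0) = 0`, `g'(0) = e^{2πit}` commuting with
all `f_s` near `0`; it is the locally uniform limit of `f_{t_n}` along any sequence
`t_n ∈ A`, `t_n → t`; and any compact set invariant under all `f_s` is invariant
under `g`. -/
theorem limit_semiflow_exists
    (A : Set ℝ) (hA : (0 : ℝ) ∈ closure (A \ {0}))
    (f : ℝ → ℂ → ℂ)
    (hf : ∀ s ∈ A,
      DifferentiableOn ℂ (f s) (Metric.ball 0 1) ∧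
      Set.InjOn (f s) (Metric.ball 0 1) ∧
      f s 0 = 0 ∧
      deriv (f s) 0 = Complex.exp (2 * Real.pi * Complex.I * s))
    (hcomm : ∀ s ∈ A, ∀ s' ∈ A, ∀ᶠ z in nhds (0 : ℂ), f s (f s' z) = f s' (f s z)) :
    ∀ t ∈ closure A,
      ∃ g : ℂ → ℂ,
        IsCommutingExtension A f t g ∧
        (∀ g' : ℂ → ℂ, IsCommutingExtension A f t g' →
          Set.EqOn g' g (Metric.ball 0 1)) ∧
        (∀ u : ℕ → ℝ, (∀ n, u n ∈ A) → Filter.Tendsto u Filter.atTop (nhds t) →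
          TendstoLocallyUniformlyOn (fun n => f (u n)) g Filter.atTop
            (Metric.ball 0 1)) ∧
        (∀ K : Set ℂ, K ⊆ Metric.ball 0 1 → IsCompact K →
          (∀ s ∈ A, f s '' K = K) → g '' K = K) := by
  intro t ht
  have hmontel : ∀ u : Ultrafilter ℝ, ↑u ≤ nhdsWithin t A →
      ∃ g, TendstoLocallyUniformlyOn f g u (ball 0 1) := by
    intro u hu
    have huA : ∀ᶠ s in (u : Filter ℝ), s ∈ A := hu self_mem_nhdsWithin
    refine exists_tendstoLocallyUniformlyOn_ultrafilter u
      (huA.mono fun s hs => (hf s hs).1) fun x hx => ?_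
    rw [mem_ball_zero_iff] at hx
    have hsub : ball x ((1 - ‖x‖) / 2) ⊆ ball 0 ((1 + ‖x‖) / 2) :=
      ball_subset_ball' (by rw [dist_zero_right]; linarith)
    refine ⟨(1 - ‖x‖) / 2, by linarith, hsub.trans (ball_subset_ball (by linarith)),
      2 * (1 + Real.exp (384 / (1 - (1 + ‖x‖) / 2))), ?_⟩
    filter_upwards [huA] with s hs z hz
    obtain ⟨hd, hi, h0, hm⟩ := hf s hs
    refine norm_le_of_injOn_ball hd hi h0 ?_ (by linarith) (mem_ball_zero_iff.1 (hsub hz)).le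
    rw [hm, norm_exp_two_pi_I_mul]
  have : (nhdsWithin t A).NeBot := mem_closure_iff_nhdsWithin_neBot.1 ht
  have huniq {g g' : ℂ → ℂ} (hg : IsCommutingExtension A f t g)
      (hg' : IsCommutingExtension A f t g') : EqOn g g' (ball 0 1) :=
    hg.eqOn hA (fun s hs => (hf s hs).1) (fun s hs => (hf s hs).2.2.1)
      (fun s hs => (hf s hs).2.2.2) hg'
  obtain ⟨g, hg⟩ := hmontel (.of (nhdsWithin t A)) (Ultrafilter.of_le _)
  have hgext := isCommutingExtension_of_tendstoLocallyUniformlyOn hf hcomm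
    (Ultrafilter.of_le _) hg
  have hlim : TendstoLocallyUniformlyOn f g (nhdsWithin t A) (ball 0 1) := by
    refine tendstoLocallyUniformlyOn_of_ultrafilter isOpen_ball fun u hu => ?_
    obtain ⟨g', hg'⟩ := hmontel u hu
    exact hg'.congr_right
      (huniq (isCommutingExtension_of_tendstoLocallyUniformlyOn hf hcomm hu hg') hgext)
  refine ⟨g, hgext, fun g' hg' => huniq hg' hgext, fun u huA hu V hV x hx => ?_,
    fun K hKU hK hKf => ?_⟩
  · obtain ⟨W, hW, hW'⟩ := hlim V hV x hx
    exact ⟨W, hW, (tendsto_nhdsWithin_iff.2 ⟨hu, .of_forall huA⟩).eventually hW'⟩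
  · exact image_eq_of_tendstoLocallyUniformlyOn hlim hgext.1.continuousOn hKU hK
      (eventually_of_mem self_mem_nhdsWithin hKf)
end
end

section
/- Given ε > 0, there exists a Jordan domain W with 0 ∈ W and W̄ ⊆ 𝔻 such that: (i) d_H(𝔻̄, ∂W) < ε/2 and d_H(∂W, W̄) < ε/2; (ii) for every cross-cut γ of ℂ ∖ W̄ whose endpoints a = γ(0), b = γ(1) satisfy dist(a, ∂𝔻) < ε, dist(b, ∂𝔻) < ε and |a − b| > ε, one has W̄ ⊆ N(closure(G(γ)), ε). Moreover, there exists δ > 0 such that every Jordan domain W' with 0 ∈ W', W̄' ⊆ 𝔻 and d_H(∂W, ∂W') < δ also satisfies (i) and (ii). -/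
open Complex Metric Set Filter

noncomputable section

/-- A Jordan domain: a bounded connected open subset of `ℂ` whose frontier is the
image of an injective continuous map from the unit circle. -/
def JordanDomain (W : Set ℂ) : Prop :=
  IsOpen W ∧ IsConnected W ∧ Bornology.IsBounded W ∧
    ∃ φ : Metric.sphere (0 : ℂ) 1 → ℂ, Continuous φ ∧ Function.Injective φ ∧
      Set.range φ = frontier W

/-- `γ : [0,1] → ℂ` is a cross-cut of `ℂ ∖ K`. -/
def CrossCut (K : Set ℂ) (γ : ℝ → ℂ) : Prop :=
  ContinuousOn γ (Set.Icc 0 1) ∧ Set.InjOn γ (Set.Icc 0 1) ∧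
    γ 0 ∈ K ∧ γ 1 ∈ K ∧ γ 0 ≠ γ 1 ∧ ∀ t ∈ Set.Ioo (0 : ℝ) 1, γ t ∉ K

/-- `G(γ)`: the union of the bounded connected components of
`ℂ ∖ (K ∪ γ([0,1]))`. -/
def CrossCutRegion (K : Set ℂ) (γ : ℝ → ℂ) : Set ℂ :=
  {z | z ∉ K ∪ γ '' Set.Icc 0 1 ∧
    Bornology.IsBounded (connectedComponentIn (K ∪ γ '' Set.Icc 0 1)ᶜ z)}

/-- Conditions (i) and (ii) of the spiral Lemma for a Jordan domain `W` and `ε > 0`: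
(i) `d_H(𝔻̄, ∂W) < ε/2` and `d_H(∂W, W̄) < ε/2`; (ii) every cross-cut of `ℂ ∖ W̄` with
endpoints `ε`-close to the unit circle and at mutual distance `> ε` has
`W̄ ⊆ N(closure G(γ), ε)`. -/
def SpiralConditions (ε : ℝ) (W : Set ℂ) : Prop :=
  (Metric.hausdorffDist (Metric.closedBall (0 : ℂ) 1) (frontier W) < ε / 2 ∧
   Metric.hausdorffDist (frontier W) (closure W) < ε / 2) ∧
  (∀ γ : ℝ → ℂ, CrossCut (closure W) γ →
    Metric.infDist (γ 0) (Metric.sphere (0 : ℂ) 1) < ε →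
    Metric.infDist (γ 1) (Metric.sphere (0 : ℂ) 1) < ε →
    ε < ‖γ 0 - γ 1‖ →
    ∀ z ∈ closure W,
      Metric.infDist z (closure (CrossCutRegion (closure W) γ)) < ε)

/-- `z ↦ z - w` has a continuous logarithm on `K`. -/
def HasLogOn (K : Set ℂ) (w : ℂ) : Prop :=
  ∃ f : ℂ → ℂ, ContinuousOn f K ∧ ∀ z ∈ K, exp (f z) = z - w

lemma HasLogOn.mono {K L : Set ℂ} {w : ℂ} (h : HasLogOn L w) (hKL : K ⊆ L) : HasLogOn K w := by
  obtain ⟨f, hf, hfe⟩ := h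
  exact ⟨f, hf.mono hKL, fun z hz ↦ hfe z (hKL hz)⟩

/-- Two continuous logarithms on a preconnected set differ by a constant. -/
lemma exists_eq_add_of_exp_eq {X : Type*} [TopologicalSpace X] {S : Set X} (hS : IsPreconnected S)
    {f g : X → ℂ} (hf : ContinuousOn f S) (hg : ContinuousOn g S)
    (h : ∀ z ∈ S, exp (f z) = exp (g z)) :
    ∃ c : ℂ, exp c = 1 ∧ ∀ z ∈ S, f z = g z + c := by
  have hd : IsDiscrete (AddSubgroup.zmultiples (2 * (Real.pi : ℂ) * I) : Set ℂ) :=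
    ⟨NormedSpace.discreteTopology_zmultiples _⟩
  obtain ⟨c, hc, hcs⟩ := hS.eqOn_const_of_mapsTo hd (hf.sub hg) (fun z hz ↦ by
    obtain ⟨n, hn⟩ := exp_eq_exp_iff_exists_int.1 (h z hz)
    exact ⟨n, by simp [hn]⟩) ⟨0, zero_mem _⟩
  obtain ⟨n, rfl⟩ := hc
  refine ⟨_, exp_eq_one_iff.2 ⟨n, zsmul_eq_mul _ _⟩, fun z hz ↦ ?_⟩
  have := hcs hz
  simp only [Pi.sub_apply, Function.const_apply] at this
  rw [← sub_eq_iff_eq_add', this]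

lemma continuousOn_log_one_sub_div {K : Set ℂ} {v v' : ℂ} (h : ∀ z ∈ K, ‖v' - v‖ < ‖z - v‖) :
    ContinuousOn (fun z ↦ log (1 - (v' - v) / (z - v))) K ∧
      ∀ z ∈ K, (z - v) * exp (log (1 - (v' - v) / (z - v))) = z - v' := by
  have hne : ∀ z ∈ K, z - v ≠ 0 := fun z hz ↦
    norm_pos_iff.1 ((norm_nonneg _).trans_lt (h z hz))
  have hs : ∀ z ∈ K, 1 - (v' - v) / (z - v) ∈ slitPlane := fun z hz ↦ by
    rw [sub_eq_add_neg]
    apply mem_slitPlane_of_norm_lt_one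
    rw [norm_neg, norm_div, div_lt_one ((norm_nonneg _).trans_lt (h z hz))]
    exact h z hz
  refine ⟨ContinuousOn.clog (continuousOn_const.sub
    (continuousOn_const.div (by fun_prop) hne)) hs, fun z hz ↦ ?_⟩
  rw [exp_log (slitPlane_ne_zero (hs z hz))]
  have := hne z hz
  field_simp
  ring

lemma hasLogOn_iff_of_norm_lt {K : Set ℂ} {v v' : ℂ} (h : ∀ z ∈ K, ‖v' - v‖ < ‖z - v‖) :
    HasLogOn K v ↔ HasLogOn K v' := by
  obtain ⟨hc, he⟩ := continuousOn_log_one_sub_div h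
  constructor
  · rintro ⟨f, hf, hfe⟩
    exact ⟨_, hf.add hc, fun z hz ↦ by rw [Pi.add_apply, exp_add, hfe z hz, he z hz]⟩
  · rintro ⟨f, hf, hfe⟩
    refine ⟨_, hf.sub hc, fun z hz ↦ ?_⟩
    rw [Pi.sub_apply, exp_sub, hfe z hz, ← he z hz, mul_div_cancel_right₀ _ (exp_ne_zero _)]

lemma hasLogOn_of_norm_lt {K : Set ℂ} {w : ℂ} (h : ∀ z ∈ K, ‖z‖ < ‖w‖) : HasLogOn K w := by
  rcases K.eq_empty_or_nonempty with rfl | ⟨z₀, hz₀⟩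
  · exact ⟨0, by simp, by simp⟩
  have hw : w ≠ 0 := norm_pos_iff.1 ((norm_nonneg _).trans_lt (h z₀ hz₀))
  have hs : ∀ z ∈ K, 1 - z / w ∈ slitPlane := fun z hz ↦ by
    rw [sub_eq_add_neg]
    apply mem_slitPlane_of_norm_lt_one
    rw [norm_neg, norm_div, div_lt_one (norm_pos_iff.2 hw)]
    exact h z hz
  refine ⟨fun z ↦ log (-w) + log (1 - z / w), continuousOn_const.add
    (ContinuousOn.clog (by fun_prop) hs), fun z hz ↦ ?_⟩
  rw [exp_add, exp_log (neg_ne_zero.2 hw), exp_log (slitPlane_ne_zero (hs z hz))]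
  field_simp
  ring

/-- A point lying in an unbounded connected set that misses `K` sees `K` with a continuous
logarithm. -/
lemma hasLogOn_of_unbounded {K S : Set ℂ} (hK : IsCompact K) (hS : IsPreconnected S)
    (hSK : Disjoint S K) (hSb : ¬ Bornology.IsBounded S) {w : ℂ} (hw : w ∈ S) : HasLogOn K w := by
  have key : ∀ v ∉ K, ∀ᶠ v' in nhds v, v' ∉ K ∧ (HasLogOn K v ↔ HasLogOn K v') := by
    intro v hv
    obtain ⟨r, hr, hb⟩ := Metric.isOpen_iff.1 hK.isClosed.isOpen_compl v hv
    filter_upwards [Metric.ball_mem_nhds v hr] with v' hv'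
    refine ⟨hb hv', hasLogOn_iff_of_norm_lt fun z hz ↦ ?_⟩
    rw [mem_ball, dist_eq_norm] at hv'
    by_contra! hlt
    exact hb (by rw [mem_ball, dist_eq_norm]; exact hlt.trans_lt hv') hz
  have hU : IsOpen {v | v ∉ K ∧ HasLogOn K v} := isOpen_iff_mem_nhds.2 fun v hv ↦ by
    filter_upwards [key v hv.1] with v' hv' using ⟨hv'.1, hv'.2.1 hv.2⟩
  have hV : IsOpen {v | v ∉ K ∧ ¬ HasLogOn K v} := isOpen_iff_mem_nhds.2 fun v hv ↦ by
    filter_upwards [key v hv.1] with v' hv' using ⟨hv'.1, fun h ↦ hv.2 (hv'.2.2 h)⟩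
  refine (hS.subset_left_of_subset_union hU hV ?_ ?_ ?_ hw).2
  · exact Set.disjoint_left.2 fun v hv hv' ↦ hv'.2 hv.2
  · intro v hv
    have := Set.disjoint_left.1 hSK hv
    by_cases h : HasLogOn K v
    · exact Or.inl ⟨this, h⟩
    · exact Or.inr ⟨this, h⟩
  · obtain ⟨R, hR⟩ := hK.isBounded.exists_norm_le
    have : ∃ v ∈ S, R < ‖v‖ := by
      by_contra! h
      exact hSb (isBounded_iff_forall_norm_le.2 ⟨R, h⟩)
    obtain ⟨v, hv, hRv⟩ := this
    exact ⟨v, hv, Set.disjoint_left.1 hSK hv, hasLogOn_of_norm_lt fun z hz ↦ (hR z hz).trans_lt hRv⟩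

lemma not_hasLogOn_sphere (w : ℂ) {R : ℝ} (hR : 0 < R) : ¬ HasLogOn (sphere w R) w := by
  rintro ⟨f, hf, hfe⟩
  have hmem : ∀ t : ℝ, w + exp (Real.log R + t * I) ∈ sphere w R := fun t ↦ by
    simp [Complex.norm_exp, Real.exp_log hR]
  obtain ⟨c, -, hc⟩ := exists_eq_add_of_exp_eq (X := ℝ) (S := univ) isPreconnected_univ
    (f := fun t : ℝ ↦ f (w + exp (Real.log R + t * I))) (g := fun t : ℝ ↦ Real.log R + t * I)
    (hf.comp (by fun_prop) fun t _ ↦ hmem t) (by fun_prop)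
    fun t _ ↦ by simp [hfe _ (hmem t)]
  have h0 := hc 0 trivial
  have h1 := hc (2 * Real.pi) trivial
  have he : exp (Real.log R + (2 * Real.pi : ℝ) * I) = exp (Real.log R + (0 : ℝ) * I) := by
    rw [exp_eq_exp_iff_exists_int]
    exact ⟨1, by push_cast; ring⟩
  simp only [he] at h1
  rw [h0] at h1
  have : (2 * Real.pi : ℂ) * I = 0 := by
    push_cast at h1
    linear_combination -h1
  simp [Real.pi_ne_zero] at this

/-- A set containing the frontier of a bounded set `V` admits no continuous logarithm of
`z ↦ z - w` when `w ∈ V`. -/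
lemma not_hasLogOn_of_frontier_subset {K V : Set ℂ} (hVb : Bornology.IsBounded V)
    (hVK : frontier V ⊆ K) {w : ℂ} (hw : w ∈ V) : ¬ HasLogOn K w := by
  intro hK
  obtain ⟨f, hf, hfe⟩ := hK.mono hVK
  obtain ⟨F, hF⟩ := ContinuousMap.exists_restrict_eq (isClosed_frontier (s := V))
    ⟨_, hf.domRestrict⟩
  have hFe : ∀ z ∈ frontier V, exp (F z) = z - w := fun z hz ↦ by
    rw [← hfe z hz]
    have := congrArg (fun G ↦ G ⟨z, hz⟩) hF
    simp at this
    rw [this]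
  classical
  let g : ℂ → ℂ := fun z ↦ if z ∈ V then exp (F z) else z - w
  have hg : Continuous g := Continuous.if hFe (by fun_prop) (by fun_prop)
  have hg0 : ∀ z, g z ≠ 0 := fun z ↦ by
    by_cases hz : z ∈ V
    · simp [g, hz]
    · simp only [g, hz, if_false]
      exact sub_ne_zero.2 fun h ↦ hz (h ▸ hw)
  obtain ⟨G, hG, hGe⟩ := exists_continuousOn_eqOn_exp_comp (U := (univ : Set ℂ))
    (by
      rw [IsSimplyConnected]
      have : ContractibleSpace (univ : Set ℂ) := (convex_univ).contractibleSpace univ_nonempty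
      infer_instance) isOpen_univ hg.continuousOn (by simpa using hg0)
  obtain ⟨R, hR⟩ := hVb.subset_ball w
  have hR0 : 0 < R := by simpa using hR hw
  refine not_hasLogOn_sphere w hR0 ⟨G, hG.mono (subset_univ _), fun z hz ↦ ?_⟩
  have : z ∉ V := fun h ↦ by
    have := hR h
    rw [mem_sphere] at hz
    rw [mem_ball, hz] at this
    exact lt_irrefl _ this
  have h := hGe (mem_univ z)
  simpa [g, this] using h

lemma hasLogOn_image_Icc {ψ : ℝ → ℂ} {a b : ℝ} (hab : a ≤ b) (hψ : ContinuousOn ψ (Icc a b))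
    (hinj : InjOn ψ (Icc a b)) {w : ℂ} (hw : w ∉ ψ '' Icc a b) : HasLogOn (ψ '' Icc a b) w := by
  let ψ' : Icc a b → ℂ := fun t ↦ ψ t
  have hψ' : Continuous ψ' := hψ.domRestrict
  have hext : Continuous (IccExtend hab ψ') := hψ'.Icc_extend'
  obtain ⟨G, hG, hGe⟩ := exists_continuousOn_eqOn_exp_comp (U := (univ : Set ℝ))
    (g := fun t ↦ IccExtend hab ψ' t - w)
    (by
      rw [IsSimplyConnected]
      have : ContractibleSpace (univ : Set ℝ) := (convex_univ).contractibleSpace univ_nonempty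
      infer_instance) isOpen_univ (by fun_prop) (by
        rintro ⟨t, -, ht⟩
        simp only [IccExtend, Function.comp_apply, ψ'] at ht
        exact hw ⟨_, (projIcc a b hab t).2, sub_eq_zero.1 ht⟩)
  have hinv : ContinuousOn (Function.invFunOn ψ (Icc a b)) (ψ '' Icc a b) := by
    rw [continuousOn_iff_isClosed]
    intro t ht
    refine ⟨ψ '' (Icc a b ∩ t), ((isCompact_Icc.inter_right ht).image_of_continuousOn
      (hψ.mono inter_subset_left)).isClosed, ?_⟩
    ext z
    constructor
    · rintro ⟨hz, x, hx, rfl⟩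
      refine ⟨⟨x, ⟨hx, ?_⟩, rfl⟩, mem_image_of_mem _ hx⟩
      rwa [mem_preimage, hinj.leftInvOn_invFunOn hx] at hz
    · rintro ⟨⟨x, ⟨hx, hxt⟩, rfl⟩, -⟩
      refine ⟨?_, mem_image_of_mem _ hx⟩
      rwa [mem_preimage, hinj.leftInvOn_invFunOn hx]
  refine ⟨_, hG.comp hinv (fun _ _ ↦ trivial), ?_⟩
  rintro _ ⟨x, hx, rfl⟩
  have := hGe (mem_univ x)
  simp only [Function.comp_apply, hinj.leftInvOn_invFunOn hx] at this ⊢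
  rw [this, IccExtend_of_mem hab _ hx]

/-- Gluing of logarithms along a connected common part. -/
lemma HasLogOn.union {A B C : Set ℂ} {w : ℂ} (hA : IsClosed A) (hB : IsClosed B)
    (hC : IsPreconnected C) (hCA : C ⊆ A) (hCB : C ⊆ B) (hAB : A ∩ B ⊆ C)
    (h₁ : HasLogOn A w) (h₂ : HasLogOn B w) : HasLogOn (A ∪ B) w := by
  obtain ⟨f, hf, hfe⟩ := h₁
  obtain ⟨g, hg, hge⟩ := h₂
  obtain ⟨c, hc, hfg⟩ := exists_eq_add_of_exp_eq hC (hf.mono hCA) (hg.mono hCB)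
    fun z hz ↦ by rw [hfe z (hCA hz), hge z (hCB hz)]
  classical
  let F : ℂ → ℂ := fun z ↦ if z ∈ A then f z else g z + c
  have hFA : EqOn F f A := fun z hz ↦ if_pos hz
  have hFB : EqOn F (fun z ↦ g z + c) B := fun z hz ↦ by
    by_cases h : z ∈ A
    · rw [hFA h, hfg z (hAB ⟨h, hz⟩)]
    · exact if_neg h
  refine ⟨F, (hf.congr hFA).union_of_isClosed ((hg.add continuousOn_const).congr hFB) hA hB, ?_⟩
  rintro z (hz | hz)
  · rw [hFA hz, hfe z hz]
  · rw [hFB hz, exp_add, hc, mul_one, hge z hz]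

lemma JordanDomain.exists_param {W : Set ℂ} (hW : JordanDomain W) {p : ℂ} (hp : p ∈ frontier W) :
    ∃ ψ : ℝ → ℂ, Continuous ψ ∧ ψ 0 = p ∧ ψ 1 = p ∧ InjOn ψ (Ico 0 1) ∧
      ψ '' Icc 0 1 = frontier W := by
  obtain ⟨-, -, -, φ, hφ, hinj, hr⟩ := hW
  obtain ⟨u, rfl⟩ : p ∈ range φ := hr ▸ hp
  have hu : ‖(u : ℂ)‖ = 1 := by simp
  have hu0 : (u : ℂ) ≠ 0 := norm_ne_zero_iff.1 (by rw [hu]; exact one_ne_zero)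
  have hmem : ∀ t : ℝ, (u : ℂ) * exp ((2 * Real.pi * t : ℝ) * I) ∈ sphere (0 : ℂ) 1 := fun t ↦ by
    rw [mem_sphere_zero_iff_norm, norm_mul, hu, norm_exp_ofReal_mul_I, mul_one]
  refine ⟨fun t ↦ φ ⟨_, hmem t⟩, hφ.comp (by fun_prop), congrArg φ (by simp),
    congrArg φ (Subtype.ext (by simp)), ?_, ?_⟩
  · intro s hs t ht hst
    have h := mul_left_cancel₀ hu0 (Subtype.ext_iff.1 (hinj hst))
    obtain ⟨n, hn⟩ := exp_eq_exp_iff_exists_int.1 h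
    have h2 : s = t + n := by
      have : (2 * Real.pi * I : ℂ) * s = (2 * Real.pi * I) * (t + n) := by
        push_cast at hn
        linear_combination hn
      exact_mod_cast mul_left_cancel₀ two_pi_I_ne_zero this
    have h3 : (n : ℝ) < 1 := by linarith [hs.2, ht.1]
    have h4 : (-1 : ℝ) < n := by linarith [hs.1, ht.2]
    have h5 : n = 0 := by
      have : n < 1 := by exact_mod_cast h3
      have : -1 < n := by exact_mod_cast h4
      omega
    simpa [h5] using h2
  · rw [← hr]
    refine Subset.antisymm (by rintro _ ⟨t, -, rfl⟩; exact mem_range_self _) ?_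
    rintro _ ⟨v, rfl⟩
    have hv : ‖(v : ℂ)‖ = 1 := by simp
    refine ⟨Int.fract (arg (v / u) / (2 * Real.pi)), ⟨Int.fract_nonneg _, (Int.fract_lt_one _).le⟩,
      congrArg φ (Subtype.ext ?_)⟩
    have hπ : (Real.pi : ℂ) ≠ 0 := ofReal_ne_zero.2 Real.pi_ne_zero
    have h1 : exp ((2 * Real.pi * Int.fract (arg (v / u) / (2 * Real.pi)) : ℝ) * I) =
        exp (arg (v / u) * I) := by
      rw [exp_eq_exp_iff_exists_int]
      refine ⟨-⌊arg (v / u) / (2 * Real.pi)⌋, ?_⟩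
      rw [Int.fract]
      push_cast
      field_simp
      ring
    have h2 := norm_mul_exp_arg_mul_I (v / u : ℂ)
    rw [norm_div, hu, hv, div_one, ofReal_one, one_mul] at h2
    simp only [h1, h2]
    field_simp

lemma JordanDomain.mem_closure_compl_closure {W : Set ℂ} (hW : JordanDomain W) {p : ℂ}
    (hp : p ∈ frontier W) : p ∈ closure (closure W)ᶜ := by
  obtain ⟨ψ, hψ, h0, h1, hinj, him⟩ := hW.exists_param hp
  obtain ⟨hWo, hWc, hWb, -⟩ := hW
  by_contra hpc
  rw [closure_compl, notMem_compl_iff] at hpc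
  have hO : IsOpen (ψ ⁻¹' interior (closure W)) := isOpen_interior.preimage hψ
  obtain ⟨r₀, hr₀, hb₀⟩ := Metric.isOpen_iff.1 hO 0 (by rwa [mem_preimage, h0])
  obtain ⟨r₁, hr₁, hb₁⟩ := Metric.isOpen_iff.1 hO 1 (by rwa [mem_preimage, h1])
  obtain ⟨d, hd, hdm⟩ := exists_between (lt_min (lt_min hr₀ hr₁) (one_half_pos (α := ℝ)))
  simp only [lt_min_iff] at hdm
  have hA : IsClosed (ψ '' Icc d (1 - d)) := (isCompact_Icc.image hψ).isClosed
  have hAf : ψ '' Icc d (1 - d) ⊆ frontier W := by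
    rw [← him]
    exact image_mono (Icc_subset_Icc hd.le (by linarith))
  have hWO : W ⊆ interior (closure W) := interior_maximal subset_closure hWo
  have hWf : ∀ x ∈ W, x ∉ frontier W := fun x hx hxf ↦
    (hWo.frontier_eq ▸ hxf : x ∈ closure W \ W).2 hx
  have hWV : W ⊆ interior (closure W) \ ψ '' Icc d (1 - d) := fun x hx ↦
    ⟨hWO hx, fun h ↦ hWf x hx (hAf h)⟩
  obtain ⟨w, hw⟩ := hWc.nonempty
  refine not_hasLogOn_of_frontier_subset (K := ψ '' Icc d (1 - d))
    (hWb.closure.subset (sdiff_subset.trans interior_subset)) ?_ (hWV hw)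
    (hasLogOn_image_Icc (by linarith) hψ.continuousOn
      (hinj.mono (Icc_subset_Ico (by linarith) (by linarith))) (hWV hw).2)
  intro x hx
  rw [(isOpen_interior.sdiff hA).frontier_eq] at hx
  by_contra hxA
  have hxW : x ∈ closure W := closure_minimal (sdiff_subset.trans interior_subset) isClosed_closure
    hx.1
  refine hx.2 ⟨?_, hxA⟩
  by_cases hxw : x ∈ W
  · exact hWO hxw
  · have : x ∈ ψ '' Icc 0 1 := by rw [him, hWo.frontier_eq]; exact ⟨hxW, hxw⟩
    obtain ⟨t, ht, rfl⟩ := this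
    rcases lt_or_ge t d with h | h
    · exact hb₀ (by rw [mem_ball, Real.dist_eq, abs_lt]; constructor <;> linarith [ht.1])
    rcases lt_or_ge (1 - d) t with h' | h'
    · exact hb₁ (by rw [mem_ball, Real.dist_eq, abs_lt]; constructor <;> linarith [ht.2])
    · exact (hxA ⟨t, ⟨h, h'⟩, rfl⟩).elim

lemma CrossCut.disjoint {W : Set ℂ} (hWo : IsOpen W) {γ : ℝ → ℂ} (hγ : CrossCut (closure W) γ) :
    Disjoint W (γ '' Icc 0 1) := by
  obtain ⟨hc, -, -, -, -, hout⟩ := hγ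
  rw [Set.disjoint_right]
  rintro _ ⟨t, ht, rfl⟩ htW
  have hcl : t ∈ closure (Ioo (0 : ℝ) 1) := by rwa [closure_Ioo zero_ne_one]
  have := mem_closure_iff_nhdsWithin_neBot.1 hcl
  have h1 : ∀ᶠ s in nhdsWithin t (Ioo (0 : ℝ) 1), γ s ∈ W :=
    ((hc t ht).mono Ioo_subset_Icc_self).eventually (hWo.mem_nhds htW)
  obtain ⟨s, hs, hs'⟩ := (h1.and self_mem_nhdsWithin).exists
  exact hout s hs' (subset_closure hs)

lemma JordanDomain.hasLogOn_of_notMem_closure {W : Set ℂ} (hW : JordanDomain W) {γ : ℝ → ℂ}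
    (hγ : CrossCut (closure W) γ) {p : ℂ} (hp : p ∈ frontier W)
    (hpG : p ∉ closure (CrossCutRegion (closure W) γ)) {L : Set ℂ} (hL : IsCompact L)
    (hγL : γ '' Icc 0 1 ⊆ L) (hLs : L ⊆ frontier W ∪ γ '' Icc 0 1) (hpL : p ∉ L) {w : ℂ}
    (hw : w ∈ W) : HasLogOn L w := by
  have hWo := hW.1
  obtain ⟨s, hs, hb⟩ := Metric.isOpen_iff.1 (hL.isClosed.isOpen_compl.inter
    (isClosed_closure (s := CrossCutRegion (closure W) γ)).isOpen_compl) p ⟨hpL, hpG⟩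
  obtain ⟨x, hx, hxW⟩ := mem_closure_iff.1 (hW.mem_closure_compl_closure hp) _ isOpen_ball
    (mem_ball_self hs)
  obtain ⟨y, hy, hyW⟩ := mem_closure_iff.1 (frontier_subset_closure hp) _ isOpen_ball
    (mem_ball_self hs)
  have hxm : x ∈ (closure W ∪ γ '' Icc 0 1)ᶜ := by
    rintro (h | h)
    · exact hxW h
    · exact (hb hx).1 (hγL h)
  have hxC := mem_connectedComponentIn hxm
  have hunb : ¬ Bornology.IsBounded (connectedComponentIn (closure W ∪ γ '' Icc 0 1)ᶜ x) :=
    fun h ↦ (hb hx).2 (subset_closure ⟨hxm, h⟩)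
  refine hasLogOn_of_unbounded (S := (W ∪ ball p s) ∪
    connectedComponentIn (closure W ∪ γ '' Icc 0 1)ᶜ x) hL ?_ ?_
    (fun h ↦ hunb (h.subset subset_union_right)) (Or.inl (Or.inl hw))
  · exact (hW.2.1.isPreconnected.union y hyW hy (convex_ball p s).isPreconnected).union x
      (Or.inr hx) hxC isPreconnected_connectedComponentIn
  · rw [Set.disjoint_left]
    rintro z ((hz | hz) | hz) hzL
    · rcases hLs hzL with h | h
      · exact (hWo.frontier_eq ▸ h : z ∈ closure W \ W).2 hz
      · exact Set.disjoint_left.1 (hγ.disjoint hWo) hz h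
    · exact (hb hz).1 hzL
    · exact connectedComponentIn_subset _ _ hz
        ((hLs hzL).imp (fun h ↦ frontier_subset_closure h) id)

/-- The closure of the region cut off by a cross-cut contains a boundary arc joining the end points
of the cross-cut. -/
lemma JordanDomain.exists_arc_subset_closure {W : Set ℂ} (hW : JordanDomain W) {γ : ℝ → ℂ}
    (hγ : CrossCut (closure W) γ) :
    ∃ α : Set ℂ, IsPreconnected α ∧ γ 0 ∈ α ∧ γ 1 ∈ α ∧ α ⊆ frontier W ∧
      α ⊆ closure (CrossCutRegion (closure W) γ) := by
  have hWo := hW.1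
  have hmem : ∀ t ∈ Icc (0 : ℝ) 1, γ t ∈ closure W → γ t ∈ frontier W := fun t ht h ↦ by
    rw [hWo.frontier_eq]
    exact ⟨h, Set.disjoint_right.1 (hγ.disjoint hWo) (mem_image_of_mem _ ht)⟩
  have hdisj := hγ.disjoint hWo
  have hγ' := hγ
  obtain ⟨hc, -, h0, h1, hne, hout⟩ := hγ'
  have hm0 : (0 : ℝ) ∈ Icc (0 : ℝ) 1 := by simp
  have hm1 : (1 : ℝ) ∈ Icc (0 : ℝ) 1 := by simp
  obtain ⟨ψ, hψ, hψ0, hψ1, hinj, him⟩ := hW.exists_param (hmem 0 hm0 h0)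
  obtain ⟨t₁, ht₁, hψt⟩ : γ 1 ∈ ψ '' Icc 0 1 := him ▸ hmem 1 hm1 h1
  have ht0 : 0 < t₁ := ht₁.1.lt_of_ne fun h ↦ hne (by rw [← hψ0, ← hψt, h])
  have ht1 : t₁ < 1 := ht₁.2.lt_of_ne fun h ↦ hne (by rw [← hψ1, ← hψt, h])
  set Γ := γ '' Icc 0 1 with hΓ
  have hΓc : IsCompact Γ := isCompact_Icc.image_of_continuousOn hc
  have hΓ0 : γ 0 ∈ Γ := mem_image_of_mem _ hm0
  have hΓ1 : γ 1 ∈ Γ := mem_image_of_mem _ hm1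
  have hΓf : ∀ x ∈ Γ, x ∈ frontier W → x = γ 0 ∨ x = γ 1 := by
    rintro _ ⟨t, ht, rfl⟩ hx
    rcases ht.1.eq_or_lt with rfl | h
    · exact Or.inl rfl
    rcases ht.2.eq_or_lt with rfl | h'
    · exact Or.inr rfl
    · exact (hout t ⟨h, h'⟩ (frontier_subset_closure hx)).elim
  have hψf : ∀ t ∈ Icc (0 : ℝ) 1, ψ t ∈ frontier W := fun t ht ↦ him ▸ mem_image_of_mem _ ht
  have hψΓ : ∀ t ∈ Ioo (0 : ℝ) 1, ψ t ∈ Γ → t = t₁ := fun t ht h ↦ by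
    rcases hΓf _ h (hψf t ⟨ht.1.le, ht.2.le⟩) with h | h
    · exact (ht.1.ne' (hinj ⟨ht.1.le, ht.2⟩ ⟨le_rfl, zero_lt_one⟩ (h.trans hψ0.symm))).elim
    · exact hinj ⟨ht.1.le, ht.2⟩ ⟨ht0.le, ht1⟩ (h.trans hψt.symm)
  have harc : ∀ a b : ℝ, 0 ≤ a → a < b → b ≤ 1 →
      (∀ t ∈ Ioo a b, ψ t ∈ closure (CrossCutRegion (closure W) γ)) →
      γ 0 ∈ ψ '' Icc a b → γ 1 ∈ ψ '' Icc a b →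
      ∃ α : Set ℂ, IsPreconnected α ∧ γ 0 ∈ α ∧ γ 1 ∈ α ∧ α ⊆ frontier W ∧
        α ⊆ closure (CrossCutRegion (closure W) γ) := by
    intro a b ha hab hb h hg0 hg1
    refine ⟨ψ '' Icc a b, isPreconnected_Icc.image _ hψ.continuousOn, hg0, hg1, ?_, ?_⟩
    · rw [← him]
      exact image_mono (Icc_subset_Icc ha hb)
    · rw [← closure_Ioo hab.ne]
      exact (image_closure_subset_closure_image hψ).trans
        (closure_minimal (image_subset_iff.2 h) isClosed_closure)
  by_cases hα : ∀ t ∈ Ioo 0 t₁, ψ t ∈ closure (CrossCutRegion (closure W) γ)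
  · exact harc 0 t₁ le_rfl ht0 ht1.le hα ⟨0, ⟨le_rfl, ht0.le⟩, hψ0⟩
      ⟨t₁, ⟨ht0.le, le_rfl⟩, hψt⟩
  by_cases hβ : ∀ t ∈ Ioo t₁ 1, ψ t ∈ closure (CrossCutRegion (closure W) γ)
  · exact harc t₁ 1 ht0.le ht1 le_rfl hβ ⟨1, ⟨ht1.le, le_rfl⟩, hψ1⟩
      ⟨t₁, ⟨le_rfl, ht1.le⟩, hψt⟩
  exfalso
  push Not at hα hβ
  obtain ⟨s, hs, hsG⟩ := hα
  obtain ⟨t, ht, htG⟩ := hβ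
  obtain ⟨w, hw⟩ := hW.2.1.nonempty
  have hsub : ∀ a b : ℝ, 0 ≤ a → b ≤ 1 → ψ '' Icc a b ∪ Γ ⊆ frontier W ∪ Γ := fun a b ha hb ↦
    union_subset_union_left _ (him ▸ image_mono (Icc_subset_Icc ha hb))
  have hcpt : ∀ a b : ℝ, IsCompact (ψ '' Icc a b ∪ Γ) := fun a b ↦
    (isCompact_Icc.image hψ).union hΓc
  have hA : HasLogOn (ψ '' Icc t₁ 1 ∪ Γ) w := by
    refine hW.hasLogOn_of_notMem_closure hγ (hψf s ⟨hs.1.le, by linarith [hs.2]⟩) hsG (hcpt _ _)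
      subset_union_right (hsub _ _ ht0.le le_rfl) ?_ hw
    rintro (⟨r, hr, hrs⟩ | h)
    · rcases hr.2.eq_or_lt with rfl | hr1
      · rw [hψ1, ← hψ0] at hrs
        have := hinj ⟨le_rfl, zero_lt_one⟩ ⟨hs.1.le, by linarith [hs.2]⟩ hrs
        linarith [hs.1]
      · have := hinj ⟨ht0.le.trans hr.1, hr1⟩ ⟨hs.1.le, by linarith [hs.2]⟩ hrs
        linarith [hs.2, hr.1]
    · exact hs.2.ne (hψΓ s ⟨hs.1, by linarith [hs.2]⟩ h)
  have hB : HasLogOn (ψ '' Icc 0 t₁ ∪ Γ) w := by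
    refine hW.hasLogOn_of_notMem_closure hγ (hψf t ⟨by linarith [ht.1], ht.2.le⟩) htG (hcpt _ _)
      subset_union_right (hsub _ _ le_rfl ht1.le) ?_ hw
    rintro (⟨r, hr, hrs⟩ | h)
    · have := hinj ⟨hr.1, hr.2.trans_lt ht1⟩ ⟨by linarith [ht.1], ht.2⟩ hrs
      linarith [ht.1, hr.2]
    · exact ht.1.ne' (hψΓ t ⟨by linarith [ht.1], ht.2⟩ h)
  refine not_hasLogOn_of_frontier_subset hW.2.2.1 ?_ hw (HasLogOn.union (C := Γ)
    (hcpt _ _).isClosed (hcpt _ _).isClosed (isPreconnected_Icc.image _ hc) subset_union_right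
    subset_union_right ?_ hA hB)
  · rw [← him]
    rintro _ ⟨r, hr, rfl⟩
    rcases le_total r t₁ with h | h
    · exact Or.inr (Or.inl ⟨r, ⟨hr.1, h⟩, rfl⟩)
    · exact Or.inl (Or.inl ⟨r, ⟨h, hr.2⟩, rfl⟩)
  · rintro _ ⟨⟨r, hr, rfl⟩ | h, ⟨q, hq, hqr⟩ | h'⟩
    · rcases hr.2.eq_or_lt with rfl | hr1
      · rw [hψ1]; exact hΓ0
      · have := hinj ⟨hq.1, hq.2.trans_lt ht1⟩ ⟨ht0.le.trans hr.1, hr1⟩ hqr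
        have : r = t₁ := le_antisymm (this ▸ hq.2) hr.1
        rw [this, hψt]; exact hΓ1
    · exact h'
    · exact h
    · exact h

/-- The radial twist `z ↦ z * exp (i τ(|z|))`. -/
def twist (τ : ℝ → ℝ) (hτ : Continuous τ) : ℂ ≃ₜ ℂ where
  toFun z := z * exp (τ ‖z‖ * I)
  invFun z := z * exp (-(τ ‖z‖ * I))
  left_inv z := by
    simp only [norm_mul, norm_exp_ofReal_mul_I, mul_one, mul_assoc, ← exp_add, add_neg_cancel,
      exp_zero]
  right_inv z := by
    have : ‖exp (-(τ ‖z‖ * I))‖ = 1 := by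
      rw [← neg_mul, ← ofReal_neg, norm_exp_ofReal_mul_I]
    simp only [norm_mul, this, mul_one, mul_assoc, ← exp_add, neg_add_cancel, exp_zero]
  continuous_toFun := by fun_prop
  continuous_invFun := by fun_prop

lemma twist_apply {τ : ℝ → ℝ} (hτ : Continuous τ) (z : ℂ) :
    twist τ hτ z = z * exp (τ ‖z‖ * I) := rfl

lemma norm_twist {τ : ℝ → ℝ} (hτ : Continuous τ) (z : ℂ) : ‖twist τ hτ z‖ = ‖z‖ := by
  rw [twist_apply, norm_mul, norm_exp_ofReal_mul_I, mul_one]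

lemma norm_twist_symm {τ : ℝ → ℝ} (hτ : Continuous τ) (z : ℂ) :
    ‖(twist τ hτ).symm z‖ = ‖z‖ := by
  rw [← norm_twist hτ, Homeomorph.apply_symm_apply]

lemma continuous_ofReal_mul_self {p : ℂ → ℝ} {M : ℝ} (hc : ContinuousOn p {0}ᶜ)
    (hM : ∀ z, |p z| ≤ M) : Continuous fun z : ℂ ↦ (p z : ℂ) * z := by
  refine continuous_iff_continuousAt.2 fun z ↦ ?_
  by_cases hz : z = 0
  · subst hz
    rw [ContinuousAt, mul_zero]
    refine squeeze_zero_norm (a := fun z : ℂ ↦ M * ‖z‖) (fun z ↦ ?_) ?_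
    · rw [norm_mul, norm_real, Real.norm_eq_abs]
      gcongr
      exact hM z
    · have : Continuous fun z : ℂ ↦ M * ‖z‖ := by fun_prop
      simpa using this.tendsto 0
  · have : ContinuousAt p z := hc.continuousAt (isOpen_compl_singleton.mem_nhds hz)
    fun_prop

/-- The homeomorphism of the plane scaling each ray from the origin by a positive factor. -/
def rayScaling (p : ℂ → ℝ) (m M : ℝ) (hm : 0 < m) (hc : ContinuousOn p {0}ᶜ)
    (hp : ∀ z, m ≤ p z) (hM : ∀ z, p z ≤ M) (hs : ∀ t : ℝ, 0 < t → ∀ z, p (t * z) = p z) :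
    ℂ ≃ₜ ℂ where
  toFun z := p z * z
  invFun z := ((p z)⁻¹ : ℝ) * z
  left_inv z := by
    have h := hm.trans_le (hp z)
    have : (p z : ℂ) ≠ 0 := ofReal_ne_zero.2 h.ne'
    simp only [hs _ h, ofReal_inv]
    field_simp
  right_inv z := by
    have h := hm.trans_le (hp z)
    have : (p z : ℂ) ≠ 0 := ofReal_ne_zero.2 h.ne'
    simp only [hs _ (inv_pos.2 h)]
    rw [ofReal_inv]
    field_simp
  continuous_toFun := continuous_ofReal_mul_self hc fun z ↦ by
    rw [abs_of_pos (hm.trans_le (hp z))]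
    exact hM z
  continuous_invFun := continuous_ofReal_mul_self (M := m⁻¹)
    (hc.inv₀ fun z _ ↦ (hm.trans_le (hp z)).ne') fun z ↦ by
      rw [abs_of_pos (inv_pos.2 (hm.trans_le (hp z)))]
      exact inv_anti₀ hm (hp z)

lemma norm_rayScaling_symm (p : ℂ → ℝ) (m M : ℝ) (hm : 0 < m) (hc : ContinuousOn p {0}ᶜ)
    (hp : ∀ z, m ≤ p z) (hM : ∀ z, p z ≤ M) (hs : ∀ t : ℝ, 0 < t → ∀ z, p (t * z) = p z) (z : ℂ) :
    ‖(rayScaling p m M hm hc hp hM hs).symm z‖ = ‖z‖ / p z := by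
  change ‖(((p z)⁻¹ : ℝ) : ℂ) * z‖ = _
  rw [norm_mul, norm_real, Real.norm_of_nonneg (inv_nonneg.2 (hm.le.trans (hp z)))]
  ring

lemma jordanDomain_image_ball (H : ℂ ≃ₜ ℂ) : JordanDomain (H '' ball 0 1) := by
  refine ⟨H.isOpenMap _ isOpen_ball, ((convex_ball (0 : ℂ) 1).isConnected
    ⟨0, mem_ball_self one_pos⟩).image H H.continuous.continuousOn, ?_, fun z ↦ H z,
    by fun_prop, H.injective.comp Subtype.val_injective, ?_⟩
  · exact ((isCompact_closedBall (0 : ℂ) 1).image H.continuous).isBounded.subset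
      (image_mono ball_subset_closedBall)
  · rw [← H.image_frontier, frontier_ball _ one_ne_zero, ← image_eq_range]

/-- The profile of a star-shaped domain with `N` arms: the radius in the direction of `z`. -/
def armProfile (N : ℕ) (ρ₀ ρ₁ : ℝ) (z : ℂ) : ℝ :=
  ρ₀ + (ρ₁ - ρ₀) * (1 + ((z / ‖z‖) ^ N).re) / 2

lemma armProfile_mem_Icc (N : ℕ) {ρ₀ ρ₁ : ℝ} (h : ρ₀ ≤ ρ₁) (z : ℂ) :
    armProfile N ρ₀ ρ₁ z ∈ Icc ρ₀ ρ₁ := by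
  have h1 : ‖(z / ‖z‖) ^ N‖ ≤ 1 := by
    rw [norm_pow, norm_div, norm_real, norm_norm]
    exact pow_le_one₀ (by positivity) (div_self_le_one _)
  have h2 := (abs_le.1 ((abs_re_le_norm _).trans h1))
  unfold armProfile
  constructor <;> nlinarith [h2.1, h2.2]

lemma armProfile_of_pow_eq {N : ℕ} {ρ₀ ρ₁ s : ℝ} {z : ℂ} (hz : z ≠ 0)
    (h : z ^ N = s * (‖z‖ : ℂ) ^ N) :
    armProfile N ρ₀ ρ₁ z = ρ₀ + (ρ₁ - ρ₀) * (1 + s) / 2 := by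
  have : (‖z‖ : ℂ) ^ N ≠ 0 := pow_ne_zero _ (ofReal_ne_zero.2 (norm_ne_zero_iff.2 hz))
  rw [armProfile, div_pow, h, mul_div_cancel_right₀ _ this, ofReal_re]

lemma continuousOn_armProfile (N : ℕ) (ρ₀ ρ₁ : ℝ) : ContinuousOn (armProfile N ρ₀ ρ₁) {0}ᶜ := by
  have : ContinuousOn (fun z : ℂ ↦ z / (‖z‖ : ℂ)) {0}ᶜ :=
    continuousOn_id.div (by fun_prop) fun z hz ↦ ofReal_ne_zero.2 (norm_ne_zero_iff.2 hz)
  unfold armProfile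
  fun_prop

lemma armProfile_ofReal_mul (N : ℕ) (ρ₀ ρ₁ t : ℝ) (ht : 0 < t) (z : ℂ) :
    armProfile N ρ₀ ρ₁ (t * z) = armProfile N ρ₀ ρ₁ z := by
  have : (t : ℂ) ≠ 0 := ofReal_ne_zero.2 ht.ne'
  unfold armProfile
  rw [norm_mul, norm_real, Real.norm_of_nonneg ht.le, ofReal_mul, mul_div_mul_left _ _ this]

/-- Every direction is within angle `π / N` of an `N`-th root of unity. -/
lemma exists_root_mul_exp {N : ℕ} (hN : 0 < N) (z : ℂ) :
    ∃ c : ℂ, ∃ ψ : ℝ, ‖c‖ = 1 ∧ c ^ N = 1 ∧ |ψ| ≤ Real.pi / N ∧ z = ‖z‖ * c * exp (ψ * I) := by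
  have hN' : (0 : ℝ) < N := Nat.cast_pos.2 hN
  set x : ℝ := N * arg z / (2 * Real.pi)
  refine ⟨exp ((2 * Real.pi * round x / N : ℝ) * I), 2 * Real.pi * (x - round x) / N,
    norm_exp_ofReal_mul_I _, ?_, ?_, ?_⟩
  · rw [← exp_nat_mul, exp_eq_one_iff]
    refine ⟨round x, ?_⟩
    have : (N : ℂ) ≠ 0 := Nat.cast_ne_zero.2 hN.ne'
    push_cast
    field_simp
  · have := abs_sub_round x
    rw [abs_div, abs_mul, abs_of_pos Real.two_pi_pos, Nat.abs_cast]
    gcongr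
    nlinarith [Real.pi_pos]
  · rw [mul_assoc, ← exp_add, ← add_mul, ← ofReal_add]
    have : 2 * Real.pi * round x / N + 2 * Real.pi * (x - round x) / N = arg z := by
      simp only [x]
      field_simp
      ring
    rw [this, norm_mul_exp_arg_mul_I]

/-- Every direction is within angle `π / N` of an `N`-th root of `-1`. -/
lemma exists_neg_root_mul_exp {N : ℕ} (hN : 0 < N) (z : ℂ) :
    ∃ c : ℂ, ∃ ψ : ℝ, ‖c‖ = 1 ∧ c ^ N = -1 ∧ |ψ| ≤ Real.pi / N ∧ z = ‖z‖ * c * exp (ψ * I) := by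
  obtain ⟨c, ψ, hc, hcN, hψ, hz⟩ :=
    exists_root_mul_exp hN (z * exp ((Real.pi / N : ℝ) * I))
  have hN' : (N : ℂ) ≠ 0 := Nat.cast_ne_zero.2 hN.ne'
  refine ⟨c * exp ((-(Real.pi / N) : ℝ) * I), ψ, by
    rw [norm_mul, hc, norm_exp_ofReal_mul_I, one_mul], ?_, hψ, ?_⟩
  · rw [mul_pow, hcN, ← exp_nat_mul, one_mul]
    have : (N : ℂ) * ((-(Real.pi / N) : ℝ) * I) = -(Real.pi * I) := by
      push_cast
      field_simp
    rw [this, exp_neg, exp_pi_mul_I]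
    norm_num
  · rw [norm_mul, norm_exp_ofReal_mul_I, mul_one] at hz
    have h1 : exp ((Real.pi / N : ℝ) * I) * exp ((-(Real.pi / N) : ℝ) * I) = 1 := by
      rw [← exp_add, ofReal_neg, neg_mul, add_neg_cancel, exp_zero]
    linear_combination (exp ((-(Real.pi / N) : ℝ) * I)) * hz - z * h1

lemma norm_sub_mul_exp_le {r s ψ : ℝ} (hr : 0 ≤ r) :
    ‖(r : ℂ) - s * exp (ψ * I)‖ ≤ |r - s| + r * |ψ| := by
  have h : (r : ℂ) - s * exp (ψ * I) =
      ((r - s : ℝ) : ℂ) * exp (ψ * I) - r * (exp (ψ * I) - 1) := by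
    push_cast
    ring
  rw [h]
  refine (norm_sub_le _ _).trans ?_
  rw [norm_mul, norm_mul, norm_real, norm_real, norm_exp_ofReal_mul_I, mul_one,
    Real.norm_of_nonneg hr, Real.norm_eq_abs]
  gcongr
  rw [mul_comm]
  exact Real.norm_exp_I_mul_ofReal_sub_one_le

/-- A point of the twisted rays `w ^ N = s * ‖w‖ ^ N` with prescribed modulus close to `z`. -/
lemma exists_twist_near {τ : ℝ → ℝ} (hτ : Continuous τ) {N : ℕ} {s : ℂ} {θ : ℝ}
    (hs : ∀ z : ℂ, ∃ c : ℂ, ∃ ψ : ℝ, ‖c‖ = 1 ∧ c ^ N = s ∧ |ψ| ≤ θ ∧ z = ‖z‖ * c * exp (ψ * I))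
    (z : ℂ) {r : ℝ} (hr : 0 ≤ r) :
    ∃ w : ℂ, ‖w‖ = r ∧ w ^ N = s * (‖w‖ : ℂ) ^ N ∧ dist (twist τ hτ w) z ≤ |r - ‖z‖| + r * θ := by
  obtain ⟨c, ψ, hc, hcN, hψ, hz⟩ := hs (z * exp ((-τ r : ℝ) * I))
  have hw : ‖(r : ℂ) * c‖ = r := by rw [norm_mul, hc, norm_real, Real.norm_of_nonneg hr, mul_one]
  refine ⟨r * c, hw, by rw [hw, mul_pow, hcN, mul_comm], ?_⟩
  rw [norm_mul, norm_exp_ofReal_mul_I, mul_one] at hz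
  have h1 : exp ((-τ r : ℝ) * I) * exp (τ r * I) = 1 := by
    rw [← exp_add, ofReal_neg, neg_mul, neg_add_cancel, exp_zero]
  have h2 : twist τ hτ (r * c) - z = c * exp (τ r * I) * (r - ‖z‖ * exp (ψ * I)) := by
    rw [twist_apply, hw]
    linear_combination (-exp (τ r * I)) * hz + z * h1
  rw [dist_eq_norm, h2, norm_mul, norm_mul, hc, norm_exp_ofReal_mul_I, one_mul, one_mul]
  exact (norm_sub_mul_exp_le hr).trans (by gcongr)

/-- A point making angle at most `θ` with the direction `c`. -/
lemma exists_eq_mul_exp_of_cos_le {w c : ℂ} (hc : ‖c‖ = 1) {θ : ℝ} (hθ : 0 ≤ θ)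
    (hθ' : θ ≤ Real.pi) (h : ‖w‖ * Real.cos θ ≤ (w * (starRingEnd ℂ) c).re) :
    ∃ ψ : ℝ, |ψ| ≤ θ ∧ w = ‖w‖ * c * exp (ψ * I) ∧
      (w ≠ 0 → (w * (starRingEnd ℂ) c).re = ‖w‖ * Real.cos θ → |ψ| = θ) := by
  have hcc : c * (starRingEnd ℂ) c = 1 := by
    rw [mul_conj, normSq_eq_norm_sq, hc]; simp
  have hn : ‖w * (starRingEnd ℂ) c‖ = ‖w‖ := by rw [norm_mul, RCLike.norm_conj, hc, mul_one]
  by_cases hw : w = 0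
  · exact ⟨0, by simpa using hθ, by simp [hw], fun h ↦ (h hw).elim⟩
  have hw' : 0 < ‖w‖ := norm_pos_iff.2 hw
  have hre : (w * (starRingEnd ℂ) c).re = ‖w‖ * Real.cos |arg (w * (starRingEnd ℂ) c)| := by
    rw [Real.cos_abs, ← hn, norm_mul_cos_arg]
  have hmem : |arg (w * (starRingEnd ℂ) c)| ∈ Icc 0 Real.pi := ⟨abs_nonneg _, abs_arg_le_pi _⟩
  refine ⟨arg (w * (starRingEnd ℂ) c), ?_, ?_, fun _ he ↦ ?_⟩
  · rw [hre] at h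
    exact (Real.strictAntiOn_cos.le_iff_ge ⟨hθ, hθ'⟩ hmem).1 (le_of_mul_le_mul_left h hw')
  · have := norm_mul_exp_arg_mul_I (w * (starRingEnd ℂ) c)
    rw [hn] at this
    rw [mul_right_comm, this]
    linear_combination -w * hcc
  · rw [hre] at he
    exact Real.injOn_cos hmem ⟨hθ, hθ'⟩ (mul_left_cancel₀ hw'.ne' he)

/-- The radial arms `w ^ N = ‖w‖ ^ N`, up to radius `R`. -/
def innerArms (N : ℕ) (R : ℝ) : Set ℂ := {w | ‖w‖ ≤ R ∧ w ^ N = (‖w‖ : ℂ) ^ N}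

/-- The exterior of the disc of radius `R`, with the radial slits `w ^ N = -‖w‖ ^ N` reaching down
to radius `ρ`. -/
def outerSlits (N : ℕ) (ρ R : ℝ) : Set ℂ :=
  {w | R ≤ ‖w‖ ∨ ρ ≤ ‖w‖ ∧ w ^ N = -(‖w‖ : ℂ) ^ N}

lemma mem_outerSlits_of_abs_eq {N : ℕ} (hN : 0 < N) {ρ R : ℝ} {w c : ℂ} {ψ : ℝ} (hcN : c ^ N = 1)
    (hψ : |ψ| = Real.pi / N) (hw : w = ‖w‖ * c * exp (ψ * I)) (hρ : ρ ≤ ‖w‖) :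
    w ∈ outerSlits N ρ R := by
  refine Or.inr ⟨hρ, ?_⟩
  have hN' : (N : ℂ) ≠ 0 := Nat.cast_ne_zero.2 hN.ne'
  have he : exp (ψ * I) ^ N = -1 := by
    rw [← exp_nat_mul]
    rcases (abs_eq (by positivity)).1 hψ with h | h
    · have : (N : ℂ) * (ψ * I) = Real.pi * I := by
        rw [h]; push_cast; field_simp
      rw [this, exp_pi_mul_I]
    · have : (N : ℂ) * (ψ * I) = -(Real.pi * I) := by
        rw [h]; push_cast; field_simp
      rw [this, exp_neg, exp_pi_mul_I]; norm_num
  calc w ^ N = (‖w‖ * c * exp (ψ * I)) ^ N := by rw [← hw]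
    _ = _ := by rw [mul_pow, mul_pow, hcN, he]; ring

/-- The twisting angle: constant beyond radius `σ`, and turning once around the origin on each
radial interval of length `η` below it. -/
def spiralAngle (η σ r : ℝ) : ℝ := 2 * Real.pi / η * min r σ

lemma continuous_spiralAngle (η σ : ℝ) : Continuous (spiralAngle η σ) := by
  unfold spiralAngle
  fun_prop

/-- The spiral arm in the direction `c` passes near every point of a thin annulus. -/
lemma exists_radius_spiralAngle {η σ : ℝ} (hη : 0 < η) {c : ℂ} (hc : ‖c‖ = 1) (z : ℂ) {m : ℝ}
    (hm : m ≤ σ) :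
    ∃ r ∈ Icc (m - η) m, z = ‖z‖ * c * exp (spiralAngle η σ r * I) := by
  obtain ⟨n, hn, -⟩ := existsUnique_add_zsmul_mem_Ico Real.two_pi_pos
    (arg (z * (starRingEnd ℂ) c)) (2 * Real.pi / η * (m - η))
  set t := arg (z * (starRingEnd ℂ) c) with ht
  have hpi := Real.two_pi_pos
  have h1 : 2 * Real.pi / η * (m - η) + 2 * Real.pi = 2 * Real.pi / η * m := by
    field_simp; ring
  rw [h1, zsmul_eq_mul] at hn
  have h2 : 2 * Real.pi / η * (η / (2 * Real.pi) * (t + n * (2 * Real.pi))) =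
      t + n * (2 * Real.pi) := by
    field_simp
  have hk : 0 < 2 * Real.pi / η := by positivity
  refine ⟨η / (2 * Real.pi) * (t + n * (2 * Real.pi)), ⟨?_, ?_⟩, ?_⟩
  · refine le_of_mul_le_mul_left ?_ hk
    rw [h2]; exact hn.1
  · refine le_of_mul_le_mul_left ?_ hk
    rw [h2]; exact hn.2.le
  · have h3 : η / (2 * Real.pi) * (t + n * (2 * Real.pi)) ≤ σ := by
      refine le_trans (le_of_mul_le_mul_left ?_ hk) hm
      rw [h2]; exact hn.2.le
    have hcc : c * (starRingEnd ℂ) c = 1 := by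
      rw [mul_conj, normSq_eq_norm_sq, hc]; simp
    have h4 := norm_mul_exp_arg_mul_I (z * (starRingEnd ℂ) c)
    rw [norm_mul, RCLike.norm_conj, hc, mul_one, ← ht] at h4
    rw [spiralAngle, min_eq_left h3, h2]
    have h5 : exp ((t + n * (2 * Real.pi) : ℝ) * I) = exp (t * I) := by
      rw [exp_eq_exp_iff_exists_int]
      exact ⟨n, by push_cast; ring⟩
    rw [h5, mul_right_comm, h4]
    linear_combination -z * hcc

/-- A connected set avoiding the twisted slits and joining two distant points near the unit circle
has to follow a spiral arm, so that it comes close to every point. -/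
lemma exists_dist_lt_of_disjoint_slits {ε η σ : ℝ} (hη : 0 < η) (hηε : 40 * η ≤ ε)
    (hσ : 4 * η ≤ σ) (hσε : 1 - ε ≤ σ) (hσ1 : σ ≤ 1) {N : ℕ} (hN : 0 < N) (hNη : Real.pi / N ≤ η)
    {α : Set ℂ} (hα : IsPreconnected α)
    (hdisj : Disjoint
      (twist (spiralAngle η σ) (continuous_spiralAngle η σ) '' outerSlits N (2 * η) (1 - 10 * η)) α)
    {a b z : ℂ} (ha : a ∈ α) (hb : b ∈ α) (haσ : σ < ‖a‖) (hbσ : σ < ‖b‖) (hab : ε < ‖a - b‖)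
    (hz : ‖z‖ < 1 - 10 * η) : ∃ y ∈ α, dist y z < ε := by
  set T := twist (spiralAngle η σ) (continuous_spiralAngle η σ) with hT
  set θ := Real.pi / N with hθ
  have hN1 : (1 : ℝ) ≤ N := Nat.one_le_cast.2 hN
  have hθ0 : 0 < θ := by positivity
  have hθpi : θ ≤ Real.pi := div_le_self Real.pi_pos.le hN1
  have hnot : ∀ w, T w ∈ α → w ∉ outerSlits N (2 * η) (1 - 10 * η) := fun w hw hw' ↦
    Set.disjoint_left.1 hdisj (mem_image_of_mem _ hw') hw
  have hsymm : ∀ y ∈ α, T (T.symm y) ∈ α := fun y hy ↦ by rwa [T.apply_symm_apply]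
  have hlt : ∀ y ∈ α, ‖y‖ < 1 - 10 * η := fun y hy ↦ by
    by_contra! h
    refine hnot _ (hsymm y hy) (Or.inl ?_)
    rwa [norm_twist_symm]
  obtain ⟨c, ψ, hc, hcN, hψ, ha0⟩ := exists_root_mul_exp hN (T.symm a)
  obtain ⟨r, hr, hzr⟩ := exists_radius_spiralAngle hη hc z (σ := σ) (m := max (3 * η) (min ‖z‖ σ))
    (max_le (by linarith) (min_le_right _ _))
  have hr2 : 2 * η ≤ r := by linarith [hr.1, le_max_left (3 * η) (min ‖z‖ σ)]
  have hrσ : r ≤ σ := hr.2.trans (max_le (by linarith) (min_le_right _ _))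
  have hrz : |r - ‖z‖| ≤ ε - 9 * η := by
    have h0 := norm_nonneg z
    obtain ⟨h1, h2⟩ := hr
    rw [abs_le]
    rcases le_total ‖z‖ σ with h | h
    · rw [min_eq_left h] at h1 h2
      rcases le_total (3 * η) ‖z‖ with h' | h'
      · rw [max_eq_right h'] at h1 h2
        constructor <;> linarith
      · rw [max_eq_left h'] at h1 h2
        constructor <;> linarith
    · rw [min_eq_right h, max_eq_right (by linarith)] at h1 h2
      constructor <;> linarith
  by_contra! hcon
  set U : Set ℂ := {w | r < ‖w‖} ∩ {w | ‖w‖ * Real.cos θ < (w * (starRingEnd ℂ) c).re} with hU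
  set V : Set ℂ := {w | ‖w‖ < r} ∪ {w | (w * (starRingEnd ℂ) c).re < ‖w‖ * Real.cos θ} with hV
  have hUo : IsOpen U := (isOpen_lt (by fun_prop) (by fun_prop)).inter
    (isOpen_lt (by fun_prop) (by fun_prop))
  have hVo : IsOpen V := (isOpen_lt (by fun_prop) (by fun_prop)).union
    (isOpen_lt (by fun_prop) (by fun_prop))
  have hUV : Disjoint U V := by
    rw [Set.disjoint_left]
    rintro w ⟨h1, h2⟩ (h3 | h3)
    exacts [(mem_ofPred.1 h1).not_gt h3, (mem_ofPred.1 h2).not_gt h3]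
  have hsub : T.symm '' α ⊆ U ∪ V := by
    rintro _ ⟨y, hy, rfl⟩
    set w := T.symm y with hw
    by_contra h
    simp only [hU, hV, mem_union, mem_inter_iff, mem_ofPred_eq, not_or, not_and, not_lt] at h
    obtain ⟨h1, h2, h3⟩ := h
    obtain ⟨ψ', hψ', hwψ, heq⟩ := exists_eq_mul_exp_of_cos_le hc hθ0.le hθpi h3
    have hw0 : w ≠ 0 := norm_pos_iff.1 (by linarith)
    rcases h2.lt_or_eq with h4 | h4
    · exact hnot w (hsymm y hy)
        (mem_outerSlits_of_abs_eq hN hcN (heq hw0 (le_antisymm (h1 h4) h3)) hwψ (by linarith))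
    · refine (hcon y hy).not_gt ?_
      have h5 : y - z = c * exp (spiralAngle η σ r * I) * exp (ψ' * I) *
          (r - ‖z‖ * exp ((-ψ' : ℝ) * I)) := by
        have h6 : y = w * exp (spiralAngle η σ ‖w‖ * I) := by
          rw [← twist_apply (continuous_spiralAngle η σ), hw, T.apply_symm_apply]
        have h7 : exp (ψ' * I) * exp ((-ψ' : ℝ) * I) = 1 := by
          rw [← exp_add, ofReal_neg, neg_mul, add_neg_cancel, exp_zero]
        rw [← h4] at h6 hwψ
        rw [h6]
        linear_combination (exp (spiralAngle η σ r * I)) * hwψ - hzr +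
          (‖z‖ * c * exp (spiralAngle η σ r * I)) * h7
      rw [dist_eq_norm, h5, norm_mul, norm_mul, norm_mul, hc, norm_exp_ofReal_mul_I,
        norm_exp_ofReal_mul_I, one_mul, one_mul, one_mul]
      refine (norm_sub_mul_exp_le (by linarith)).trans_lt ?_
      rw [abs_neg]
      have : r * |ψ'| ≤ 1 * η := by
        gcongr
        · linarith
        · linarith
      linarith
  have haU : T.symm a ∈ U := by
    have hna : ‖T.symm a‖ = ‖a‖ := norm_twist_symm _ _
    have hapos : 0 < ‖a‖ := by linarith
    have hψlt : |ψ| < θ := hψ.lt_of_ne fun h ↦ hnot _ (hsymm a ha)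
      (mem_outerSlits_of_abs_eq hN hcN h ha0 (by linarith))
    refine ⟨mem_ofPred.2 (by linarith), mem_ofPred.2 ?_⟩
    have hcc : c * (starRingEnd ℂ) c = 1 := by
      rw [mul_conj, normSq_eq_norm_sq, hc]; simp
    have h1 : T.symm a * (starRingEnd ℂ) c = ‖T.symm a‖ * exp (ψ * I) := by
      linear_combination (starRingEnd ℂ) c * ha0 + (‖T.symm a‖ * exp (ψ * I)) * hcc
    rw [h1, re_ofReal_mul, exp_ofReal_mul_I_re, ← Real.cos_abs ψ, hna]
    exact mul_lt_mul_of_pos_left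
      (Real.cos_lt_cos_of_nonneg_of_le_pi (abs_nonneg _) hθpi hψlt) hapos
  have hbU : T.symm b ∈ U := (hα.image T.symm
    T.symm.continuous.continuousOn).subset_left_of_subset_union hUo hVo hUV hsub ⟨_, mem_image_of_mem _ ha, haU⟩ (mem_image_of_mem _ hb)
  obtain ⟨ψ', hψ', hb0, -⟩ := exists_eq_mul_exp_of_cos_le hc hθ0.le hθpi hbU.2.le
  have hna : ‖T.symm a‖ = ‖a‖ := norm_twist_symm _ _
  have hnb : ‖T.symm b‖ = ‖b‖ := norm_twist_symm _ _
  have h1 : ∀ y, σ < ‖y‖ → y = T.symm y * exp (spiralAngle η σ σ * I) := fun y hy ↦ by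
    have : spiralAngle η σ ‖T.symm y‖ = spiralAngle η σ σ := by
      rw [norm_twist_symm, spiralAngle, spiralAngle, min_eq_right hy.le, min_self]
    rw [← this, ← twist_apply (continuous_spiralAngle η σ), T.apply_symm_apply]
  have h2 : a - b = c * exp (ψ * I) * exp (spiralAngle η σ σ * I) *
      (‖a‖ - ‖b‖ * exp ((ψ' - ψ : ℝ) * I)) := by
    have h3 : exp (ψ * I) * exp ((ψ' - ψ : ℝ) * I) = exp (ψ' * I) := by
      rw [← exp_add, ofReal_sub]; ring_nf
    rw [hna] at ha0
    rw [hnb] at hb0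
    linear_combination h1 a haσ - h1 b hbσ + exp (spiralAngle η σ σ * I) * ha0 -
      exp (spiralAngle η σ σ * I) * hb0 + c * exp (spiralAngle η σ σ * I) * ‖b‖ * h3
  have h4 := hlt a ha
  have h5 := hlt b hb
  rw [h2, norm_mul, norm_mul, norm_mul, hc, norm_exp_ofReal_mul_I, norm_exp_ofReal_mul_I, one_mul,
    one_mul, one_mul] at hab
  have h6 := hab.trans_le (norm_sub_mul_exp_le (norm_nonneg a))
  have h7 : |ψ' - ψ| ≤ 2 * η := (abs_sub _ _).trans (by linarith)
  have h8 : ‖a‖ * |ψ' - ψ| ≤ 1 * (2 * η) := by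
    gcongr
    linarith
  have h9 : |‖a‖ - ‖b‖| ≤ 1 - 10 * η - σ := by
    rw [abs_le]; constructor <;> linarith
  linarith

lemma subset_of_disjoint_frontier {W S : Set ℂ} (hW : IsOpen W) (hS : IsPreconnected S)
    (hf : Disjoint S (frontier W)) {x : ℂ} (hx : x ∈ S) (hxW : x ∈ W) : S ⊆ W := by
  refine hS.subset_left_of_subset_union hW isClosed_closure.isOpen_compl
    (disjoint_compl_right.mono_left subset_closure) (fun y hy ↦ ?_) ⟨x, hx, hxW⟩
  by_contra h
  rw [mem_union, not_or, notMem_compl_iff] at h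
  exact Set.disjoint_left.1 hf hy ⟨h.2, by rw [hW.interior_eq]; exact h.1⟩

lemma exists_mem_frontier_dist_le {W : Set ℂ} (hW : IsOpen W) {z c e : ℂ} {r : ℝ} (hc : c ∈ W)
    (he : e ∉ W) (hcz : dist c z ≤ r) (hez : dist e z ≤ r) : ∃ y ∈ frontier W, dist z y ≤ r := by
  by_contra! h
  refine he (subset_of_disjoint_frontier hW (convex_closedBall z r).isPreconnected ?_
    (mem_closedBall.2 hcz) hc (mem_closedBall.2 hez))
  rw [Set.disjoint_left]
  intro y hy hyW
  rw [mem_closedBall, dist_comm] at hy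
  exact hy.not_gt (h y hyW)

lemma spiralConditions_of_arms_subset {ε η : ℝ} (hη : 0 < η) (hηε : 40 * η ≤ ε) (hη1 : 40 * η ≤ 1)
    {N : ℕ} (hN : 0 < N) (hNη : Real.pi / N ≤ η) {T : ℂ ≃ₜ ℂ}
    (hT : T = twist (spiralAngle η (max (1 - ε) (4 * η))) (continuous_spiralAngle _ _))
    {W : Set ℂ} (hW : JordanDomain W) (hW1 : closure W ⊆ ball 0 1)
    (harms : T '' innerArms N (1 - 12 * η) ⊆ W)
    (hslits : Disjoint (T '' outerSlits N (2 * η) (1 - 10 * η)) (closure W)) :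
    SpiralConditions ε W := by
  have hnot : ∀ w ∈ outerSlits N (2 * η) (1 - 10 * η), T w ∉ closure W := fun w hw ↦
    Set.disjoint_left.1 hslits (mem_image_of_mem _ hw)
  have hlt : ∀ y ∈ closure W, ‖y‖ < 1 - 10 * η := fun y hy ↦ by
    by_contra! h
    refine hnot (T.symm y) (Or.inl ?_) (by rwa [T.apply_symm_apply])
    rwa [hT, norm_twist_symm]
  have hθ : 0 ≤ Real.pi / N := by positivity
  have hdense : ∀ z ∈ closedBall (0 : ℂ) 1, ∃ y ∈ frontier W, dist z y ≤ 13 * η := by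
    intro z hz
    rw [mem_closedBall_zero_iff] at hz
    obtain ⟨c, hc, hcN, hcz⟩ := exists_twist_near
      (continuous_spiralAngle η (max (1 - ε) (4 * η))) (exists_root_mul_exp hN) z
      (r := min ‖z‖ (1 - 12 * η)) (le_min (norm_nonneg z) (by linarith))
    obtain ⟨e, he, heN, hez⟩ := exists_twist_near
      (continuous_spiralAngle η (max (1 - ε) (4 * η))) (exists_neg_root_mul_exp hN) z
      (r := max ‖z‖ (2 * η)) (le_max_of_le_left (norm_nonneg z))
    rw [← hT] at hcz hez
    refine exists_mem_frontier_dist_le hW.1 (c := T c) (e := T e) (harms (mem_image_of_mem _ ?_))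
      (fun h ↦ hnot e ?_ (subset_closure h)) (hcz.trans ?_) (hez.trans ?_)
    · exact ⟨hc.trans_le (min_le_right _ _), by rw [hcN, one_mul]⟩
    · exact Or.inr ⟨(le_max_right _ _).trans he.ge, by rw [heN, neg_one_mul]⟩
    · have h1 : min ‖z‖ (1 - 12 * η) * (Real.pi / N) ≤ 1 * η := by
        gcongr
        exact (min_le_left _ _).trans hz
      have h2 : |min ‖z‖ (1 - 12 * η) - ‖z‖| ≤ 12 * η := by
        rw [abs_le]
        constructor
        · have : ‖z‖ - 12 * η ≤ min ‖z‖ (1 - 12 * η) := le_min (by linarith) (by linarith)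
          linarith
        · linarith [min_le_left ‖z‖ (1 - 12 * η)]
      linarith
    · have h1 : max ‖z‖ (2 * η) * (Real.pi / N) ≤ 1 * η := by
        gcongr
        exact max_le hz (by linarith)
      have h2 : |max ‖z‖ (2 * η) - ‖z‖| ≤ 2 * η := by
        rw [abs_le]
        constructor
        · linarith [le_max_left ‖z‖ (2 * η)]
        · have : max ‖z‖ (2 * η) ≤ ‖z‖ + 2 * η :=
            max_le (by linarith) (by linarith [norm_nonneg z])
          linarith
      linarith
  have hball : closure W ⊆ closedBall 0 1 := hW1.trans ball_subset_closedBall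
  have hηpos : 0 ≤ 13 * η := by linarith
  refine ⟨⟨?_, ?_⟩, ?_⟩
  · refine (hausdorffDist_le_of_mem_dist hηpos hdense fun y hy ↦
      ⟨y, hball (frontier_subset_closure hy), by rwa [dist_self]⟩).trans_lt (by linarith)
  · refine (hausdorffDist_le_of_mem_dist hηpos (fun y hy ↦
      ⟨y, frontier_subset_closure hy, by rwa [dist_self]⟩)
      fun y hy ↦ hdense y (hball hy)).trans_lt (by linarith)
  · intro γ hγ ha hb hab z hz
    obtain ⟨α, hα, haα, hbα, hαW, hαG⟩ := hW.exists_arc_subset_closure hγ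
    have hnear : ∀ x, infDist x (sphere (0 : ℂ) 1) < ε → 1 - ε < ‖x‖ := fun x hx ↦ by
      obtain ⟨s, hs, hxs⟩ := (infDist_lt_iff (NormedSpace.sphere_nonempty.2 zero_le_one)).1 hx
      rw [mem_sphere_zero_iff_norm] at hs
      rw [dist_comm, dist_eq_norm] at hxs
      linarith [norm_sub_norm_le s x]
    have ha1 := hnear _ ha
    have hb1 := hnear _ hb
    have ha2 := hlt _ (frontier_subset_closure (hαW haα))
    have hb2 := hlt _ (frontier_subset_closure (hαW hbα))
    have hab' := norm_sub_le (γ 0) (γ 1)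
    obtain ⟨y, hy, hyz⟩ := exists_dist_lt_of_disjoint_slits hη hηε (le_max_right (1 - ε) _)
      (le_max_left _ _) (max_le (by linarith) (by linarith)) hN hNη hα
      (hT ▸ hslits.mono_right (hαW.trans frontier_subset_closure)) haα hbα
      (max_lt ha1 (by linarith)) (max_lt hb1 (by linarith)) hab (hlt z hz)
    exact (infDist_le_dist_of_mem (hαG hy)).trans_lt (by rwa [dist_comm])

lemma JordanDomain.isCompact_frontier {W : Set ℂ} (hW : JordanDomain W) :
    IsCompact (frontier W) :=
  hW.2.2.1.isCompact_closure.of_isClosed_subset isClosed_frontier frontier_subset_closure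

lemma JordanDomain.nonempty_frontier {W : Set ℂ} (hW : JordanDomain W) :
    (frontier W).Nonempty := by
  obtain ⟨-, -, -, φ, -, -, hφ⟩ := hW
  rw [← hφ]
  exact ⟨φ ⟨1, by simp⟩, mem_range_self _⟩

lemma JordanDomain.exists_disjoint_frontier {W K : Set ℂ} (hW : JordanDomain W) (hK : IsClosed K)
    (hWK : Disjoint (frontier W) K) :
    ∃ δ : ℝ, 0 < δ ∧ ∀ W' : Set ℂ, JordanDomain W' →
      hausdorffDist (frontier W) (frontier W') < δ → Disjoint K (frontier W') := by
  obtain ⟨δ, hδ, hsub⟩ := hW.isCompact_frontier.exists_thickening_subset_open hK.isOpen_compl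
    hWK.subset_compl_right
  refine ⟨δ, hδ, fun W' hW' hd ↦ Set.disjoint_right.2 fun y hy ↦ hsub ?_⟩
  obtain ⟨x, hx, hxy⟩ := exists_dist_lt_of_hausdorffDist_lt' hy hd
    (hausdorffEDist_ne_top_of_nonempty_of_bounded hW.nonempty_frontier hW'.nonempty_frontier
      hW.isCompact_frontier.isBounded hW'.isCompact_frontier.isBounded)
  exact mem_thickening_iff.2 ⟨x, hx, by rwa [dist_comm]⟩

lemma isClosed_innerArms (N : ℕ) (R : ℝ) : IsClosed (innerArms N R) :=
  (isClosed_le (f := fun w : ℂ ↦ ‖w‖) (by fun_prop) (by fun_prop)).inter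
    (isClosed_eq (f := fun w : ℂ ↦ w ^ N) (by fun_prop) (by fun_prop))

lemma isClosed_outerSlits (N : ℕ) (ρ R : ℝ) : IsClosed (outerSlits N ρ R) :=
  (isClosed_le (g := fun w : ℂ ↦ ‖w‖) (by fun_prop) (by fun_prop)).union
    ((isClosed_le (g := fun w : ℂ ↦ ‖w‖) (by fun_prop) (by fun_prop)).inter
      (isClosed_eq (f := fun w : ℂ ↦ w ^ N) (by fun_prop) (by fun_prop)))

lemma zero_mem_innerArms {N : ℕ} {R : ℝ} (hR : 0 ≤ R) : (0 : ℂ) ∈ innerArms N R :=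
  ⟨by rwa [norm_zero], by simp⟩

lemma isPreconnected_innerArms {N : ℕ} {R : ℝ} (hR : 0 ≤ R) : IsPreconnected (innerArms N R) := by
  have : StarConvex ℝ 0 (innerArms N R) := by
    refine starConvex_zero_iff.2 fun w ⟨hw, hwN⟩ t ht ht1 ↦ ?_
    have hn : ‖t • w‖ = t * ‖w‖ := by rw [norm_smul, Real.norm_of_nonneg ht]
    refine ⟨?_, ?_⟩
    · rw [hn]
      nlinarith [norm_nonneg w]
    · rw [hn, real_smul, mul_pow, hwN, ofReal_mul, mul_pow]
  exact (this.isPathConnected (zero_mem_innerArms hR)).isConnected.isPreconnected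

lemma ofReal_mul_mem_outerSlits {N : ℕ} {ρ R t : ℝ} {w : ℂ} (hw : w ∈ outerSlits N ρ R)
    (ht : 1 ≤ t) : (t : ℂ) * w ∈ outerSlits N ρ R := by
  have hn : ‖(t : ℂ) * w‖ = t * ‖w‖ := by
    rw [norm_mul, norm_real, Real.norm_of_nonneg (by linarith)]
  have hle : ‖w‖ ≤ ‖(t : ℂ) * w‖ := by
    rw [hn]
    exact le_mul_of_one_le_left (norm_nonneg w) ht
  rcases hw with hw | ⟨hw, hwN⟩
  · exact Or.inl (hw.trans hle)
  · exact Or.inr ⟨hw.trans hle, by rw [hn, mul_pow, hwN, ofReal_mul, mul_pow, mul_neg]⟩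

/-- The twisted slits lie outside a domain in the disc as soon as they avoid its frontier, because
they extend to infinity. -/
lemma disjoint_slits_closure {N : ℕ} {ρ R : ℝ} (hρ : 0 < ρ) (hR : 0 < R) {T : ℂ ≃ₜ ℂ}
    (hT : ∀ w, ‖T w‖ = ‖w‖) {W : Set ℂ} (hW : IsOpen W) (hW1 : closure W ⊆ ball 0 1)
    (h : Disjoint (T '' outerSlits N ρ R) (frontier W)) :
    Disjoint (T '' outerSlits N ρ R) (closure W) := by
  rw [Set.disjoint_left]
  rintro _ ⟨w, hw, rfl⟩ hcl
  have hwW : T w ∈ W := by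
    by_contra hn
    exact Set.disjoint_left.1 h (mem_image_of_mem _ hw) ⟨hcl, by rwa [hW.interior_eq]⟩
  have hw0 : 0 < ‖w‖ := by
    rcases hw with hw | hw
    · exact hR.trans_le hw
    · exact hρ.trans_le hw.1
  set S : Set ℂ := (fun t : ℝ ↦ T (t * w)) '' Ici 1
  have hS : IsPreconnected S := isPreconnected_Ici.image _ (by fun_prop)
  have hSW : S ⊆ W := by
    refine subset_of_disjoint_frontier hW hS (h.mono_left ?_) ⟨1, self_mem_Ici, by simp⟩ hwW
    rintro _ ⟨t, ht, rfl⟩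
    exact mem_image_of_mem _ (ofReal_mul_mem_outerSlits hw ht)
  have hfar : T ((1 + ‖w‖⁻¹ : ℝ) * w) ∈ W :=
    hSW ⟨1 + ‖w‖⁻¹, mem_Ici.2 (by linarith [inv_pos.2 hw0]), rfl⟩
  have := hW1 (subset_closure hfar)
  rw [mem_ball_zero_iff, hT, norm_mul, norm_real, Real.norm_of_nonneg (by positivity), add_mul,
    inv_mul_cancel₀ hw0.ne'] at this
  linarith

/-- A Jordan domain containing all twisted arms and none of the twisted slits. -/
lemma exists_jordanDomain_arms_slits (N : ℕ) {η : ℝ} (hη : 0 < η) (hη1 : 40 * η ≤ 1)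
    {T : ℂ ≃ₜ ℂ} (hT : ∀ w, ‖T w‖ = ‖w‖) :
    ∃ W : Set ℂ, JordanDomain W ∧ (0 : ℂ) ∈ W ∧ closure W ⊆ ball 0 1 ∧
      T '' innerArms N (1 - 12 * η) ⊆ W ∧
      Disjoint (T '' outerSlits N (2 * η) (1 - 10 * η)) (closure W) := by
  have hle : η ≤ 1 - 11 * η := by linarith
  have hp := armProfile_mem_Icc N hle
  set H := rayScaling (armProfile N η (1 - 11 * η)) η (1 - 11 * η) hη (continuousOn_armProfile _ _ _)
    (fun z ↦ (hp z).1) (fun z ↦ (hp z).2) (armProfile_ofReal_mul _ _ _)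
  have hsymm : ∀ w, ‖(H.trans T).symm (T w)‖ = ‖w‖ / armProfile N η (1 - 11 * η) w := fun w ↦ by
    change ‖H.symm (T.symm (T w))‖ = _
    rw [T.symm_apply_apply, norm_rayScaling_symm]
  have hpos : ∀ w, 0 < armProfile N η (1 - 11 * η) w := fun w ↦ hη.trans_le (hp w).1
  have hmem : ∀ w, T w ∈ (H.trans T) '' ball 0 1 ↔ ‖w‖ < armProfile N η (1 - 11 * η) w := fun w ↦ by
    rw [Homeomorph.image_eq_preimage_symm, mem_preimage, mem_ball_zero_iff, hsymm,
      div_lt_one (hpos w)]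
  have hcl : ∀ w, T w ∈ closure ((H.trans T) '' ball 0 1) ↔
      ‖w‖ ≤ armProfile N η (1 - 11 * η) w := fun w ↦ by
    rw [← Homeomorph.image_closure, closure_ball _ one_ne_zero,
      Homeomorph.image_eq_preimage_symm, mem_preimage, mem_closedBall_zero_iff, hsymm,
      div_le_one (hpos w)]
  have hT0 : T 0 = 0 := by rw [← norm_eq_zero, hT, norm_zero]
  refine ⟨(H.trans T) '' ball 0 1, jordanDomain_image_ball _, ?_, fun y hy ↦ ?_, ?_, ?_⟩
  · have := (hmem 0).2 (by rw [norm_zero]; exact hpos 0)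
    rwa [hT0] at this
  · rw [← T.apply_symm_apply y, hcl] at hy
    rw [mem_ball_zero_iff, ← T.apply_symm_apply y, hT]
    linarith [(hp (T.symm y)).2]
  · rintro _ ⟨w, ⟨hw, hwN⟩, rfl⟩
    rw [hmem]
    rcases eq_or_ne w 0 with rfl | hw0
    · rw [norm_zero]
      exact hpos 0
    · rw [armProfile_of_pow_eq (s := 1) hw0 (by rw [hwN, ofReal_one, one_mul])]
      linarith
  · rw [Set.disjoint_left]
    rintro _ ⟨w, hw | ⟨hw, hwN⟩, rfl⟩ h
    · rw [hcl] at h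
      linarith [(hp w).2]
    · have hw0 : w ≠ 0 := norm_pos_iff.1 (by linarith)
      rw [hcl, armProfile_of_pow_eq (s := -1) hw0 (by rw [hwN]; simp)] at h
      linarith

/-- The spiral Lemma: for every `ε > 0` there is a Jordan domain `W` with `0 ∈ W`,
`W̄ ⊆ 𝔻`, satisfying conditions (i) and (ii); moreover the conditions persist for any
Jordan domain `W' ∋ 0`, `W̄' ⊆ 𝔻`, whose boundary is sufficiently close to `∂W` in
Hausdorff distance. -/
theorem spiral_domain_exists (ε : ℝ) (hε : 0 < ε) :
    ∃ W : Set ℂ, JordanDomain W ∧ (0 : ℂ) ∈ W ∧ closure W ⊆ Metric.ball 0 1 ∧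
      SpiralConditions ε W ∧
      ∃ δ : ℝ, 0 < δ ∧
        ∀ W' : Set ℂ, JordanDomain W' → (0 : ℂ) ∈ W' → closure W' ⊆ Metric.ball 0 1 →
          Metric.hausdorffDist (frontier W) (frontier W') < δ →
          SpiralConditions ε W' := by
  set η : ℝ := min ε 1 / 40 with hηdef
  have hη : 0 < η := by positivity
  have hηε : 40 * η ≤ ε := by linarith [min_le_left ε 1]
  have hη1 : 40 * η ≤ 1 := by linarith [min_le_right ε 1]
  obtain ⟨N, hNη⟩ := exists_nat_gt (Real.pi / η)
  have hN' : (0 : ℝ) < N := lt_trans (by positivity) hNη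
  have hN : 0 < N := Nat.cast_pos.1 hN'
  have hθ : Real.pi / N ≤ η := by
    rw [div_le_iff₀ hN']
    rw [div_lt_iff₀ hη] at hNη
    linarith
  obtain ⟨T, hT⟩ : ∃ T, T = twist (spiralAngle η (max (1 - ε) (4 * η)))
    (continuous_spiralAngle _ _) := ⟨_, rfl⟩
  have hTn : ∀ w, ‖T w‖ = ‖w‖ := fun w ↦ by rw [hT, norm_twist]
  obtain ⟨W, hW, hW0, hW1, harms, hslits⟩ := exists_jordanDomain_arms_slits N hη hη1 hTn
  refine ⟨W, hW, hW0, hW1,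
    spiralConditions_of_arms_subset hη hηε hη1 hN hθ hT hW hW1 harms hslits, ?_⟩
  obtain ⟨δ, hδ, hfar⟩ := hW.exists_disjoint_frontier
    ((T.isClosedMap _ (isClosed_innerArms N (1 - 12 * η))).union
      (T.isClosedMap _ (isClosed_outerSlits N (2 * η) (1 - 10 * η))))
    (disjoint_union_right.2 ⟨(disjoint_frontier_iff_isOpen.2 hW.1).mono_right harms,
      (hslits.mono_right frontier_subset_closure).symm⟩)
  refine ⟨δ, hδ, fun W' hW' hW0' hW1' hd ↦ ?_⟩
  obtain ⟨hf1, hf2⟩ := disjoint_union_left.1 (hfar W' hW' hd)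
  have hR : 0 ≤ 1 - 12 * η := by linarith
  have hT0 : T 0 = 0 := by rw [← norm_eq_zero, hTn, norm_zero]
  exact spiralConditions_of_arms_subset hη hηε hη1 hN hθ hT hW' hW1'
    (subset_of_disjoint_frontier hW'.1
      ((isPreconnected_innerArms hR).image T T.continuous.continuousOn) hf1
      ⟨0, zero_mem_innerArms hR, hT0⟩ hW0')
    (disjoint_slits_closure (by linarith) (by linarith) hTn hW'.1 hW1' hf2)
end
end

section
/- Let 0 < R < 1, let ε > 0, and let a, b be distinct points of the circle {z : |z| = R}. Then there exists an injective continuous map γ : [0,1] → ℂ with γ(0) = a, γ(1) = b, 0 < |γ(t)| < R for all t ∈ (0,1), such that every point of the closed disk {z : |z| ≤ R} lies within distance ε of γ([0,1]), and such that for (at least) one of the two closed circular arcs J of {z : |z| = R} joining a to b, the point 0 lies in the unbounded connected component of ℂ ∖ (γ([0,1]) ∪ J). -/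
open Complex Metric Set Filter

noncomputable section

/-- The point of the rectangle `[-1, 1] × [0, 1]` at relative distance `s` along the segment from
the origin to the boundary in the direction `(τ, 1 - |τ|)`. -/
def rectPoint (τ s : ℝ) : ℝ × ℝ :=
  (s * τ / max |τ| (1 - |τ|), s * (1 - |τ|) / max |τ| (1 - |τ|))

lemma rectScale_pos (τ : ℝ) : 0 < max |τ| (1 - |τ|) := by
  rcases le_or_gt |τ| (1 / 2) with h | h
  · exact lt_max_of_lt_right (by linarith)
  · exact lt_max_of_lt_left (by linarith)

lemma abs_rectPoint_fst_lt {τ s : ℝ} (hs : s ∈ Ioo (0 : ℝ) 1) : |(rectPoint τ s).1| < 1 := by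
  have hm := rectScale_pos τ
  have h := le_max_left |τ| (1 - |τ|)
  rw [rectPoint, abs_div, abs_mul, abs_of_pos hm, abs_of_pos hs.1, div_lt_one hm]
  nlinarith [hs.1, hs.2, abs_nonneg τ]

lemma rectPoint_snd_lt {τ s : ℝ} (hs : s ∈ Ioo (0 : ℝ) 1) : (rectPoint τ s).2 < 1 := by
  have hm := rectScale_pos τ
  have h := le_max_right |τ| (1 - |τ|)
  rw [rectPoint, div_lt_one hm]
  nlinarith [hs.1, hs.2]

lemma rectPoint_snd_pos {τ s : ℝ} (hs : s ∈ Ioo (0 : ℝ) 1) (hτ : |τ| < 1) :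
    0 < (rectPoint τ s).2 :=
  div_pos (mul_pos hs.1 (by linarith)) (rectScale_pos τ)

lemma eq_of_rectPoint_eq {τ τ' s s' : ℝ} (hs : 0 < s) (hs' : 0 < s')
    (h : rectPoint τ s = rectPoint τ' s') : τ = τ' := by
  have hm := rectScale_pos τ
  have hm' := rectScale_pos τ'
  simp only [rectPoint, Prod.mk.injEq] at h
  generalize max |τ| (1 - |τ|) = m at *
  generalize max |τ'| (1 - |τ'|) = m' at *
  obtain ⟨h1, h2⟩ := h
  have hk : 0 < s / m := div_pos hs hm
  have hk' : 0 < s' / m' := div_pos hs' hm'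
  rw [mul_div_right_comm, mul_div_right_comm s'] at h1 h2
  generalize s / m = k at *
  generalize s' / m' = k' at *
  have h3 := congrArg abs h1
  rw [abs_mul, abs_mul, abs_of_pos hk, abs_of_pos hk'] at h3
  have : k = k' := by linarith
  subst this
  exact mul_left_cancel₀ hk.ne' h1

lemma exists_rectPoint_eq {x y : ℝ} (hx : |x| ≤ 1) (hy : y ∈ Icc (0 : ℝ) 1) :
    ∃ τ ∈ Icc (-1 : ℝ) 1, ∃ s ∈ Icc (0 : ℝ) 1, rectPoint τ s = (x, y) := by
  rcases (add_nonneg (abs_nonneg x) hy.1).eq_or_lt with h | h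
  · have hx0 : x = 0 := abs_eq_zero.1 (by linarith [abs_nonneg x, hy.1])
    have hy0 : y = 0 := by linarith [abs_nonneg x, hy.1]
    exact ⟨0, by simp, 0, by simp, by simp [rectPoint, hx0, hy0]⟩
  · have hτ : |x / (|x| + y)| = |x| / (|x| + y) := by rw [abs_div, abs_of_pos h]
    have hτ1 : 1 - |x| / (|x| + y) = y / (|x| + y) := by field_simp; ring
    refine ⟨x / (|x| + y), ?_, max |x| y, ⟨le_max_of_le_right hy.1, max_le hx hy.2⟩, ?_⟩
    · rw [mem_Icc, ← abs_le, hτ, div_le_one h]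
      linarith [hy.1]
    · have hmax : 0 < max |x| y := by
        by_contra! hc
        linarith [le_max_left |x| y, le_max_right |x| y]
      rw [rectPoint, hτ, hτ1, max_div_div_right h.le]
      ext
      · field_simp
      · field_simp

lemma continuous_rectPoint : Continuous fun p : ℝ × ℝ => rectPoint p.1 p.2 := by
  unfold rectPoint
  exact .prodMk (.div (by fun_prop) (by fun_prop) fun p => (rectScale_pos p.1).ne')
    (.div (by fun_prop) (by fun_prop) fun p => (rectScale_pos p.1).ne')

/-- The increasing Möbius bijection of `[-1, 1]` onto `[0, 1]` which sends `0` to `κ`. -/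
def intervalMoebius (κ v : ℝ) : ℝ := κ * (1 + v) / ((1 - κ) * (1 - v) + κ * (1 + v))

lemma intervalMoebius_denom_pos {κ v : ℝ} (hκ : κ ∈ Ioo (0 : ℝ) 1) (hv : v ∈ Icc (-1 : ℝ) 1) :
    0 < (1 - κ) * (1 - v) + κ * (1 + v) := by
  rcases hv.1.eq_or_lt with h | h
  · subst h
    linarith [hκ.2]
  · have h1 : 0 < κ * (1 + v) := mul_pos hκ.1 (by linarith)
    have h2 : 0 ≤ (1 - κ) * (1 - v) :=
      mul_nonneg (by linarith [hκ.2]) (by linarith [hv.2])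
    linarith

lemma intervalMoebius_mem_Ioo {κ v : ℝ} (hκ : κ ∈ Ioo (0 : ℝ) 1) (hv : v ∈ Ioo (-1 : ℝ) 1) :
    intervalMoebius κ v ∈ Ioo (0 : ℝ) 1 := by
  have hd := intervalMoebius_denom_pos hκ (Ioo_subset_Icc_self hv)
  refine ⟨div_pos (mul_pos hκ.1 (by linarith [hv.1])) hd, (div_lt_one hd).2 ?_⟩
  linarith [mul_pos (sub_pos.2 hκ.2) (sub_pos.2 hv.2)]

lemma continuousOn_intervalMoebius {κ : ℝ} (hκ : κ ∈ Ioo (0 : ℝ) 1) :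
    ContinuousOn (intervalMoebius κ) (Icc (-1) 1) :=
  .div (by fun_prop) (by fun_prop) fun _ hv => (intervalMoebius_denom_pos hκ hv).ne'

lemma exists_intervalMoebius_eq {κ s : ℝ} (hκ : κ ∈ Ioo (0 : ℝ) 1) (hs : s ∈ Icc (0 : ℝ) 1) :
    ∃ v ∈ Icc (-1 : ℝ) 1, intervalMoebius κ v = s := by
  have h := intermediate_value_Icc (by norm_num : (-1 : ℝ) ≤ 1) (continuousOn_intervalMoebius hκ)
  have h0 : intervalMoebius κ (-1) = 0 := by simp [intervalMoebius]
  have h1 : intervalMoebius κ 1 = 1 := by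
    have := hκ.1.ne'
    simp only [intervalMoebius]
    field_simp
    ring
  rw [h0, h1] at h
  exact h hs

lemma intervalMoebius_zero (κ : ℝ) : intervalMoebius κ 0 = κ := by simp [intervalMoebius]

/-- Polar coordinates on the disk of radius `R`, slit in the direction `-c`. -/
def slitPolar (c : ℂ) (R : ℝ) (p : ℝ × ℝ) : ℂ :=
  c * ((R * (1 - p.2) : ℝ) * exp ((Real.pi * p.1 : ℝ) * I))

lemma continuous_slitPolar (c : ℂ) (R : ℝ) : Continuous (slitPolar c R) := by
  unfold slitPolar
  fun_prop

lemma norm_slitPolar {c : ℂ} (hc : ‖c‖ = 1) (R : ℝ) (p : ℝ × ℝ) :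
    ‖slitPolar c R p‖ = |R * (1 - p.2)| := by
  rw [slitPolar, norm_mul, norm_mul, hc, norm_exp_ofReal_mul_I, norm_real, Real.norm_eq_abs]
  ring

lemma pi_mul_mem_Ioo {x : ℝ} (hx : |x| < 1) : Real.pi * x ∈ Ioo (-Real.pi) Real.pi := by
  rw [abs_lt] at hx
  constructor <;> nlinarith [Real.pi_pos]

lemma slitPolar_injOn {c : ℂ} (hc : ‖c‖ = 1) {R : ℝ} (hR : 0 < R) :
    InjOn (slitPolar c R) {p | |p.1| < 1 ∧ p.2 < 1} := by
  rintro ⟨x, y⟩ ⟨hx, hy⟩ ⟨x', y'⟩ ⟨hx', hy'⟩ h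
  simp only at hx hy hx' hy'
  have hc0 : c ≠ 0 := norm_ne_zero_iff.1 (by simp [hc])
  have hr : 0 < R * (1 - y) := mul_pos hR (by linarith)
  have hr' : 0 < R * (1 - y') := mul_pos hR (by linarith)
  have hn := congrArg norm h
  rw [norm_slitPolar hc, norm_slitPolar hc, abs_of_pos hr, abs_of_pos hr'] at hn
  have hy : y = y' := by linarith [mul_left_cancel₀ hR.ne' hn]
  subst hy
  have he := mul_left_cancel₀ (ofReal_ne_zero.2 hr.ne') (mul_left_cancel₀ hc0 h)
  have ha := congrArg arg he
  have h1 := pi_mul_mem_Ioo hx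
  have h2 := pi_mul_mem_Ioo hx'
  rw [arg_exp_mul_I, arg_exp_mul_I,
    (toIocMod_eq_self _).2 ⟨h1.1, by linarith [h1.2]⟩,
    (toIocMod_eq_self _).2 ⟨h2.1, by linarith [h2.2]⟩] at ha
  rw [mul_left_cancel₀ Real.pi_ne_zero ha]

lemma exists_slitPolar_eq {c : ℂ} (hc : ‖c‖ = 1) {R : ℝ} (hR : 0 < R) {z : ℂ} (hz : ‖z‖ ≤ R) :
    ∃ x y : ℝ, |x| ≤ 1 ∧ y ∈ Icc (0 : ℝ) 1 ∧ slitPolar c R (x, y) = z := by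
  have hc0 : c ≠ 0 := norm_ne_zero_iff.1 (by simp [hc])
  refine ⟨arg (z / c) / Real.pi, 1 - ‖z‖ / R, ?_, ⟨?_, ?_⟩, ?_⟩
  · rw [abs_div, abs_of_pos Real.pi_pos, div_le_one Real.pi_pos]
    exact abs_arg_le_pi _
  · linarith [(div_le_one hR).2 hz]
  · linarith [div_nonneg (norm_nonneg z) hR.le]
  · have h1 : R * (1 - (1 - ‖z‖ / R)) = ‖z / c‖ := by
      rw [norm_div, hc]
      field_simp
      ring
    have h2 : Real.pi * (arg (z / c) / Real.pi) = arg (z / c) := by field_simp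
    rw [slitPolar, h1, h2, norm_mul_exp_arg_mul_I, mul_div_cancel₀ _ hc0]

lemma slitPolar_notMem_ray {c : ℂ} (hc : ‖c‖ = 1) {R : ℝ} (hR : 0 < R) {p : ℝ × ℝ}
    (h1 : |p.1| < 1) (h2 : p.2 < 1) : slitPolar c R p ∉ (fun s : ℝ => c * (-s : ℝ)) '' Ici 0 := by
  rintro ⟨s, hs, h⟩
  have hc0 : c ≠ 0 := norm_ne_zero_iff.1 (by simp [hc])
  have h := mul_left_cancel₀ hc0 h
  have hr : 0 < R * (1 - p.2) := mul_pos hR (by linarith)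
  have hp := pi_mul_mem_Ioo h1
  have hmem : ((R * (1 - p.2) : ℝ) * exp ((Real.pi * p.1 : ℝ) * I) : ℂ) ∈ slitPlane := by
    rw [mem_slitPlane_iff_arg, exp_mul_I, arg_mul_cos_add_sin_mul_I hr ⟨hp.1, hp.2.le⟩]
    refine ⟨hp.2.ne, mul_ne_zero (ofReal_ne_zero.2 hr.ne') ?_⟩
    rw [← exp_mul_I]
    exact exp_ne_zero _
  rw [← h, ofReal_mem_slitPlane] at hmem
  linarith [mem_Ici.1 hs]

lemma not_isBounded_connectedComponentIn_of_ray {c : ℂ} (hc : ‖c‖ = 1) {K : Set ℂ}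
    (hK : Disjoint ((fun s : ℝ => c * (-s : ℝ)) '' Ici 0) K) :
    ¬ Bornology.IsBounded (connectedComponentIn Kᶜ 0) := by
  intro hb
  have hpre : IsPreconnected ((fun s : ℝ => c * (-s : ℝ)) '' Ici 0) :=
    isPreconnected_Ici.image _ (by fun_prop)
  have hsub := hpre.subset_connectedComponentIn (x := 0) ⟨0, by simp, by simp⟩
    hK.subset_compl_right
  obtain ⟨M, hM⟩ := (hb.subset hsub).exists_norm_le
  have h := hM _ ⟨|M| + 1, mem_Ici.2 (by positivity), rfl⟩
  rw [norm_mul, hc, one_mul, norm_real, norm_neg, Real.norm_eq_abs,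
    abs_of_pos (by positivity)] at h
  linarith [le_abs_self M]

/-- Distinct points of a circle are symmetric about some direction `c`. -/
lemma exists_symmetric_direction {R : ℝ} (hR : 0 < R) {a b : ℂ} (ha : ‖a‖ = R) (hb : ‖b‖ = R)
    (hab : a ≠ b) :
    ∃ c : ℂ, ‖c‖ = 1 ∧ ∃ κ ∈ Ioo (0 : ℝ) 1,
      slitPolar c R (-κ, 0) = a ∧ slitPolar c R (κ, 0) = b := by
  have ha0 : a ≠ 0 := norm_ne_zero_iff.1 (by linarith)
  have hRC : (R : ℂ) ≠ 0 := ofReal_ne_zero.2 hR.ne'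
  obtain ⟨κ, hκ, hκb⟩ : ∃ κ ∈ Ioo (0 : ℝ) 1, exp ((2 * Real.pi * κ : ℝ) * I) = b / a := by
    have hexp : exp (arg (b / a) * I) = b / a := by
      have h := norm_mul_exp_arg_mul_I (b / a)
      rwa [norm_div, ha, hb, div_self hR.ne', ofReal_one, one_mul] at h
    have h0 : arg (b / a) ≠ 0 := by
      intro h
      rw [h, ofReal_zero, zero_mul, exp_zero, eq_div_iff ha0, one_mul] at hexp
      exact hab hexp
    have h1 := neg_pi_lt_arg (b / a)
    have h2 := arg_le_pi (b / a)
    have hpi := Real.pi_pos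
    rcases h0.lt_or_gt with h | h
    · refine ⟨arg (b / a) / (2 * Real.pi) + 1, ⟨?_, ?_⟩, ?_⟩
      · have : -1 < arg (b / a) / (2 * Real.pi) := by
          rw [lt_div_iff₀ (by positivity)]
          linarith
        linarith
      · linarith [div_neg_of_neg_of_pos h (by positivity : 0 < 2 * Real.pi)]
      · have : 2 * Real.pi * (arg (b / a) / (2 * Real.pi) + 1) = arg (b / a) + 2 * Real.pi := by
          field_simp
        rw [this]
        push_cast
        rw [add_mul, exp_add, exp_two_pi_mul_I, mul_one, hexp]
    · refine ⟨arg (b / a) / (2 * Real.pi), ⟨by positivity, ?_⟩, ?_⟩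
      · rw [div_lt_one (by positivity)]
        linarith
      · rw [mul_div_cancel₀ _ (by positivity), hexp]
  refine ⟨a / R * exp ((Real.pi * κ : ℝ) * I), ?_, κ, hκ, ?_, ?_⟩
  · rw [norm_mul, norm_exp_ofReal_mul_I, norm_div, ha, norm_real, Real.norm_eq_abs,
      abs_of_pos hR, div_self hR.ne', one_mul]
  · have : exp ((Real.pi * κ : ℝ) * I) * exp ((Real.pi * -κ : ℝ) * I) = 1 := by
      rw [← exp_add, ← exp_zero]
      congr 1
      push_cast
      ring
    calc _ = a / R * R * (exp ((Real.pi * κ : ℝ) * I) * exp ((Real.pi * -κ : ℝ) * I)) := by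
          simp only [slitPolar, sub_zero, mul_one]
          ring
      _ = a := by rw [this, mul_one, div_mul_cancel₀ _ hRC]
  · have : exp ((Real.pi * κ : ℝ) * I) * exp ((Real.pi * κ : ℝ) * I) = b / a := by
      rw [← exp_add, ← hκb]
      congr 1
      push_cast
      ring
    calc _ = a / R * R * (exp ((Real.pi * κ : ℝ) * I) * exp ((Real.pi * κ : ℝ) * I)) := by
          simp only [slitPolar, sub_zero, mul_one]
          ring
      _ = b := by rw [this, div_mul_cancel₀ _ hRC, mul_div_cancel₀ _ ha0]

lemma exists_sin_eq_near {n : ℕ} (hn : 0 < n) {t v : ℝ} (ht : t ∈ Icc (0 : ℝ) 1)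
    (hv : v ∈ Icc (-1 : ℝ) 1) :
    ∃ t' ∈ Icc (0 : ℝ) 1, |t' - t| ≤ 1 / n ∧ Real.sin (2 * Real.pi * n * t') = v := by
  have hn' : (0 : ℝ) < n := Nat.cast_pos.2 hn
  obtain ⟨k, hkn, hk1, hk2⟩ : ∃ k : ℕ, k + 1 ≤ n ∧ (k : ℝ) ≤ n * t ∧ n * t ≤ k + 1 := by
    rcases ht.2.eq_or_lt with h | h
    · refine ⟨n - 1, by omega, ?_⟩
      have : ((n - 1 : ℕ) : ℝ) = n - 1 := by push_cast [hn]; ring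
      constructor <;> rw [h, this] <;> linarith
    · have h0 : 0 ≤ n * t := mul_nonneg hn'.le ht.1
      exact ⟨⌊n * t⌋₊, (Nat.floor_lt h0).2 (by nlinarith), Nat.floor_le h0,
        (Nat.lt_floor_add_one _).le⟩
  have hkn' : (k : ℝ) + 1 ≤ n := by exact_mod_cast hkn
  obtain ⟨w, hw0, hw1, hw⟩ : ∃ w : ℝ, 0 ≤ w ∧ w ≤ 1 ∧ Real.sin (2 * Real.pi * w) = v := by
    have h1 := Real.neg_pi_div_two_le_arcsin v
    have h2 := Real.arcsin_le_pi_div_two v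
    have hpi := Real.pi_pos
    refine ⟨(Real.pi - Real.arcsin v) / (2 * Real.pi), div_nonneg (by linarith) (by linarith),
      (div_le_one (by positivity)).2 (by linarith), ?_⟩
    rw [mul_div_cancel₀ _ (by positivity), Real.sin_pi_sub, Real.sin_arcsin hv.1 hv.2]
  refine ⟨(k + w) / n, ⟨by positivity, (div_le_one hn').2 (by linarith)⟩, ?_, ?_⟩
  · have : (k + w) / n - t = (k + w - n * t) / n := by field_simp
    rw [this, abs_div, abs_of_pos hn']
    gcongr
    rw [abs_le]
    constructor <;> linarith
  · have : 2 * Real.pi * n * ((k + w) / n) = 2 * Real.pi * w + k * (2 * Real.pi) := by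
      field_simp
      ring
    rw [this, Real.sin_add_nat_mul_two_pi, hw]

/-- Sampling a continuous function on `[0, 1] × [-1, 1]` along a rapidly oscillating graph which
stays away from the horizontal sides approximates all of its values. -/
lemma exists_oscillation_approx {f : ℝ × ℝ → ℂ}
    (hf : ContinuousOn f (Icc (0 : ℝ) 1 ×ˢ Icc (-1 : ℝ) 1)) {ε : ℝ} (hε : 0 < ε) :
    ∃ n : ℕ, ∃ l ∈ Ioo (0 : ℝ) 1, ∀ p ∈ Icc (0 : ℝ) 1 ×ˢ Icc (-1 : ℝ) 1, ∃ t ∈ Icc (0 : ℝ) 1,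
      dist (f p) (f (t, l * Real.sin (2 * Real.pi * n * t))) < ε := by
  obtain ⟨δ, hδ, h⟩ := Metric.uniformContinuousOn_iff.1
    ((isCompact_Icc.prod isCompact_Icc).uniformContinuousOn_of_continuous hf) ε hε
  obtain ⟨n, hn⟩ := exists_nat_one_div_lt hδ
  have hη : 0 < min (1 / 2) (δ / 2) := by positivity
  have hη1 : min (1 / 2) (δ / 2) ≤ 1 / 2 := min_le_left _ _
  have hη2 : min (1 / 2) (δ / 2) ≤ δ / 2 := min_le_right _ _
  generalize min (1 / 2) (δ / 2) = η at *
  refine ⟨n + 1, 1 - η, ⟨by linarith, by linarith⟩, ?_⟩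
  rintro ⟨t, v⟩ ⟨ht, hv⟩
  simp only at ht hv
  obtain ⟨t', ht', htt', hs⟩ := exists_sin_eq_near n.succ_pos ht hv
  refine ⟨t', ht', ?_⟩
  rw [Nat.succ_eq_add_one] at hs htt'
  rw [hs]
  have hvη : |η * v| ≤ η := by
    rw [abs_mul, abs_of_pos hη]
    exact mul_le_of_le_one_right hη.le (abs_le.2 hv)
  refine h _ ⟨ht, hv⟩ _ ⟨ht', ?_⟩ ?_
  · have := hv.1
    have := hv.2
    constructor <;> nlinarith
  · rw [Prod.dist_eq, max_lt_iff, Real.dist_eq, Real.dist_eq]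
    constructor
    · rw [abs_sub_comm]
      refine htt'.trans_lt ?_
      push_cast
      exact hn
    · have : v - (1 - η) * v = η * v := by ring
      simp only [this]
      linarith

/-- The spiral arc construction: given `0 < R < 1`, `ε > 0` and distinct points `a, b`
on the circle of radius `R`, there is an injective arc `γ` from `a` to `b` whose
interior lies in the punctured open disk `{0 < |z| < R}`, which is `ε`-dense in the
closed disk of radius `R`, and such that for (at least) one of the two closed circular
arcs `J` of the circle `{|z| = R}` joining `a` to `b` (realized as the image of an
injective continuous path `σ` in the circle from `a` to `b`), the point `0` lies in the
unbounded connected component of `ℂ ∖ (γ([0,1]) ∪ J)`. -/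
theorem spiral_arc_exists (R ε : ℝ) (hR0 : 0 < R) (hR1 : R < 1) (hε : 0 < ε)
    (a b : ℂ) (ha : a ∈ Metric.sphere (0 : ℂ) R) (hb : b ∈ Metric.sphere (0 : ℂ) R)
    (hab : a ≠ b) :
    ∃ γ : ℝ → ℂ,
      ContinuousOn γ (Set.Icc 0 1) ∧ Set.InjOn γ (Set.Icc 0 1) ∧
      γ 0 = a ∧ γ 1 = b ∧
      (∀ t ∈ Set.Ioo (0 : ℝ) 1, 0 < ‖γ t‖ ∧ ‖γ t‖ < R) ∧
      (∀ z ∈ Metric.closedBall (0 : ℂ) R,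
        Metric.infDist z (γ '' Set.Icc 0 1) ≤ ε) ∧
      ∃ σ : ℝ → ℂ,
        ContinuousOn σ (Set.Icc 0 1) ∧ Set.InjOn σ (Set.Icc 0 1) ∧
        σ 0 = a ∧ σ 1 = b ∧
        σ '' Set.Icc 0 1 ⊆ Metric.sphere (0 : ℂ) R ∧
        ¬ Bornology.IsBounded
          (connectedComponentIn (γ '' Set.Icc 0 1 ∪ σ '' Set.Icc 0 1)ᶜ 0) := by
  rw [mem_sphere_zero_iff_norm] at ha hb
  obtain ⟨c, hc, κ, hκ, hκa, hκb⟩ := exists_symmetric_direction hR0 ha hb hab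
  set f : ℝ × ℝ → ℂ :=
    fun p => slitPolar c R (rectPoint (2 * p.1 - 1) (intervalMoebius κ p.2)) with hf
  have hfc : ContinuousOn f (Icc (0 : ℝ) 1 ×ˢ Icc (-1 : ℝ) 1) := by
    refine (continuous_slitPolar c R).comp_continuousOn
      (continuous_rectPoint.comp_continuousOn (.prodMk (by fun_prop) ?_))
    exact (continuousOn_intervalMoebius hκ).comp continuousOn_snd fun p hp => hp.2
  obtain ⟨n, l, hl, hfε⟩ := exists_oscillation_approx hfc hε
  have hv (t : ℝ) : l * Real.sin (2 * Real.pi * n * t) ∈ Ioo (-1 : ℝ) 1 := by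
    rw [mem_Ioo, ← abs_lt, abs_mul, abs_of_pos hl.1]
    nlinarith [hl.1, hl.2, Real.abs_sin_le_one (2 * Real.pi * n * t)]
  have hs (t : ℝ) := intervalMoebius_mem_Ioo hκ (hv t)
  have hτ {t : ℝ} (ht : t ∈ Icc (0 : ℝ) 1) : |2 * t - 1| ≤ 1 := by
    rw [abs_le]
    constructor <;> linarith [ht.1, ht.2]
  have hκ1 {t : ℝ} (ht : t ∈ Icc (0 : ℝ) 1) : |κ * (2 * t - 1)| < 1 := by
    rw [abs_mul, abs_of_pos hκ.1]
    nlinarith [hκ.1, hκ.2, hτ ht, abs_nonneg (2 * t - 1)]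
  refine ⟨fun t => f (t, l * Real.sin (2 * Real.pi * n * t)), ?_, ?_, ?_, ?_, ?_, ?_,
    fun t => slitPolar c R (κ * (2 * t - 1), 0), ?_, ?_, ?_, ?_, ?_, ?_⟩
  · exact hfc.comp (by fun_prop) fun t ht => ⟨ht, Ioo_subset_Icc_self (hv t)⟩
  · intro t ht t' ht' h
    have := eq_of_rectPoint_eq (hs t).1 (hs t').1 <|
      slitPolar_injOn hc hR0 ⟨abs_rectPoint_fst_lt (hs t), rectPoint_snd_lt (hs t)⟩
        ⟨abs_rectPoint_fst_lt (hs t'), rectPoint_snd_lt (hs t')⟩ h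
    linarith
  · simp [hf, intervalMoebius_zero, rectPoint, hκa]
  · have : Real.sin (2 * Real.pi * n) = 0 := by
      simpa [mul_comm] using Real.sin_add_nat_mul_two_pi 0 n
    have h2 : (2 : ℝ) - 1 = 1 := by norm_num
    simp [hf, intervalMoebius_zero, rectPoint, hκb, this, h2]
  · intro t ht
    have h1 := rectPoint_snd_lt (τ := 2 * t - 1) (hs t)
    have h2 := rectPoint_snd_pos (τ := 2 * t - 1) (hs t)
      (abs_lt.2 ⟨by linarith [ht.1], by linarith [ht.2]⟩)
    simp only [hf]
    rw [norm_slitPolar hc, abs_of_pos (mul_pos hR0 (by linarith))]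
    constructor <;> nlinarith
  · intro z hz
    obtain ⟨x, y, hx, hy, rfl⟩ := exists_slitPolar_eq hc hR0 (mem_closedBall_zero_iff.1 hz)
    obtain ⟨τ, hτ, s, hs, hxy⟩ := exists_rectPoint_eq hx hy
    obtain ⟨v, hv, rfl⟩ := exists_intervalMoebius_eq hκ hs
    obtain ⟨t, ht, hd⟩ := hfε ((τ + 1) / 2, v)
      ⟨⟨by linarith [hτ.1], by linarith [hτ.2]⟩, hv⟩
    have hfz : f ((τ + 1) / 2, v) = slitPolar c R (x, y) := by
      have : 2 * ((τ + 1) / 2) - 1 = τ := by ring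
      simp only [hf, this, hxy]
    rw [hfz] at hd
    exact (infDist_le_dist_of_mem (mem_image_of_mem _ ht)).trans hd.le
  · exact ((continuous_slitPolar c R).comp (by fun_prop)).continuousOn
  · intro t ht t' ht' h
    have h := congrArg Prod.fst <|
      slitPolar_injOn hc hR0 ⟨hκ1 ht, zero_lt_one⟩ ⟨hκ1 ht', zero_lt_one⟩ h
    linarith [mul_left_cancel₀ hκ.1.ne' h]
  · simp [hκa]
  · have h2 : (2 : ℝ) - 1 = 1 := by norm_num
    simp [hκb, h2]
  · rintro _ ⟨t, -, rfl⟩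
    rw [mem_sphere_zero_iff_norm, norm_slitPolar hc]
    simp [abs_of_pos hR0]
  · refine not_isBounded_connectedComponentIn_of_ray hc (disjoint_right.2 ?_)
    rintro _ (⟨t, ht, rfl⟩ | ⟨t, ht, rfl⟩)
    · exact slitPolar_notMem_ray hc hR0 (abs_rectPoint_fst_lt (hs t)) (rectPoint_snd_lt (hs t))
    · exact slitPolar_notMem_ray hc hR0 (hκ1 ht) zero_lt_one
end
end

section
/- Let D ⊆ ℂ be a Jordan domain containing the origin, let Λ = E⁻¹(D), and let h : Λ → ℂ ∖ {0} be a holomorphic nowhere-vanishing function with h(z + 1) = h(z) for all z ∈ Λ and h(z) → 1 as Im z → +∞. Then there exists a holomorphic function g on D with g(0) = 0 such that h(z) = exp(g(E(z))) for all z ∈ Λ. -/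
open Complex Metric Set Filter

noncomputable section

/-- The universal covering `E(z) = e^{2πiz}` of `ℂ*`. -/
def E (z : ℂ) : ℂ := Complex.exp (2 * Real.pi * Complex.I * z)

open Topology MeasureTheory

/-- The integral of `g` along the segment from `a` to `b`. -/
def segInt (g : ℂ → ℂ) (a b : ℂ) : ℂ :=
  ∫ t in (0 : ℝ)..1, g (a + t • (b - a)) * (b - a)

lemma add_smul_sub_mem_segment {a b : ℂ} {t : ℝ} (ht : t ∈ uIcc (0 : ℝ) 1) :
    a + t • (b - a) ∈ segment ℝ a b := by
  rw [uIcc_of_le zero_le_one] at ht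
  rw [segment_eq_image']
  exact ⟨t, ht, rfl⟩

lemma continuousOn_segInt_integrand {g : ℂ → ℂ} {a b : ℂ} (hg : ContinuousOn g (segment ℝ a b)) :
    ContinuousOn (fun t : ℝ => g (a + t • (b - a)) * (b - a)) (uIcc 0 1) :=
  (hg.comp (Continuous.continuousOn (by fun_prop))
    fun _ ht => add_smul_sub_mem_segment ht).mul continuousOn_const

lemma segInt_congr {g₁ g₂ : ℂ → ℂ} {a b : ℂ} (h : EqOn g₁ g₂ (segment ℝ a b)) :
    segInt g₁ a b = segInt g₂ a b :=
  intervalIntegral.integral_congr fun t ht => by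
    simp only [h (add_smul_sub_mem_segment ht)]

lemma segInt_sub_mul {g₁ g₂ : ℂ → ℂ} {a b : ℂ} (h₁ : ContinuousOn g₁ (segment ℝ a b))
    (h₂ : ContinuousOn g₂ (segment ℝ a b)) (c : ℂ) :
    segInt (fun w => g₁ w - c * g₂ w) a b = segInt g₁ a b - c * segInt g₂ a b := by
  rw [segInt, segInt, segInt, ← intervalIntegral.integral_const_mul,
    ← intervalIntegral.integral_sub]
  · refine intervalIntegral.integral_congr fun t _ => ?_
    ring
  · exact (continuousOn_segInt_integrand h₁).intervalIntegrable
  · exact ((continuousOn_segInt_integrand h₂).intervalIntegrable).const_mul c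

lemma segInt_eq_sub {F g : ℂ → ℂ} {a b : ℂ} (hF : ∀ z ∈ segment ℝ a b, HasDerivAt F (g z) z)
    (hg : ContinuousOn g (segment ℝ a b)) : segInt g a b = F b - F a := by
  have h := intervalIntegral.integral_eq_sub_of_hasDerivAt (a := 0) (b := 1)
    (f := fun t : ℝ => F (a + t • (b - a)))
    (f' := fun t : ℝ => g (a + t • (b - a)) * (b - a)) (fun t ht => ?_)
    (continuousOn_segInt_integrand hg).intervalIntegrable
  · simpa [segInt] using h
  · have h₁ : HasDerivAt (fun t : ℝ => a + t • (b - a)) (b - a) t := by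
      simpa using ((hasDerivAt_id t).smul_const (b - a)).const_add a
    exact (hF _ (add_smul_sub_mem_segment ht)).comp t h₁

lemma norm_segInt_le {g : ℂ → ℂ} {a b : ℂ} {C : ℝ} (h : ∀ z ∈ segment ℝ a b, ‖g z‖ ≤ C) :
    ‖segInt g a b‖ ≤ C * ‖b - a‖ := by
  have := intervalIntegral.norm_integral_le_of_norm_le_const (a := (0 : ℝ)) (b := 1)
    (f := fun t : ℝ => g (a + t • (b - a)) * (b - a)) (C := C * ‖b - a‖) fun t ht => by
      rw [norm_mul]
      gcongr
      exact h _ (add_smul_sub_mem_segment (uIoc_subset_uIcc ht))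
  simpa [segInt] using this

lemma hasDerivAt_integral_of_continuousOn {U : Set ℂ} (hU : IsOpen U) {F : ℂ → ℝ → ℂ} {a b : ℝ}
    (hF : ContinuousOn (Function.uncurry F) (U ×ˢ uIcc a b))
    (hd : ∀ t ∈ uIcc a b, DifferentiableOn ℂ (fun z => F z t) U) {z₀ : ℂ} (hz₀ : z₀ ∈ U) :
    HasDerivAt (fun z => ∫ t in a..b, F z t) (∫ t in a..b, deriv (fun z => F z t) z₀) z₀ := by
  obtain ⟨r, hr, hrU⟩ := Metric.nhds_basis_closedBall.mem_iff.1 (hU.mem_nhds hz₀)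
  have hcont : ∀ z ∈ U, ContinuousOn (F z) (uIcc a b) := fun z hz =>
    hF.comp (f := fun t => (z, t)) (by fun_prop) fun t ht => ⟨hz, ht⟩
  have hmeas : ∀ z ∈ U, AEStronglyMeasurable (F z) (volume.restrict (uIoc a b)) := fun z hz =>
    ((hcont z hz).mono uIoc_subset_uIcc).aestronglyMeasurable measurableSet_uIoc
  obtain ⟨M, hM⟩ := ((isCompact_closedBall z₀ r).prod (isCompact_uIcc (a := a) (b := b))
    ).exists_bound_of_continuousOn (hF.mono (prod_mono hrU Subset.rfl))
  have hdiff : ∀ t ∈ uIoc a b, ∀ z ∈ U, HasDerivAt (fun z => F z t) (deriv (fun z => F z t) z) z :=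
    fun t ht z hz => ((hd t (uIoc_subset_uIcc ht)).differentiableAt (hU.mem_nhds hz)).hasDerivAt
  have hsub : ∀ z ∈ ball z₀ (r / 2), closedBall z (r / 2) ⊆ closedBall z₀ r := fun z hz =>
    closedBall_subset_closedBall' (by rw [mem_ball] at hz; linarith)
  have hball : ball z₀ (r / 2) ⊆ U := fun z hz =>
    hrU (hsub z hz (mem_closedBall_self (by positivity)))
  refine (intervalIntegral.hasDerivAt_integral_of_dominated_loc_of_deriv_le
    (F' := fun z t => deriv (fun z => F z t) z) (bound := fun _ => M / (r / 2))
    (ball_mem_nhds z₀ (half_pos hr)) ?_ (hcont z₀ hz₀).intervalIntegrable ?_ ?_ (by simp) ?_).2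
  · filter_upwards [hU.mem_nhds hz₀] with z hz using hmeas z hz
  · classical
    refine aestronglyMeasurable_of_tendsto_ae (𝓝[≠] (0 : ℂ))
      (f := fun s t => if z₀ + s ∈ U then s⁻¹ • (F (z₀ + s) t - F z₀ t) else 0) (fun s => ?_) ?_
    · by_cases hs : z₀ + s ∈ U
      · simp only [hs, if_true]
        exact ((hmeas _ hs).sub (hmeas _ hz₀)).const_smul s⁻¹
      · simp only [hs, if_false]
        exact aestronglyMeasurable_const
    · refine (ae_restrict_iff' measurableSet_uIoc).2 (.of_forall fun t ht => ?_)
      refine (hasDerivAt_iff_tendsto_slope_zero.1 (hdiff t ht z₀ hz₀)).congr' ?_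
      have : ∀ᶠ s in 𝓝 (0 : ℂ), z₀ + s ∈ U :=
        (Continuous.continuousAt (f := fun s : ℂ => z₀ + s) (by fun_prop)).eventually_mem
          (hU.mem_nhds (by simpa using hz₀))
      filter_upwards [this.filter_mono nhdsWithin_le_nhds] with s hs
      simp [hs]
  · refine .of_forall fun t ht z hz => ?_
    refine norm_deriv_le_of_forall_mem_sphere_norm_le (half_pos hr) ?_ fun w hw => ?_
    · refine DifferentiableOn.diffContOnCl_ball (U := U) (hd t (uIoc_subset_uIcc ht)) ?_
      exact (hsub z hz).trans hrU
    · exact hM (w, t) ⟨hsub z hz (sphere_subset_closedBall hw), uIoc_subset_uIcc ht⟩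
  · exact .of_forall fun t ht z hz => hdiff t ht z (hball hz)

lemma hasDerivAt_segInt {U : Set ℂ} (hU : IsOpen U) {k : ℂ → ℂ → ℂ} {a b : ℂ}
    (hk : ContinuousOn (Function.uncurry k) (U ×ˢ segment ℝ a b))
    (hd : ∀ w ∈ segment ℝ a b, DifferentiableOn ℂ (fun z => k z w) U) {z₀ : ℂ} (hz₀ : z₀ ∈ U) :
    HasDerivAt (fun z => segInt (k z) a b) (segInt (fun w => deriv (fun z => k z w) z₀) a b) z₀ := by
  have h := hasDerivAt_integral_of_continuousOn hU (a := (0 : ℝ)) (b := 1)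
    (F := fun z t => k z (a + t • (b - a)) * (b - a)) ?_ ?_ hz₀
  · refine h.congr_deriv (intervalIntegral.integral_congr fun t ht => ?_)
    have := (hd _ (add_smul_sub_mem_segment ht)).differentiableAt (hU.mem_nhds hz₀)
    exact deriv_mul_const this _
  · refine ContinuousOn.mul (hk.comp (f := fun p : ℂ × ℝ => (p.1, a + p.2 • (b - a)))
      (Continuous.continuousOn (by fun_prop)) fun p hp => ?_) continuousOn_const
    exact ⟨hp.1, add_smul_sub_mem_segment hp.2⟩
  · exact fun t ht => (hd _ (add_smul_sub_mem_segment ht)).mul_const _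

lemma continuousOn_uncurry_dslope {U : Set ℂ} (hU : IsOpen U) {g : ℂ → ℂ}
    (hg : DifferentiableOn ℂ g U) :
    ContinuousOn (fun p : ℂ × ℂ => dslope g p.2 p.1) (U ×ˢ U) := by
  rintro ⟨z, w⟩ ⟨hz, hw⟩
  refine ContinuousAt.continuousWithinAt ?_
  by_cases hzw : z = w
  · subst hzw
    have hs : HasStrictDerivAt g (deriv g z) z :=
      (hg.analyticAt (hU.mem_nhds hz)).hasStrictDerivAt
    have hc : ContinuousAt (deriv g) z :=
      ((hg.deriv hU).differentiableAt (hU.mem_nhds hz)).continuousAt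
    rw [ContinuousAt, dslope_same, Metric.tendsto_nhds]
    intro ε hε
    have h₁ := hs.hasStrictFDerivAt.isLittleO.def (half_pos hε)
    have h₂ : ∀ᶠ p : ℂ × ℂ in 𝓝 (z, z), dist (deriv g p.2) (deriv g z) < ε :=
      (hc.comp (x := (z, z)) (f := Prod.snd) continuousAt_snd).eventually (ball_mem_nhds _ hε)
    filter_upwards [h₁, h₂] with p hp₁ hp₂
    by_cases hp : p.1 = p.2
    · rwa [hp, dslope_same]
    · have hp' : 0 < ‖p.1 - p.2‖ := norm_pos_iff.2 (sub_ne_zero.2 hp)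
      rw [dslope_of_ne _ hp, slope_def_field, dist_eq_norm]
      have : (g p.1 - g p.2) / (p.1 - p.2) - deriv g z
          = (g p.1 - g p.2 - (p.1 - p.2) • deriv g z) / (p.1 - p.2) := by
        have := sub_ne_zero.2 hp
        rw [smul_eq_mul]
        field_simp
      rw [ContinuousLinearMap.toSpanSingleton_apply] at hp₁
      rw [this, norm_div, div_lt_iff₀ hp']
      nlinarith
  · have hne : ∀ᶠ p : ℂ × ℂ in 𝓝 (z, w), p.1 ≠ p.2 :=
      (isOpen_ne_fun continuous_fst continuous_snd).mem_nhds hzw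
    have hgz : ContinuousAt g z := (hg.differentiableAt (hU.mem_nhds hz)).continuousAt
    have hgw : ContinuousAt g w := (hg.differentiableAt (hU.mem_nhds hw)).continuousAt
    have : ContinuousAt (fun p : ℂ × ℂ => (g p.1 - g p.2) / (p.1 - p.2)) (z, w) :=
      ((hgz.comp (x := (z, w)) (f := Prod.fst) continuousAt_fst).sub
        (hgw.comp (x := (z, w)) (f := Prod.snd) continuousAt_snd)).div (by fun_prop)
        (sub_ne_zero.2 hzw)
    refine this.congr ?_
    filter_upwards [hne] with p hp
    rw [dslope_of_ne _ hp, slope_def_field]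

/-- The integral of `g` along a chain of oriented segments, given by their endpoints. -/
def chainInt (g : ℂ → ℂ) (l : List (ℂ × ℂ)) : ℂ :=
  (l.map fun e => segInt g e.1 e.2).sum

/-- The value of `F` on the boundary of a chain of oriented segments. -/
def chainBoundary (l : List (ℂ × ℂ)) (F : ℂ → ℂ) : ℂ :=
  (l.map fun e => F e.2 - F e.1).sum

/-- All segments of the chain lie in `K`. -/
def ChainIn (K : Set ℂ) (l : List (ℂ × ℂ)) : Prop :=
  ∀ e ∈ l, segment ℝ e.1 e.2 ⊆ K

lemma ChainIn.exists_isCompact {U : Set ℂ} {l : List (ℂ × ℂ)} (hl : ChainIn U l) :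
    ∃ K ⊆ U, IsCompact K ∧ ChainIn K l := by
  refine ⟨⋃ e ∈ {e | e ∈ l}, segment ℝ e.1 e.2, iUnion₂_subset hl,
    l.finite_toSet.isCompact_biUnion fun e _ => ?_, fun e he =>
      subset_iUnion₂_of_subset e he Subset.rfl⟩
  rw [segment_eq_image']
  exact isCompact_Icc.image (by fun_prop)

lemma chainInt_congr {K : Set ℂ} {g₁ g₂ : ℂ → ℂ} {l : List (ℂ × ℂ)} (hl : ChainIn K l)
    (h : EqOn g₁ g₂ K) : chainInt g₁ l = chainInt g₂ l := by
  rw [chainInt, chainInt]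
  congr 1
  exact List.map_congr_left fun e he => segInt_congr (h.mono (hl e he))

lemma chainInt_sub_mul {K : Set ℂ} {g₁ g₂ : ℂ → ℂ} {l : List (ℂ × ℂ)} (hl : ChainIn K l)
    (h₁ : ContinuousOn g₁ K) (h₂ : ContinuousOn g₂ K) (c : ℂ) :
    chainInt (fun w => g₁ w - c * g₂ w) l = chainInt g₁ l - c * chainInt g₂ l := by
  induction l with
  | nil => simp [chainInt]
  | cons e l ih =>
    have he := hl e List.mem_cons_self
    have ih := ih fun e he => hl e (List.mem_cons_of_mem _ he)
    simp only [chainInt, List.map_cons, List.sum_cons] at ih ⊢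
    rw [ih, segInt_sub_mul (h₁.mono he) (h₂.mono he) c]
    ring

lemma chainInt_eq_boundary {K : Set ℂ} {F g : ℂ → ℂ} {l : List (ℂ × ℂ)} (hl : ChainIn K l)
    (hF : ∀ z ∈ K, HasDerivAt F (g z) z) (hg : ContinuousOn g K) :
    chainInt g l = chainBoundary l F := by
  rw [chainInt, chainBoundary]
  congr 1
  exact List.map_congr_left fun e he =>
    segInt_eq_sub (fun z hz => hF z (hl e he hz)) (hg.mono (hl e he))

lemma hasDerivAt_chainInt {U K : Set ℂ} (hU : IsOpen U) {k : ℂ → ℂ → ℂ} {l : List (ℂ × ℂ)}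
    (hl : ChainIn K l) (hk : ContinuousOn (Function.uncurry k) (U ×ˢ K))
    (hd : ∀ w ∈ K, DifferentiableOn ℂ (fun z => k z w) U) {z₀ : ℂ} (hz₀ : z₀ ∈ U) :
    HasDerivAt (fun z => chainInt (k z) l) (chainInt (fun w => deriv (fun z => k z w) z₀) l) z₀ := by
  induction l with
  | nil => simpa [chainInt] using hasDerivAt_const z₀ (0 : ℂ)
  | cons e l ih =>
    have he := hl e List.mem_cons_self
    simp only [chainInt, List.map_cons, List.sum_cons]
    exact (hasDerivAt_segInt hU (hk.mono (prod_mono Subset.rfl he))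
      (fun w hw => hd w (he hw)) hz₀).add (ih fun e he => hl e (List.mem_cons_of_mem _ he))

lemma exists_norm_chainInt_le (l : List (ℂ × ℂ)) : ∃ L : ℝ, ∀ (K : Set ℂ) (g : ℂ → ℂ) (C : ℝ),
    ChainIn K l → (∀ z ∈ K, ‖g z‖ ≤ C) → ‖chainInt g l‖ ≤ C * L := by
  induction l with
  | nil => exact ⟨0, fun K g C _ _ => by simp [chainInt]⟩
  | cons e l ih =>
    obtain ⟨L, hL⟩ := ih
    refine ⟨‖e.2 - e.1‖ + L, fun K g C hl hg => ?_⟩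
    rw [mul_add]
    simp only [chainInt, List.map_cons, List.sum_cons]
    exact norm_add_le_of_le
      (norm_segInt_le fun z hz => hg z (hl e List.mem_cons_self hz))
      (hL K g C (fun e he => hl e (List.mem_cons_of_mem _ he)) hg)

lemma hasDerivAt_inv_sub_left {z w : ℂ} (h : z ≠ w) :
    HasDerivAt (fun y => (w - y)⁻¹) (((w - z) ^ 2)⁻¹) z := by
  have h₁ : HasDerivAt (fun y => w - y) (-1) z := by
    simpa using (hasDerivAt_id z).const_sub w
  exact (h₁.fun_inv (sub_ne_zero.2 h.symm)).congr_deriv (by ring)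

lemma hasDerivAt_neg_inv_sub {z w : ℂ} (h : w ≠ z) :
    HasDerivAt (fun y => -(y - z)⁻¹) (((w - z) ^ 2)⁻¹) w := by
  have h₁ : HasDerivAt (fun y => y - z) 1 w := by
    simpa using (hasDerivAt_id w).sub_const z
  exact (h₁.fun_inv (sub_ne_zero.2 h)).fun_neg.congr_deriv (by ring)

lemma continuousOn_uncurry_mul_inv_sub {K : Set ℂ} {g : ℂ → ℂ} (hg : ContinuousOn g K) :
    ContinuousOn (Function.uncurry fun z w => g w * (w - z)⁻¹) (Kᶜ ×ˢ K) := by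
  refine (hg.comp continuousOn_snd fun p hp => hp.2).mul (ContinuousOn.inv₀ (by fun_prop) ?_)
  rintro ⟨z, w⟩ ⟨hz, hw⟩ h
  rw [sub_eq_zero] at h
  simp only at h hz hw
  exact hz (h ▸ hw)

lemma differentiableOn_mul_inv_sub {K : Set ℂ} (c : ℂ) {w : ℂ} (hw : w ∈ K) :
    DifferentiableOn ℂ (fun z => c * (w - z)⁻¹) Kᶜ := fun z hz =>
  ((hasDerivAt_inv_sub_left (by rintro rfl; exact hz hw)).const_mul c
    ).differentiableAt.differentiableWithinAt

lemma differentiableOn_chainInt_mul_inv_sub {K : Set ℂ} (hK : IsClosed K) {l : List (ℂ × ℂ)}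
    (hl : ChainIn K l) {g : ℂ → ℂ} (hg : ContinuousOn g K) :
    DifferentiableOn ℂ (fun z => chainInt (fun w => g w * (w - z)⁻¹) l) Kᶜ := fun _ hz =>
  (hasDerivAt_chainInt hK.isOpen_compl hl (continuousOn_uncurry_mul_inv_sub hg)
    (fun _ hw => differentiableOn_mul_inv_sub _ hw) hz).differentiableAt.differentiableWithinAt

/-- The Cauchy transform `z ↦ ∮ (w - z)⁻¹ dw` along a cycle is locally constant off the cycle. -/
lemma deriv_chainInt_inv_sub {K : Set ℂ} (hK : IsClosed K) {l : List (ℂ × ℂ)}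
    (hl : ChainIn K l) (hc : ∀ F, chainBoundary l F = 0) {z : ℂ} (hz : z ∈ Kᶜ) :
    deriv (fun z => chainInt (fun w => 1 * (w - z)⁻¹) l) z = 0 := by
  have hne : ∀ w ∈ K, w ≠ z := fun w hw h => hz (h ▸ hw)
  rw [(hasDerivAt_chainInt hK.isOpen_compl hl (continuousOn_uncurry_mul_inv_sub
    continuousOn_const) (fun _ hw => differentiableOn_mul_inv_sub _ hw) hz).deriv,
    chainInt_congr hl (g₂ := fun w => ((w - z) ^ 2)⁻¹),
    chainInt_eq_boundary hl (fun w hw => hasDerivAt_neg_inv_sub (hne w hw)), hc]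
  · exact ContinuousOn.inv₀ (by fun_prop) fun w hw => pow_ne_zero 2 (sub_ne_zero.2 (hne w hw))
  · intro w hw
    simpa using (hasDerivAt_inv_sub_left (hne w hw).symm).deriv

lemma chainInt_eq_zero_of_ball {l : List (ℂ × ℂ)} (hc : ∀ F, chainBoundary l F = 0) {c : ℂ}
    {r : ℝ} (hl : ChainIn (ball c r) l) {g : ℂ → ℂ} (hg : DifferentiableOn ℂ g (ball c r)) :
    chainInt g l = 0 := by
  obtain ⟨F, hF⟩ := hg.isExactOn_ball
  rw [chainInt_eq_boundary hl hF hg.continuousOn, hc]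

/-- A cycle in a bounded set with connected complement winds around no point of the complement,
even in a neighbourhood. -/
lemma eventually_chainInt_inv_sub_eq_zero {U K : Set ℂ} (hUb : Bornology.IsBounded U)
    (hUc : IsPreconnected Uᶜ) (hK : IsClosed K) (hKU : K ⊆ U) {l : List (ℂ × ℂ)}
    (hl : ChainIn K l) (hc : ∀ F, chainBoundary l F = 0) {z : ℂ} (hz : z ∈ Uᶜ) :
    ∀ᶠ y in 𝓝 z, y ∈ Kᶜ ∧ chainInt (fun w => 1 * (w - y)⁻¹) l = 0 := by
  set n : ℂ → ℂ := fun y => chainInt (fun w => 1 * (w - y)⁻¹) l with hn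
  have hdiff : DifferentiableOn ℂ n Kᶜ :=
    differentiableOn_chainInt_mul_inv_sub hK hl continuousOn_const
  have hopen : ∀ t : Set ℂ, IsOpen (Kᶜ ∩ n ⁻¹' t) :=
    hK.isOpen_compl.isOpen_inter_preimage_of_deriv_eq_zero hdiff
      fun y hy => deriv_chainInt_inv_sub hK hl hc hy
  suffices Uᶜ ⊆ Kᶜ ∩ n ⁻¹' {0} from (hopen {0}).mem_nhds (this hz)
  refine hUc.subset_left_of_subset_union (hopen {0}) (hopen {0}ᶜ) ?_ ?_ ?_
  · exact (disjoint_compl_right.preimage n).mono inter_subset_right inter_subset_right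
  · rw [← inter_union_distrib_left, ← preimage_union, union_compl_self]
    simpa using hKU
  · obtain ⟨R, hR⟩ := hUb.subset_ball 0
    obtain ⟨y, hy⟩ := NormedField.exists_lt_norm ℂ R
    have hyR : y ∉ ball (0 : ℂ) R := by simpa using hy.le
    refine ⟨y, fun h => hyR (hR h), fun h => hyR (hR (hKU h)), ?_⟩
    refine chainInt_eq_zero_of_ball (c := 0) (r := R) hc
      (fun e he => ((hl e he).trans hKU).trans hR) fun w hw => ?_
    have : w - y ≠ 0 := sub_ne_zero.2 fun h => hyR (h ▸ hw)
    fun_prop (disch := assumption)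

lemma tendsto_chainInt_mul_inv_sub {K : Set ℂ} (hK : IsCompact K) {l : List (ℂ × ℂ)}
    (hl : ChainIn K l) {g : ℂ → ℂ} (hg : ContinuousOn g K) :
    Tendsto (fun z => chainInt (fun w => g w * (w - z)⁻¹) l) (cocompact ℂ) (𝓝 0) := by
  obtain ⟨L, hL⟩ := exists_norm_chainInt_le l
  obtain ⟨M, hM⟩ := hK.exists_bound_of_continuousOn hg
  obtain ⟨R, hR⟩ := hK.isBounded.exists_norm_le
  have hlim : Tendsto (fun z : ℂ => M * (‖z‖ - R)⁻¹ * L) (cocompact ℂ) (𝓝 0) := by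
    have : Tendsto (fun z : ℂ => ‖z‖ - R) (cocompact ℂ) atTop :=
      tendsto_atTop_add_const_right _ (-R) (tendsto_norm_cocompact_atTop (E := ℂ))
    simpa using ((tendsto_inv_atTop_zero.comp this).const_mul M).mul_const L
  refine squeeze_zero_norm' ?_ hlim
  filter_upwards [(tendsto_norm_cocompact_atTop (E := ℂ)).eventually_gt_atTop R] with z hz
  refine hL K _ _ hl fun w hw => ?_
  rw [norm_mul, norm_inv]
  have h₁ : ‖z‖ - R ≤ ‖w - z‖ := by
    have := norm_sub_norm_le z w
    rw [norm_sub_rev] at this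
    linarith [hR w hw]
  have h₂ : 0 ≤ M := (norm_nonneg _).trans (hM w hw)
  have h₃ : 0 < ‖z‖ - R := sub_pos.2 hz
  gcongr
  exact hM w hw

/-- Dixon's form of the Cauchy integral formula: for a cycle in `U`, the integral of the
difference quotient of a holomorphic function vanishes. -/
lemma chainInt_dslope_eq_zero {U : Set ℂ} (hU : IsOpen U) (hUb : Bornology.IsBounded U)
    (hUc : IsPreconnected Uᶜ) {l : List (ℂ × ℂ)} (hl : ChainIn U l)
    (hc : ∀ F, chainBoundary l F = 0) {g : ℂ → ℂ} (hg : DifferentiableOn ℂ g U) {z : ℂ}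
    (hz : z ∈ U) : chainInt (fun w => dslope g w z) l = 0 := by
  classical
  obtain ⟨K, hKU, hK, hlK⟩ := hl.exists_isCompact
  set H₁ : ℂ → ℂ := fun z => chainInt (fun w => dslope g w z) l with hH₁
  set H₂ : ℂ → ℂ := fun z => chainInt (fun w => g w * (w - z)⁻¹) l with hH₂
  have hgK := hg.continuousOn.mono hKU
  have hd₁ : DifferentiableOn ℂ H₁ U := fun y hy =>
    (hasDerivAt_chainInt (k := fun z w => dslope g w z) hU hl (continuousOn_uncurry_dslope hU hg)
      (fun w hw => (differentiableOn_dslope (hU.mem_nhds hw)).2 hg)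
      hy).differentiableAt.differentiableWithinAt
  have hd₂ : DifferentiableOn ℂ H₂ Kᶜ :=
    differentiableOn_chainInt_mul_inv_sub hK.isClosed hlK hgK
  have heq : ∀ y ∈ Kᶜ, chainInt (fun w => 1 * (w - y)⁻¹) l = 0 → H₁ y = H₂ y := by
    intro y hy hn
    have hinv : ContinuousOn (fun w => (w - y)⁻¹) K :=
      ContinuousOn.inv₀ (by fun_prop) fun w hw => sub_ne_zero.2 (by rintro rfl; exact hy hw)
    have := chainInt_sub_mul (g₁ := fun w => g w * (w - y)⁻¹) (g₂ := fun w => 1 * (w - y)⁻¹) hlK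
      (hgK.mul hinv) (continuousOn_const.mul hinv) (g y)
    rw [hn, mul_zero, sub_zero] at this
    refine Eq.trans ?_ this
    refine chainInt_congr hlK fun w hw => ?_
    have hwy : y ≠ w := by rintro rfl; exact hy hw
    have h₁ := sub_ne_zero.2 hwy
    have h₂ := sub_ne_zero.2 hwy.symm
    rw [dslope_of_ne _ hwy, slope_def_field]
    field_simp
    ring
  set H : ℂ → ℂ := fun z => if z ∈ U then H₁ z else H₂ z with hH
  have hd : Differentiable ℂ H := by
    intro y
    by_cases hy : y ∈ U
    · refine (hd₁.differentiableAt (hU.mem_nhds hy)).congr_of_eventuallyEq ?_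
      filter_upwards [hU.mem_nhds hy] with x hx
      exact if_pos hx
    · have hyK : y ∈ Kᶜ := fun h => hy (hKU h)
      refine (hd₂.differentiableAt
        (hK.isClosed.isOpen_compl.mem_nhds hyK)).congr_of_eventuallyEq ?_
      filter_upwards [eventually_chainInt_inv_sub_eq_zero hUb hUc hK.isClosed hKU hlK hc hy]
        with x hx
      by_cases hxU : x ∈ U
      · rw [hH]
        simp only [if_pos hxU]
        exact heq x hx.1 hx.2
      · exact if_neg hxU
  have hlim : Tendsto H (cocompact ℂ) (𝓝 0) := by
    refine (tendsto_chainInt_mul_inv_sub hK hlK hgK).congr' ?_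
    have : Uᶜ ∈ cocompact ℂ := by
      rw [← Metric.cobounded_eq_cocompact]
      exact hUb
    filter_upwards [this] with y hy
    exact (if_neg hy).symm
  simpa [hH, hz] using hd.apply_eq_of_tendsto_cocompact z hlim

/-- Cauchy's theorem for cycles in a bounded open set with connected complement. -/
theorem chainInt_eq_zero {U : Set ℂ} (hU : IsOpen U) (hUb : Bornology.IsBounded U)
    (hUc : IsPreconnected Uᶜ) {l : List (ℂ × ℂ)} (hl : ChainIn U l)
    (hc : ∀ F, chainBoundary l F = 0) {g : ℂ → ℂ} (hg : DifferentiableOn ℂ g U) :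
    chainInt g l = 0 := by
  rcases U.eq_empty_or_nonempty with rfl | ⟨z, hz⟩
  · cases l with
    | nil => simp [chainInt]
    | cons e l => exact (hl e List.mem_cons_self (left_mem_segment ℝ _ _)).elim
  have hG : DifferentiableOn ℂ (fun w => g w * (w - z)) U := hg.mul (by fun_prop)
  rw [← chainInt_dslope_eq_zero hU hUb hUc hl hc hG hz]
  refine chainInt_congr hl fun w hw => ?_
  by_cases hwz : z = w
  · subst hwz
    have h := ((hg.differentiableAt (hU.mem_nhds hz)).hasDerivAt.mul
      ((hasDerivAt_id z).sub_const z)).deriv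
    rw [dslope_same]
    simpa using! h.symm
  · have h₁ := sub_ne_zero.2 hwz
    rw [dslope_of_ne _ hwz, slope_def_field]
    field_simp
    ring

lemma exists_chain {U : Set ℂ} (hU : IsOpen U) (hUp : IsPreconnected U) {a b : ℂ} (ha : a ∈ U)
    (hb : b ∈ U) : ∃ l, ChainIn U l ∧ ∀ F, chainBoundary l F = F b - F a := by
  refine hUp.induction₂ (fun a b => ∃ l, ChainIn U l ∧ ∀ F, chainBoundary l F = F b - F a)
    (fun x hx => ?_) ?_ ?_ ha hb
  · obtain ⟨r, hr, hrU⟩ := Metric.isOpen_iff.1 hU x hx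
    refine (Filter.Eventually.filter_mono nhdsWithin_le_nhds ?_)
    filter_upwards [ball_mem_nhds x hr] with y hy
    refine ⟨[(x, y)], ?_, fun F => by simp [chainBoundary]⟩
    simpa [ChainIn] using ((convex_ball x r).segment_subset (mem_ball_self hr) hy).trans hrU
  · rintro x y z - - - ⟨l₁, h₁, h₁'⟩ ⟨l₂, h₂, h₂'⟩
    refine ⟨l₁ ++ l₂, fun e he => (List.mem_append.1 he).elim (h₁ e) (h₂ e), fun F => ?_⟩
    have e₁ := h₁' F
    have e₂ := h₂' F
    simp only [chainBoundary] at e₁ e₂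
    simp [chainBoundary, e₁, e₂]
  · rintro x y - - ⟨l, h, h'⟩
    refine ⟨l.map Prod.swap, fun e he => ?_, fun F => ?_⟩
    · obtain ⟨e', he', rfl⟩ := List.mem_map.1 he
      rw [Prod.fst_swap, Prod.snd_swap, segment_symm]
      exact h e' he'
    · rw [← neg_sub, ← h' F]
      simp [chainBoundary, Function.comp_def, List.sum_neg]

/-- A holomorphic function on a bounded domain with connected complement has a primitive. -/
theorem isExactOn_of_isPreconnected_compl {U : Set ℂ} (hU : IsOpen U) (hUp : IsPreconnected U)
    (hUb : Bornology.IsBounded U) (hUc : IsPreconnected Uᶜ) {g : ℂ → ℂ}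
    (hg : DifferentiableOn ℂ g U) : IsExactOn g U := by
  classical
  rcases U.eq_empty_or_nonempty with rfl | ⟨a, ha⟩
  · exact ⟨0, fun z hz => hz.elim⟩
  choose! p hp hp' using fun z (hz : z ∈ U) => exists_chain hU hUp hz ha
  refine ⟨fun z => -chainInt g (p z), fun z hz => ?_⟩
  obtain ⟨r, hr, hrU⟩ := Metric.isOpen_iff.1 hU z hz
  obtain ⟨P, hP⟩ := (hg.mono hrU).isExactOn_ball
  have key : ∀ y ∈ ball z r, -chainInt g (p y) = P y - P z - chainInt g (p z) := by
    intro y hy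
    have hseg : segment ℝ y z ⊆ ball z r :=
      (convex_ball z r).segment_subset hy (mem_ball_self hr)
    obtain ⟨l, hl, hl'⟩ := exists_chain hU hUp ha (hrU hy)
    have e₁ : chainInt g ((y, z) :: p z ++ l) = 0 := by
      refine chainInt_eq_zero hU hUb hUc (fun e he => ?_) (fun F => ?_) hg
      · simp only [List.cons_append, List.mem_cons, List.mem_append] at he
        rcases he with rfl | he | he
        exacts [hseg.trans hrU, hp z hz e he, hl e he]
      · have h₁ := hp' z hz F
        have h₂ := hl' F
        simp only [chainBoundary] at h₁ h₂
        simp [chainBoundary, h₁, h₂]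
    have e₂ : chainInt g (p y ++ l) = 0 := by
      refine chainInt_eq_zero hU hUb hUc (fun e he => ?_) (fun F => ?_) hg
      · rcases List.mem_append.1 he with he | he
        exacts [hp y (hrU hy) e he, hl e he]
      · have h₁ := hp' y (hrU hy) F
        have h₂ := hl' F
        simp only [chainBoundary] at h₁ h₂
        simp [chainBoundary, h₁, h₂]
    have e₃ : segInt g y z = P z - P y :=
      segInt_eq_sub (fun w hw => hP w (hseg hw)) ((hg.continuousOn.mono hrU).mono hseg)
    simp only [chainInt, List.map_append, List.map_cons, List.sum_cons, List.sum_append,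
      List.cons_append] at e₁ e₂ ⊢
    linear_combination -e₂ + e₁ - e₃
  refine (((hP z (mem_ball_self hr)).sub_const (P z)).sub_const (chainInt g (p z))
    ).congr_of_eventuallyEq ?_
  filter_upwards [ball_mem_nhds z hr] with y hy using key y hy

/-- A nowhere-vanishing holomorphic function on a bounded domain with connected complement has a
holomorphic logarithm, normalised to vanish at a point where the function is `1`. -/
theorem exists_differentiableOn_log {U : Set ℂ} (hU : IsOpen U) (hUp : IsPreconnected U)
    (hUb : Bornology.IsBounded U) (hUc : IsPreconnected Uᶜ) {f : ℂ → ℂ}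
    (hf : DifferentiableOn ℂ f U) (hf₀ : ∀ z ∈ U, f z ≠ 0) {a : ℂ} (ha : a ∈ U) (hfa : f a = 1) :
    ∃ g : ℂ → ℂ, DifferentiableOn ℂ g U ∧ g a = 0 ∧ ∀ z ∈ U, f z = exp (g z) := by
  obtain ⟨g, hga, hg⟩ := (isExactOn_of_isPreconnected_compl hU hUp hUb hUc
    ((hf.deriv hU).div hf hf₀)).with_val_at a 0
  refine ⟨g, fun z hz => (hg z hz).differentiableAt.differentiableWithinAt, hga, fun z hz => ?_⟩
  have hd : ∀ w ∈ U, HasDerivAt (fun w => f w * exp (-g w)) 0 w := fun w hw => by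
    refine ((hf.differentiableAt (hU.mem_nhds hw)).hasDerivAt.mul
      (hg w hw).fun_neg.cexp).congr_deriv ?_
    have := hf₀ w hw
    simp only [Pi.div_apply]
    field_simp
    ring
  have h := hU.is_const_of_deriv_eq_zero hUp
    (fun w hw => (hd w hw).differentiableAt.differentiableWithinAt)
    (fun w hw => (hd w hw).deriv) hz ha
  simp only [hga, hfa, neg_zero, exp_zero, mul_one, exp_neg] at h
  rwa [mul_inv_eq_one₀ (exp_ne_zero _)] at h

/-- An open set other than the empty set with connected frontier has connected complement. -/
lemma isPreconnected_compl_of_frontier {X : Type*} [TopologicalSpace X] [PreconnectedSpace X]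
    {U : Set X} (hU : IsOpen U) (hne : U.Nonempty) (hf : IsPreconnected (frontier U)) :
    IsPreconnected Uᶜ := by
  have hfU : frontier U ⊆ Uᶜ := by
    rw [hU.frontier_eq]
    exact fun x hx => hx.2
  have aux : ∀ u v : Set X, IsClosed u → IsClosed v → Uᶜ ⊆ u ∪ v → Uᶜ ∩ (u ∩ v) = ∅ →
      frontier U ⊆ u → Uᶜ ⊆ u := by
    intro u v hu hv huv hd hfu
    have heq : Uᶜ ∩ v = (closure U)ᶜ ∩ uᶜ := by
      ext x
      constructor
      · rintro ⟨hxU, hxv⟩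
        have hxu : x ∉ u := fun h => (hd ▸ ⟨hxU, h, hxv⟩ : x ∈ (∅ : Set X))
        refine ⟨fun hxc => hxu (hfu ?_), hxu⟩
        rw [hU.frontier_eq]
        exact ⟨hxc, hxU⟩
      · rintro ⟨hxc, hxu⟩
        have hxU : x ∈ Uᶜ := fun h => hxc (subset_closure h)
        exact ⟨hxU, (huv hxU).resolve_left hxu⟩
    have hclopen : IsClopen (Uᶜ ∩ v) :=
      ⟨hU.isClosed_compl.inter hv,
        heq ▸ isClosed_closure.isOpen_compl.inter hu.isOpen_compl⟩
    rcases isClopen_iff.1 hclopen with h | h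
    · exact fun x hx => (huv hx).resolve_right fun hxv => (h ▸ ⟨hx, hxv⟩ : x ∈ (∅ : Set X))
    · obtain ⟨x, hx⟩ := hne
      exact absurd hx (h.ge (mem_univ x)).1
  rw [isPreconnected_iff_subset_of_disjoint_closed]
  intro u v hu hv huv hd
  have hsub := isPreconnected_iff_subset_of_disjoint_closed.1 hf u v hu hv (hfU.trans huv)
    (subset_empty_iff.1 (hd ▸ inter_subset_inter_left _ hfU))
  rcases hsub with h | h
  · exact .inl (aux u v hu hv huv hd h)
  · exact .inr (aux v u hv hu (union_comm u v ▸ huv) (inter_comm u v ▸ hd) h)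

lemma JordanDomain.isPreconnected_compl {W : Set ℂ} (hW : JordanDomain W) :
    IsPreconnected Wᶜ := by
  obtain ⟨ho, hc, -, φ, hφ, -, hr⟩ := hW
  refine isPreconnected_compl_of_frontier ho hc.nonempty ?_
  rw [← hr]
  have : PreconnectedSpace (sphere (0 : ℂ) 1) := isPreconnected_iff_preconnectedSpace.1
    (isPreconnected_sphere (by simp) 0 1)
  exact isPreconnected_range hφ

lemma E_eq_qParam : E = Function.Periodic.qParam 1 := by
  ext z
  simp [E, Function.Periodic.qParam]

lemma E_add_one (z : ℂ) : E (z + 1) = E z := by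
  simp [E, mul_add, exp_add]

/-- A nowhere-vanishing `1`-periodic holomorphic function `h` on `Λ = E⁻¹(D)` tending
to `1` at `i∞` has a logarithm of the form `g ∘ E` with `g` holomorphic on `D` and
`g(0) = 0`. -/
theorem periodic_nonvanishing_log
    (D : Set ℂ) (hD : JordanDomain D) (hD0 : (0 : ℂ) ∈ D)
    (h : ℂ → ℂ)
    (hhol : DifferentiableOn ℂ h (E ⁻¹' D))
    (hne : ∀ z ∈ E ⁻¹' D, h z ≠ 0)
    (hper : ∀ z ∈ E ⁻¹' D, h (z + 1) = h z)
    (hlim : Filter.Tendsto h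
      (Filter.comap Complex.im Filter.atTop ⊓ Filter.principal (E ⁻¹' D))
      (nhds 1)) :
    ∃ g : ℂ → ℂ,
      DifferentiableOn ℂ g D ∧ g 0 = 0 ∧
      ∀ z ∈ E ⁻¹' D, h z = Complex.exp (g (E z)) := by
  classical
  have hDo : IsOpen D := hD.1
  have hΛo : IsOpen (E ⁻¹' D) :=
    hDo.preimage (E_eq_qParam ▸ Function.Periodic.continuous_qParam)
  set H : ℂ → ℂ := (E ⁻¹' D).piecewise h 1 with hH
  have hHper : Function.Periodic H (1 : ℝ) := fun z => by
    have hz : z + 1 ∈ E ⁻¹' D ↔ z ∈ E ⁻¹' D := by simp [E_add_one]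
    by_cases hzD : z ∈ E ⁻¹' D
    · simp only [hH, ofReal_one, piecewise_eq_of_mem _ _ _ hzD,
        piecewise_eq_of_mem _ _ _ (hz.2 hzD), hper z hzD]
    · simp only [hH, ofReal_one, piecewise_eq_of_notMem _ _ _ hzD,
        piecewise_eq_of_notMem _ _ _ (mt hz.1 hzD), Pi.one_apply]
  have hHD : ∀ z ∈ E ⁻¹' D, DifferentiableAt ℂ H z := fun z hz =>
    (hhol.differentiableAt (hΛo.mem_nhds hz)).congr_of_eventuallyEq <| by
      filter_upwards [hΛo.mem_nhds hz] with w hw using piecewise_eq_of_mem _ _ _ hw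
  have hΛ : ∀ᶠ z in comap im atTop, z ∈ E ⁻¹' D := by
    have := tendsto_nhds_of_tendsto_nhdsWithin (Function.Periodic.qParam_tendsto one_pos)
    rw [E_eq_qParam]
    exact this.eventually_mem (hDo.mem_nhds hD0)
  have hHlim : Tendsto H (comap im atTop) (𝓝 1) := by
    rw [inf_of_le_left (b := 𝓟 (E ⁻¹' D)) (le_principal_iff.2 hΛ)] at hlim
    refine hlim.congr' ?_
    filter_upwards [hΛ] with z hz using (piecewise_eq_of_mem _ _ _ hz).symm
  have hHhol : ∀ᶠ z in comap im atTop, DifferentiableAt ℂ H z := hΛ.mono hHD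
  have hHbd : BoundedAtFilter (comap im atTop) H := hHlim.isBigO_one ℝ
  set f := Function.Periodic.cuspFunction 1 H with hf
  have hfE : ∀ z ∈ E ⁻¹' D, f (E z) = h z := fun z hz => by
    rw [hf, E_eq_qParam, Function.Periodic.eq_cuspFunction one_ne_zero hHper]
    exact piecewise_eq_of_mem _ _ _ hz
  have : (comap im atTop).NeBot := atTop_neBot.comap_of_surj im_surjective
  have hf0 : f 0 = 1 :=
    tendsto_nhds_unique (Function.Periodic.tendsto_at_I_inf one_pos hHper hHhol hHbd) hHlim
  have hsurj : ∀ q ∈ D, q ≠ 0 → ∃ z ∈ E ⁻¹' D, E z = q := fun q hq hq0 => by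
    have : E (Function.Periodic.invQParam 1 q) = q := by
      rw [E_eq_qParam, Function.Periodic.qParam_right_inv one_ne_zero hq0]
    exact ⟨_, mem_preimage.2 (this.symm ▸ hq), this⟩
  have hfd : DifferentiableOn ℂ f D := fun q hq => by
    refine DifferentiableAt.differentiableWithinAt ?_
    rcases eq_or_ne q 0 with rfl | hq0
    · exact Function.Periodic.differentiableAt_cuspFunction_zero one_pos hHper hHhol hHbd
    · obtain ⟨z, hz, rfl⟩ := hsurj q hq hq0
      rw [E_eq_qParam]
      exact Function.Periodic.differentiableAt_cuspFunction one_ne_zero hHper (hHD z hz)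
  have hfne : ∀ q ∈ D, f q ≠ 0 := fun q hq => by
    rcases eq_or_ne q 0 with rfl | hq0
    · exact hf0 ▸ one_ne_zero
    · obtain ⟨z, hz, rfl⟩ := hsurj q hq hq0
      exact hfE z hz ▸ hne z hz
  obtain ⟨g, hg, hg0, hfg⟩ := exists_differentiableOn_log hDo hD.2.1.isPreconnected hD.2.2.1
    hD.isPreconnected_compl hfd hfne hD0 hf0
  exact ⟨g, hg, hg0, fun z hz => by rw [← hfE z hz, hfg _ hz]⟩
end
end
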